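/- Let X ⊂ P^{2n} be a smooth integral nondegenerate variety of dimension n ≥ 2 with σ_2(X) = P^{2n}. Then X is of type IA (general entry locus irreducible and stable under moving the point within its span) if and only if X is a QEL-manifold, i.e. its general entry locus is an irreducible conic. -/

import Mathlib

open MvPolynomial

noncomputable section

namespace EL

variable {k : Type} [Field k] {n : ℕ}

/-- Projective space of (vector) dimension `n` over `k`. -/
abbrev PS (k : Type) [Field k] (n : ℕ) : Type := Projectivization k (Fin n → k)

/-- Projective vanishing set of a polynomial (intended to be homogeneous). -/
def V0 (f : MvPolynomial (Fin n) k) : Set (PS k n) :=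
  {p | ∀ (v : Fin n → k) (hv : v ≠ 0), Projectivization.mk k v hv = p → eval v f = 0}

/-- The Zariski topology on projective space, generated by complements of vanishing
sets of homogeneous polynomials. -/
instance : TopologicalSpace (PS k n) :=
  TopologicalSpace.generateFrom
    {U | ∃ (d : ℕ) (f : MvPolynomial (Fin n) k), f.IsHomogeneous d ∧ U = (V0 f)ᶜ}

/-- The linear span (as a submodule of the cone) of a set of projective points. -/
def pspan (S : Set (PS k n)) : Submodule k (Fin n → k) := ⨆ p ∈ S, p.submodule

/-- The projective linear subspace associated to a submodule. -/
def linSet (W : Submodule k (Fin n → k)) : Set (PS k n) := {p | p.submodule ≤ W}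

/-- `q` lies in the projective span of `S`. -/
def memSpan (q : PS k n) (S : Set (PS k n)) : Prop := q.submodule ≤ pspan S

/-- The projective dimension of the span of `S`. -/
def spanDim (S : Set (PS k n)) : ℕ := Module.finrank k ↥(pspan S) - 1

/-- `S` is nondegenerate (spans the ambient projective space). -/
def Nondeg (S : Set (PS k n)) : Prop := pspan S = ⊤

/-- `S` is a projective linear subspace of projective dimension `d`. -/
def IsLin (S : Set (PS k n)) (d : ℕ) : Prop :=
  ∃ W : Submodule k (Fin n → k), Module.finrank k ↥W = d + 1 ∧ S = linSet W

/-- Dimension of a subset, as topological Krull dimension. -/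
def pdim (S : Set (PS k n)) : WithBot ℕ∞ := topologicalKrullDim ↥S

/-- An integral (sub)variety: an irreducible Zariski-closed set. -/
def IsVariety (S : Set (PS k n)) : Prop := IsClosed S ∧ IsIrreducible S

/-- A property holds for a general point of projective space. -/
def Generic (P : PS k n → Prop) : Prop :=
  ∃ U : Set (PS k n), IsOpen U ∧ Dense U ∧ ∀ q ∈ U, P q

/-- A property holds for a general point of the set `S`. -/
def GenericIn (S : Set (PS k n)) (P : PS k n → Prop) : Prop :=
  ∃ U : Set (PS k n), IsOpen U ∧ S ⊆ closure (S ∩ U) ∧ ∀ q ∈ S ∩ U, P q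

/-- A property holds for a general tuple of points of projective space. -/
def GenericP {ι : Type} (P : (ι → PS k n) → Prop) : Prop :=
  ∃ U : Set (ι → PS k n), IsOpen U ∧ Dense U ∧ ∀ z ∈ U, P z

/-- `q` is spanned by some `s` points of `X`. -/
def hasDecomp (X : Set (PS k n)) (q : PS k n) (s : ℕ) : Prop :=
  ∃ A : Finset (PS k n), ↑A ⊆ X ∧ A.card = s ∧ memSpan q ↑A

/-- The `X`-rank of a point `q`. -/
def rk (X : Set (PS k n)) (q : PS k n) : ℕ := sInf {s | hasDecomp X q s}

/-- `A` irredundantly spans `q`. -/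
def Irredundant (q : PS k n) (A : Finset (PS k n)) : Prop :=
  memSpan q ↑A ∧ ∀ B : Finset (PS k n), B ⊂ A → ¬ memSpan q ↑B

/-- The set `𝒮(X,q)` of minimal irredundant decompositions of `q` by points of `X`. -/
def decomps (X : Set (PS k n)) (q : PS k n) : Set (Finset (PS k n)) :=
  {A | ↑A ⊆ X ∧ A.card = rk X q ∧ Irredundant q A}

/-- The entry locus of `q` with respect to `X`. -/
def entryLocus (X : Set (PS k n)) (q : PS k n) : Set (PS k n) :=
  closure (⋃ A ∈ decomps X q, (↑A : Set (PS k n)))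

/-- The `s`-th secant variety of `X`. -/
def secant (X : Set (PS k n)) (s : ℕ) : Set (PS k n) :=
  closure {q | hasDecomp X q s}

/-- The generic `X`-rank: least `s` whose secant fills the span of `X`. -/
def rgen (X : Set (PS k n)) : ℕ := sInf {s | secant X s = linSet (pspan X)}

/-- Type I: the general entry locus is irreducible. -/
def TypeI (X : Set (PS k n)) : Prop := Generic (fun q => IsIrreducible (entryLocus X q))

/-- Type II: the general entry locus is reducible. -/
def TypeII (X : Set (PS k n)) : Prop := Generic (fun q => ¬ IsIrreducible (entryLocus X q))

/-- Type A: the entry locus does not change at a general point of its span. -/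
def TypeA (X : Set (PS k n)) : Prop :=
  Generic (fun q => GenericIn (linSet (pspan (entryLocus X q)))
    (fun o => entryLocus X o = entryLocus X q))

/-- `S` (of dimension `m`) has degree `d`: `d` is the largest finite number of points cut
on `S` by a linear subspace of complementary dimension. -/
def HasDegree (S : Set (PS k n)) (m d : ℕ) : Prop :=
  IsGreatest {t | ∃ L : Set (PS k n), IsLin L (n - 1 - m) ∧ (S ∩ L).Finite ∧
    (S ∩ L).ncard = t} d

/-- All secant varieties of `Y` (of dimension `m`) have the expected dimension. -/
def NonDefective (Y : Set (PS k n)) (m : ℕ) : Prop :=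
  ∀ s : ℕ, 1 ≤ s →
    pdim (secant Y s) = ((min ((m+1)*s - 1) (spanDim Y) : ℕ) : WithBot ℕ∞)

/-- `π_o(T) ⊆ π_o(Y)`: every point of `T` (other than `o`) is collinear with `o`
and a point of `Y`. -/
def projLE (o : PS k n) (T Y : Set (PS k n)) : Prop :=
  ∀ t ∈ T, t ≠ o → ∃ y ∈ Y, t.submodule ≤ o.submodule ⊔ y.submodule

/-- A Segre point of the pair `(Y,T)`: projection from `o` maps `Y` and `T`
onto the same set. -/
def SegrePtPair (Y T : Set (PS k n)) (o : PS k n) : Prop :=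
  o ∉ Y ∪ T ∧ projLE o Y T ∧ projLE o T Y

/-- A Segre point of `Y`: the projection from `o` is non-birational on `Y`
(it is not generically injective). -/
def SegrePt (Y : Set (PS k n)) (o : PS k n) : Prop :=
  o ∉ Y ∧ ¬ GenericIn Y (fun y => ∀ y' ∈ Y, y'.submodule ≤ o.submodule ⊔ y.submodule → y' = y)

/-- The Segre locus of `Y`. -/
def segreLocus (Y : Set (PS k n)) : Set (PS k n) := closure {o | SegrePt Y o}

/-- `X` is a cone with vertex `v`. -/
def IsCone (X : Set (PS k n)) (v : PS k n) : Prop :=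
  ∀ p ∈ X, ∀ q : PS k n, q.submodule ≤ v.submodule ⊔ p.submodule → q ∈ X

/-- The homogeneous polynomials vanishing on `X`. -/
def homogCut (X : Set (PS k n)) : Set (MvPolynomial (Fin n) k) :=
  {f | (∃ d, f.IsHomogeneous d) ∧ X ⊆ V0 f}

/-- The span of the gradients at `p` of homogeneous polynomials vanishing on `X`. -/
def gradSpan (X : Set (PS k n)) (p : PS k n) : Submodule k (Fin n → k) :=
  Submodule.span k ((fun f => fun i => eval p.rep (pderiv i f)) '' homogCut X)

/-- Smoothness at a point of an `m`-dimensional subvariety (Jacobian criterion). -/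
def IsSmoothPt (X : Set (PS k n)) (m : ℕ) (p : PS k n) : Prop :=
  Module.finrank k ↥(gradSpan X p) = n - (m + 1)

/-- `X` (of dimension `m`) has only isolated singularities. -/
def IsolatedSings (X : Set (PS k n)) (m : ℕ) : Prop :=
  {p ∈ X | ¬ IsSmoothPt X m p}.Finite

/-- `X` (of dimension `m`) is smooth. -/
def IsSmoothVar (X : Set (PS k n)) (m : ℕ) : Prop := ∀ p ∈ X, IsSmoothPt X m p

/-- The hyperplane (as a submodule) determined by a point of the dual projective space. -/
def hypSub (a : PS k n) : Submodule k (Fin n → k) :=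
  LinearMap.ker (∑ i, a.rep i • (LinearMap.proj i : (Fin n → k) →ₗ[k] k))

/-- The hyperplane determined by a point of the dual projective space. -/
def hypOf (a : PS k n) : Set (PS k n) := linSet (hypSub a)

/-- The (geometric) genus of a space curve `C`, defined by the node count of a
projection from a general point of its span: a general point of `⟨C⟩` lies on
`(d-1)(d-2)/2 - g` secant lines of `C`. -/
def HasGenus (C : Set (PS k n)) (g : ℕ) : Prop :=
  ∃ d : ℕ, HasDegree C 1 d ∧
    GenericIn (linSet (pspan C)) (fun q =>
      2 * (decomps C q).ncard + 2 * g + 3 * d = d * d + 2)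

/-- The embedded tangent space of `X` at `p` (as a submodule of the cone). -/
def tangentSub (X : Set (PS k n)) (p : PS k n) : Submodule k (Fin n → k) :=
  ⨅ f ∈ homogCut X,
    LinearMap.ker (∑ i, (eval p.rep (pderiv i f)) • (LinearMap.proj i : (Fin n → k) →ₗ[k] k))

/-- A curve is tangentially degenerate if its general tangent line meets the
curve elsewhere. -/
def TangDeg (X : Set (PS k n)) : Prop :=
  GenericIn {p ∈ X | IsSmoothPt X 1 p}
    (fun p => ∃ y ∈ X, y ≠ p ∧ y.submodule ≤ tangentSub X p)

/-- The homogeneous ideal of `X`. -/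
def projIdeal (X : Set (PS k n)) : Ideal (MvPolynomial (Fin n) k) :=
  Ideal.span {f | X ⊆ V0 f}

/-- `X` is a normal variety: its homogeneous coordinate ring is integrally closed
in its total fraction ring. -/
def IsNormalVar (X : Set (PS k n)) : Prop :=
  ∀ x : FractionRing (MvPolynomial (Fin n) k ⧸ projIdeal X),
    IsIntegral (MvPolynomial (Fin n) k ⧸ projIdeal X) x →
      ∃ y : MvPolynomial (Fin n) k ⧸ projIdeal X,
        algebraMap (MvPolynomial (Fin n) k ⧸ projIdeal X)
          (FractionRing (MvPolynomial (Fin n) k ⧸ projIdeal X)) y = x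

/-- `C` is an irreducible component of `Y`. -/
def IsCompOf (C Y : Set (PS k n)) : Prop :=
  Maximal (fun Z => Z ⊆ Y ∧ IsIrreducible Z) C

/-- The image of `X` under the linear projection from (the linear space of) `W`,
realized inside the complementary linear space of `Λ`. -/
def projFrom (W Λ : Submodule k (Fin n → k)) (X : Set (PS k n)) : Set (PS k n) :=
  {y | y.submodule ≤ Λ ∧ ∃ x ∈ X, y.submodule ≤ W ⊔ x.submodule}

/-- Decompositions of `q` as irredundant spans of one point from each `Xs i`. -/
def tupleDecomps {s : ℕ} (Xs : Fin s → Set (PS k n)) (q : PS k n) :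
    Set (Fin s → PS k n) :=
  {p | (∀ i, p i ∈ Xs i) ∧ Function.Injective p ∧ memSpan q (Set.range p) ∧
    ∀ i, ¬ memSpan q (Set.range p \ {p i})}

/-- The entry locus of `q` with respect to the tuple of varieties `Xs`. -/
def entryLocusT {s : ℕ} (Xs : Fin s → Set (PS k n)) (q : PS k n) : Set (PS k n) :=
  closure (⋃ p ∈ tupleDecomps Xs q, Set.range p)

/-- The join of the varieties `Xs`. -/
def joinT {s : ℕ} (Xs : Fin s → Set (PS k n)) : Set (PS k n) :=
  closure {q | ∃ p : Fin s → PS k n, (∀ i, p i ∈ Xs i) ∧ memSpan q (Set.range p)}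

/-- Relation `q = F(p)` for a tuple `F` of homogeneous polynomials of the same degree. -/
def polyMapRel {N M : ℕ} (F : Fin M → MvPolynomial (Fin N) k) (p : PS k N) (q : PS k M) :
    Prop :=
  q.submodule = Submodule.span k {fun j => eval p.rep (F j)}

/-- `A` and `B` are isomorphic via mutually inverse polynomial maps. -/
def IsPolyIso {N M : ℕ} (A : Set (PS k N)) (B : Set (PS k M)) : Prop :=
  ∃ (d e : ℕ) (F : Fin M → MvPolynomial (Fin N) k) (G : Fin N → MvPolynomial (Fin M) k),
    (∀ j, (F j).IsHomogeneous d) ∧ (∀ i, (G i).IsHomogeneous e) ∧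
    (∀ p ∈ A, ∃ q ∈ B, polyMapRel F p q ∧ polyMapRel G q p) ∧
    (∀ q ∈ B, ∃ p ∈ A, polyMapRel F p q ∧ polyMapRel G q p)

/-- `A` and `B` are birational: polynomially isomorphic on dense open subsets. -/
def Birational (A B : Set (PS k n)) : Prop :=
  ∃ U V : Set (PS k n), IsOpen U ∧ IsOpen V ∧
    A ⊆ closure (A ∩ U) ∧ B ⊆ closure (B ∩ V) ∧ IsPolyIso (A ∩ U) (B ∩ V)

/-- A finite set `S` imposes independent conditions on hypersurfaces of degree `i`. -/
def ImposesIndep (S : Finset (PS k n)) (i : ℕ) : Prop :=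
  Function.Surjective (fun f : ↥(homogeneousSubmodule (Fin n) k i) =>
    fun p : ↥(↑S : Set (PS k n)) => eval (↑p : PS k n).rep (↑f : MvPolynomial (Fin n) k))

end EL

namespace EL

/-- Lifting of a ring homomorphism along a square-zero extension, for an extension of domains in
characteristic zero. -/
lemma exists_lift_of_charZero {k P L B : Type*} [Field k] [CharZero k] [CommRing P] [IsDomain P]
    [Field L] [CommRing B] [Algebra k P] [Algebra k L] [Algebra P L] [IsScalarTower k P L]
    [Algebra.EssFiniteType k L] (hinj : Function.Injective (algebraMap P L))
    (φ : P →+* B) (g : B →+* L) (hg : Function.Surjective g)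
    (hker : IsNilpotent (RingHom.ker g)) (hφ : ∀ p, g (φ p) = algebraMap P L p) :
    ∃ ψ : L →+* B, (∀ x, g (ψ x) = x) ∧ ∀ p, ψ (algebraMap P L p) = φ p := by
  have : FaithfulSMul P L := (faithfulSMul_iff_algebraMap_injective P L).2 hinj
  let _ : Algebra (FractionRing P) L := FractionRing.liftAlgebra P L
  have : IsScalarTower P (FractionRing P) L := FractionRing.isScalarTower_liftAlgebra P L
  have : IsScalarTower k (FractionRing P) L := by
    refine IsScalarTower.of_algebraMap_eq fun x => ?_
    rw [IsScalarTower.algebraMap_apply k P L, IsScalarTower.algebraMap_apply P (FractionRing P) L,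
      ← IsScalarTower.algebraMap_apply k P (FractionRing P)]
  have : CharZero (FractionRing P) := charZero_of_injective_algebraMap
    (algebraMap k (FractionRing P)).injective
  have : Algebra.EssFiniteType (FractionRing P) L := Algebra.EssFiniteType.of_comp k _ L
  have : Algebra.FormallySmooth P (FractionRing P) :=
    Algebra.FormallySmooth.of_isLocalization (nonZeroDivisors P)
  have : Algebra.FormallySmooth P L := Algebra.FormallySmooth.comp P (FractionRing P) L
  let _ : Algebra P B := φ.toAlgebra
  let g' : B →ₐ[P] L := { g with commutes' := hφ }
  let ψ : L →ₐ[P] B := Algebra.FormallySmooth.liftOfSurjective (AlgHom.id P L) g' hg hker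
  refine ⟨ψ, fun x => ?_, fun p => ψ.commutes p⟩
  exact Algebra.FormallySmooth.liftOfSurjective_apply (AlgHom.id P L) g' hg hker x

/-- The directional derivative of `f` at `z` in direction `u`. -/
def dirDeriv {K σ : Type*} [Field K] [Fintype σ] (z u : σ → K) (f : MvPolynomial σ K) : K :=
  ∑ i, eval z (pderiv i f) * u i

lemma snd_aeval_dual {k K σ : Type*} [CommRing k] [CommRing K] [Algebra k K] [Fintype σ]
    (z u : σ → K) (f : MvPolynomial σ k) :
    aeval (fun i => (TrivSqZeroExt.inl (z i) + TrivSqZeroExt.inr (u i) : DualNumber K)) f =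
      TrivSqZeroExt.inl (aeval z f) + TrivSqZeroExt.inr (∑ i, aeval z (pderiv i f) * u i) := by
  classical
  induction f using MvPolynomial.induction_on with
  | C a => simp [TrivSqZeroExt.algebraMap_eq_inl']
  | add p q hp hq =>
    simp only [map_add, hp, hq, add_mul, Finset.sum_add_distrib]
    ext <;> simp
  | mul_X p i hp =>
    simp only [map_mul, hp, aeval_X, Derivation.leibniz, pderiv_X, smul_eq_mul, map_add]
    ext
    · simp
    · simp [add_mul, Finset.sum_add_distrib, Pi.single_apply, apply_ite]
      simp [Finset.mul_sum, mul_comm, mul_left_comm]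

end EL

namespace EL

lemma exists_derivation_direction {k σ τ ι R L : Type} [Field k] [CharZero k] [Fintype σ]
    [CommRing R] [IsDomain R] [Algebra k R] [Field L] [Algebra R L] [IsFractionRing R L]
    [Algebra k L] [IsScalarTower k R L] [Algebra.EssFiniteType k R]
    (π : MvPolynomial σ k →ₐ[k] R)
    (p : τ → MvPolynomial σ k) (s : ι → MvPolynomial σ k) (A : Subalgebra k R)
    (hA : ∀ i, π (s i) ∈ A)
    (hdom : ∀ Q : MvPolynomial τ A, aeval (fun j => π (p j)) Q = 0 → Q = 0) (j₀ : τ) :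
    ∃ u : σ → L,
      (∀ f, π f = 0 → ∑ i, algebraMap R L (π (pderiv i f)) * u i = 0) ∧
      (∀ l, ∑ i, algebraMap R L (π (pderiv i (s l))) * u i = 0) ∧
      (∀ l, ∑ i, algebraMap R L (π (pderiv i (p l))) * u i =
        open Classical in if l = j₀ then 1 else 0) := by
  classical
  let e : MvPolynomial τ A →ₐ[A] L := aeval (fun j => algebraMap R L (π (p j)))
  have he : ∀ Q, e Q = algebraMap R L (aeval (fun j => π (p j)) Q) := by
    intro Q
    have : e = (IsScalarTower.toAlgHom A R L).comp
        (aeval (fun j => π (p j))) := by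
      ext j; simp [e]
    rw [this]; rfl
  let _ : Algebra (MvPolynomial τ A) L := e.toRingHom.toAlgebra
  have halg : ∀ Q : MvPolynomial τ A, algebraMap (MvPolynomial τ A) L Q = e Q := fun _ => rfl
  have : IsScalarTower k (MvPolynomial τ A) L := by
    refine IsScalarTower.of_algebraMap_eq fun c => ?_
    rw [halg, IsScalarTower.algebraMap_apply k A (MvPolynomial τ A), AlgHom.commutes,
      ← IsScalarTower.algebraMap_apply k A L]
  have hinj : Function.Injective (algebraMap (MvPolynomial τ A) L) := by
    rw [injective_iff_map_eq_zero]
    intro Q hQ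
    rw [halg, he] at hQ
    exact hdom Q ((IsFractionRing.injective R L) (by simpa using hQ))
  have : Algebra.EssFiniteType R L := Algebra.EssFiniteType.of_isLocalization L (nonZeroDivisors R)
  have : Algebra.EssFiniteType k L := Algebra.EssFiniteType.comp k R L
  let φ : MvPolynomial τ A →+* DualNumber L :=
    eval₂Hom ((TrivSqZeroExt.inlHom L L).comp (algebraMap A L))
      (fun j => TrivSqZeroExt.inl (algebraMap R L (π (p j))) +
        TrivSqZeroExt.inr (if j = j₀ then 1 else 0))
  let g : DualNumber L →+* L := (TrivSqZeroExt.fstHom L L L).toRingHom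
  have hg : Function.Surjective g := fun x => ⟨TrivSqZeroExt.inl x, rfl⟩
  have hker : IsNilpotent (RingHom.ker g) := ⟨2, TrivSqZeroExt.kerIdeal_sq L L⟩
  have hφ : ∀ Q, g (φ Q) = algebraMap (MvPolynomial τ A) L Q := by
    intro Q
    have : g.comp φ = e.toRingHom := by
      apply MvPolynomial.ringHom_ext
      · intro a; simp [g, φ, e]
      · intro j; by_cases h : j = j₀ <;> simp [g, φ, e, h]
    exact congrArg (fun h => h Q) this
  obtain ⟨ψ, hψ1, hψ2⟩ := exists_lift_of_charZero (k := k) hinj φ g hg hker hφ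
  let z : σ → L := fun i => algebraMap R L (π (X i))
  let u : σ → L := fun i => (ψ (z i)).snd
  have hz : ∀ f : MvPolynomial σ k, aeval z f = algebraMap R L (π f) := by
    intro f
    have : aeval z = (IsScalarTower.toAlgHom k R L).comp (π) := by
      ext i; simp [z]
    rw [this]; rfl
  have key : ∀ f : MvPolynomial σ k, (ψ (algebraMap R L (π f))).snd =
      ∑ i, algebraMap R L (π (pderiv i f)) * u i := by
    intro f
    have h1 : (ψ.comp (algebraMap R L)).comp π.toRingHom = (aeval (R := k) (fun i =>
        (TrivSqZeroExt.inl (z i) + TrivSqZeroExt.inr (u i) : DualNumber L))).toRingHom := by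
      apply MvPolynomial.ringHom_ext
      · intro a
        have h2 : algebraMap R L (π (C a)) =
            algebraMap (MvPolynomial τ A) L (C (algebraMap k A a)) := by
          rw [halg, he]
          simp only [aeval_C]
          rw [← algebraMap_eq, AlgHom.commutes, ← IsScalarTower.algebraMap_apply k A R]
        change ψ (algebraMap R L (π (C a))) = _
        rw [h2, hψ2]
        simp [φ, TrivSqZeroExt.algebraMap_eq_inl', ← IsScalarTower.algebraMap_apply k A L]
      · intro i
        change ψ (z i) = _
        simp only [AlgHom.toRingHom_eq_coe, RingHom.coe_coe, aeval_X]
        ext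
        · simpa [g] using hψ1 (z i)
        · simp [u]
    have h2 := congrArg (fun h => (h f).snd) h1
    change (ψ (algebraMap R L (π f))).snd = _ at h2
    rw [h2]
    change (aeval (R := k) (fun i =>
        (TrivSqZeroExt.inl (z i) + TrivSqZeroExt.inr (u i) : DualNumber L)) f).snd = _
    rw [snd_aeval_dual]
    simp [hz]
  refine ⟨u, fun f hf => ?_, fun l => ?_, fun l => ?_⟩
  · rw [← key, hf]; simp
  · rw [← key]
    have h2 : algebraMap R L (π (s l)) =
        algebraMap (MvPolynomial τ A) L (C ⟨π (s l), hA l⟩) := by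
      rw [halg, he]
      simp only [aeval_C]
      rfl
    rw [h2, hψ2]
    simp [φ]
  · rw [← key]
    have h2 : algebraMap R L (π (p l)) =
        algebraMap (MvPolynomial τ A) L (X l) := by
      rw [halg, he]
      simp only [aeval_X]
    rw [h2, hψ2]
    by_cases h : l = j₀ <;> simp [φ, h]

lemma eval_aeval {k σ τ : Type} [CommRing k] (z : σ → k) (q : τ → MvPolynomial σ k)
    (G : MvPolynomial τ k) : eval z (aeval q G) = eval (fun i => eval z (q i)) G := by
  induction G using MvPolynomial.induction_on with
  | C a => simp [← algebraMap_eq]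
  | add a b ha hb => simp only [map_add, ha, hb]
  | mul_X a i ha => simp only [map_mul, ha, aeval_X, eval_X]

lemma exists_surjective_differential_aux {k σ τ ι R L : Type} [Field k] [CharZero k] [Fintype σ]
    [Fintype τ] [CommRing R] [IsDomain R] [Algebra k R] [Field L] [Algebra R L] [IsFractionRing R L]
    [Algebra k L] [IsScalarTower k R L] [Algebra.EssFiniteType k R] (B : Set (σ → k))
    (π : MvPolynomial σ k →ₐ[k] R) (hsurj : Function.Surjective π)
    (hπ : ∀ f, π f = 0 ↔ ∀ z ∈ B, eval z f = 0)
    (p : τ → MvPolynomial σ k) (s : ι → MvPolynomial σ k)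
    (hdom : ∀ G : MvPolynomial (τ ⊕ ι) k,
      (∀ z ∈ B, eval (Sum.elim (fun j => eval z (p j)) (fun i => eval z (s i))) G = 0) →
      ∀ z ∈ B, ∀ w : τ → k, eval (Sum.elim w (fun i => eval z (s i))) G = 0)
    (g : MvPolynomial σ k) (hg : ∃ z ∈ B, eval z g ≠ 0) :
    ∃ z ∈ B, eval z g ≠ 0 ∧ ∀ w : τ → k, ∃ u : σ → k,
      (∀ f, π f = 0 → dirDeriv z u f = 0) ∧ (∀ i, dirDeriv z u (s i) = 0) ∧
      ∀ j, dirDeriv z u (p j) = w j := by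
  classical
  set A := (aeval (R := k) (fun i => π (s i))).range with hA
  have hdom' : ∀ Q : MvPolynomial τ A, aeval (fun j => π (p j)) Q = 0 → Q = 0 := by
    intro Q hQ
    obtain ⟨Q', rfl⟩ := map_surjective
      (aeval (R := k) (fun i => π (s i))).rangeRestrict.toRingHom
      (AlgHom.rangeRestrict_surjective _) Q
    set G := (sumAlgEquiv k τ ι).symm Q' with hG
    have hG' : Q' = sumAlgEquiv k τ ι G := by simp [hG]
    have h1 : ∀ G, aeval (fun j => π (p j)) (map
        (aeval (R := k) (fun i => π (s i))).rangeRestrict.toRingHom (sumAlgEquiv k τ ι G)) =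
        π (aeval (Sum.elim p s) G) := by
      intro G
      induction G using MvPolynomial.induction_on with
      | C a => simp [← algebraMap_eq]
      | add a b ha hb => simp only [map_add, ha, hb]
      | mul_X a i ha =>
        simp only [map_mul, ha]
        congr 1
        rcases i with i | i
        · simp
        · simp
    have h2 : ∀ G : MvPolynomial (τ ⊕ ι) k, ∀ w v, eval (Sum.elim w v) G =
        eval w (map (eval v) (sumAlgEquiv k τ ι G)) := by
      intro G w v
      induction G using MvPolynomial.induction_on with
      | C a => simp [← algebraMap_eq]
      | add a b ha hb => simp only [map_add, ha, hb]
      | mul_X a i ha =>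
        simp only [map_mul, ha]
        congr 1
        rcases i with i | i <;> simp
    rw [hG', h1, hπ] at hQ
    have h3 := hdom G (fun z hz => by
      rw [← hQ z hz, eval_aeval]
      congr 2
      ext i
      rcases i with i | i <;> rfl)
    ext m
    simp only [coeff_map, coeff_zero]
    change aeval (R := k) (fun i => π (s i)) (coeff m Q') = 0
    have h4 : aeval (R := k) (fun i => π (s i)) (coeff m Q') = π (aeval s (coeff m Q')) := by
      rw [← AlgHom.comp_apply]
      congr 1
      ext; simp
    rw [h4, hπ]
    intro z hz
    have h5 : map (eval (fun i => eval z (s i))) Q' = 0 := by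
      apply MvPolynomial.funext
      intro w
      rw [hG', ← h2, h3 z hz w, map_zero]
    have h6 := congrArg (coeff m) h5
    rw [coeff_map, coeff_zero] at h6
    rw [← h6, eval_aeval]
  have hex := fun j => exists_derivation_direction (L := L) π p s A (fun i => ⟨X i, by simp⟩) hdom' j
  choose u hu1 hu2 hu3 using hex
  obtain ⟨⟨b, hb⟩, hb'⟩ := IsLocalization.exist_integer_multiples_of_finite (nonZeroDivisors R)
    (fun x : τ × σ => u x.1 x.2)
  choose r hr using hb'
  obtain ⟨h, rfl⟩ := hsurj b
  have hU : ∀ x, ∃ U, π U = r x := fun x => hsurj (r x)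
  choose U hU using hU
  have hsum : ∀ f j, algebraMap R L (π (∑ i, pderiv i f * U (j, i))) =
      algebraMap R L (π h) * ∑ i, algebraMap R L (π (pderiv i f)) * u j i := by
    intro f j
    simp only [map_sum, map_mul, hU, hr, Finset.mul_sum, Algebra.smul_def]
    exact Finset.sum_congr rfl fun i _ => by
      ring
  have hinj := IsFractionRing.injective R L
  have hgh : ∃ z ∈ B, eval z (g * h) ≠ 0 := by
    by_contra! hcon
    have h0 := (hπ _).2 hcon
    rw [map_mul] at h0
    rcases mul_eq_zero.1 h0 with h0 | h0
    · obtain ⟨z, hz, hz'⟩ := hg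
      exact hz' ((hπ _).1 h0 z hz)
    · exact nonZeroDivisors.ne_zero hb h0
  obtain ⟨z, hz, hzgh⟩ := hgh
  rw [map_mul] at hzgh
  refine ⟨z, hz, left_ne_zero_of_mul hzgh, fun w => ?_⟩
  have hh := right_ne_zero_of_mul hzgh
  have hd : ∀ f, dirDeriv z (fun i => (eval z h)⁻¹ * ∑ j, w j * eval z (U (j, i))) f =
      (eval z h)⁻¹ * ∑ j, w j * eval z (∑ i, pderiv i f * U (j, i)) := by
    intro f
    simp only [dirDeriv, map_sum, map_mul, Finset.mul_sum]
    rw [Finset.sum_comm]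
    exact Finset.sum_congr rfl fun j _ => Finset.sum_congr rfl fun i _ => by ring
  have hzero : ∀ f, (∀ j, ∑ i, algebraMap R L (π (pderiv i f)) * u j i = 0) →
      ∀ j, eval z (∑ i, pderiv i f * U (j, i)) = 0 := by
    intro f hf j
    refine (hπ _).1 (hinj ?_) z hz
    rw [hsum, hf, mul_zero, map_zero]
  refine ⟨(fun i => (eval z h)⁻¹ * ∑ j, w j * eval z (U (j, i))), fun f hf => ?_, fun l => ?_, fun l => ?_⟩
  · rw [hd]
    simp [hzero f (fun j => hu1 j f (hf))]
  · rw [hd]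
    simp [hzero (s l) (fun j => hu2 j l)]
  · rw [hd]
    have h1 : ∀ j, eval z (∑ i, pderiv i (p l) * U (j, i)) = if l = j then eval z h else 0 := by
      intro j
      have : π (∑ i, pderiv i (p l) * U (j, i) - if l = j then h else 0) = 0 := by
        apply hinj
        rw [map_sub, map_sub, hsum, hu3]
        split_ifs <;> simp
      have := (hπ _).1 this z hz
      rw [map_sub, sub_eq_zero] at this
      rw [this]
      split_ifs <;> simp
    simp only [h1]
    simp only [mul_ite, mul_zero, Finset.sum_ite_eq, Finset.mem_univ, if_true]
    field_simp

/-- Generic smoothness of a dominant polynomial map on an irreducible set, relative to the map `s`: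
if the image of `(p, s)` is dense in the product of affine space with the image of `s`, then
at some point of `B` the differential of `p` along the fibres of `s` is onto. -/
lemma exists_surjective_differential_relative {k σ τ ι : Type} [Field k] [CharZero k] [Fintype σ]
    [Fintype τ] (B : Set (σ → k)) (hB : (vanishingIdeal k B).IsPrime)
    (p : τ → MvPolynomial σ k) (s : ι → MvPolynomial σ k)
    (hdom : ∀ G : MvPolynomial (τ ⊕ ι) k,
      (∀ z ∈ B, eval (Sum.elim (fun j => eval z (p j)) (fun i => eval z (s i))) G = 0) →
      ∀ z ∈ B, ∀ w : τ → k, eval (Sum.elim w (fun i => eval z (s i))) G = 0)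
    (g : MvPolynomial σ k) (hg : ∃ z ∈ B, eval z g ≠ 0) :
    ∃ z ∈ B, eval z g ≠ 0 ∧ ∀ w : τ → k, ∃ u : σ → k,
      (∀ f ∈ vanishingIdeal k B, dirDeriv z u f = 0) ∧ (∀ i, dirDeriv z u (s i) = 0) ∧
      ∀ j, dirDeriv z u (p j) = w j := by
  have hπ : ∀ f, Ideal.Quotient.mkₐ k (vanishingIdeal k B) f = 0 ↔ ∀ z ∈ B, eval z f = 0 := by
    intro f
    change Ideal.Quotient.mk _ f = 0 ↔ _
    rw [Ideal.Quotient.eq_zero_iff_mem, mem_vanishingIdeal_iff]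
    simp
  have hEFT : Algebra.EssFiniteType k (MvPolynomial σ k ⧸ vanishingIdeal k B) := inferInstance
  obtain ⟨z, hz, hgz, H⟩ := exists_surjective_differential_aux
    (L := FractionRing (MvPolynomial σ k ⧸ vanishingIdeal k B)) B
    (Ideal.Quotient.mkₐ k (vanishingIdeal k B)) (Ideal.Quotient.mkₐ_surjective _ _) hπ p s hdom g hg
  refine ⟨z, hz, hgz, fun w => ?_⟩
  obtain ⟨u, h1, h2⟩ := H w
  exact ⟨u, fun f hf => h1 f (Ideal.Quotient.eq_zero_iff_mem.2 hf), h2⟩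

lemma exists_vanishingIdeal_eq_of_mem_minimalPrimes {k σ : Type} [Field k] [Finite σ]
    (B : Set (σ → k)) (𝔭 : Ideal (MvPolynomial σ k)) (h𝔭 : 𝔭 ∈ (vanishingIdeal k B).minimalPrimes) :
    vanishingIdeal k {z ∈ B | ∀ f ∈ 𝔭, eval z f = 0} = 𝔭 := by
  classical
  have hfin := Ideal.finite_minimalPrimes_of_isNoetherianRing (MvPolynomial σ k)
    (vanishingIdeal k B)
  have hp : 𝔭.IsPrime := h𝔭.1.1
  have hex : ∀ 𝔮 ∈ hfin.toFinset.erase 𝔭, ∃ e ∈ 𝔮, e ∉ 𝔭 := by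
    intro 𝔮 h𝔮
    rw [Finset.mem_erase, Set.Finite.mem_toFinset] at h𝔮
    by_contra! hcon
    exact h𝔮.1 (le_antisymm hcon (h𝔭.2 h𝔮.2.1 hcon))
  choose! e he1 he2 using hex
  refine le_antisymm (fun f hf => ?_) (fun f hf => ?_)
  · have hE : (∏ 𝔮 ∈ hfin.toFinset.erase 𝔭, e 𝔮) ∉ 𝔭 := by
      rw [hp.prod_mem_iff]
      rintro ⟨𝔮, h𝔮, h⟩
      exact he2 𝔮 h𝔮 h
    have hmul : (∏ 𝔮 ∈ hfin.toFinset.erase 𝔭, e 𝔮) * f ∈ vanishingIdeal k B := by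
      rw [mem_vanishingIdeal_iff]
      intro z hz
      rw [map_mul]
      have hzp : (RingHom.ker (eval z)).IsPrime := RingHom.ker_isPrime _
      have hle : vanishingIdeal k B ≤ RingHom.ker (eval z) := by
        intro g hg
        simpa using (mem_vanishingIdeal_iff.1 hg) z hz
      obtain ⟨𝔮, h𝔮, h𝔮z⟩ := Ideal.exists_minimalPrimes_le hle
      by_cases h : 𝔮 = 𝔭
      · subst h
        rw [mem_vanishingIdeal_iff] at hf
        rw [hf z ⟨hz, fun g hg => by simpa using h𝔮z hg⟩, mul_zero]
      · have hmem : 𝔮 ∈ hfin.toFinset.erase 𝔭 := by simp [h, h𝔮]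
        have : eval z (e 𝔮) = 0 := by simpa using h𝔮z (he1 𝔮 hmem)
        rw [map_prod, Finset.prod_eq_zero hmem (by simpa using this), zero_mul]
    exact (hp.mem_or_mem (h𝔭.1.2 hmul)).resolve_left hE
  · rw [mem_vanishingIdeal_iff]
    intro z hz
    simpa using hz.2 f hf

/-- Generic smoothness for a dominant polynomial map on an arbitrary set. -/
lemma exists_surjective_differential {k σ τ : Type} [Field k] [CharZero k] [Fintype σ]
    [Fintype τ] (B : Set (σ → k)) (p : τ → MvPolynomial σ k)
    (hdom : ∀ G : MvPolynomial τ k, (∀ z ∈ B, eval (fun j => eval z (p j)) G = 0) → G = 0) :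
    ∃ z ∈ B, ∀ w : τ → k, ∃ u : σ → k,
      (∀ f ∈ vanishingIdeal k B, dirDeriv z u f = 0) ∧ ∀ j, dirDeriv z u (p j) = w j := by
  classical
  have hcomap : (vanishingIdeal k B).comap (aeval (R := k) p).toRingHom = ⊥ := by
    rw [eq_bot_iff]
    intro G hG
    refine hdom G fun z hz => ?_
    rw [← eval_aeval]
    simpa using (mem_vanishingIdeal_iff.1 hG) z hz
  have hmin : (⊥ : Ideal (MvPolynomial τ k)) ∈
      ((vanishingIdeal k B).comap (aeval (R := k) p).toRingHom).minimalPrimes := by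
    rw [hcomap]
    exact ⟨⟨Ideal.isPrime_bot, le_rfl⟩, fun _ _ _ => bot_le⟩
  obtain ⟨𝔭, h𝔭, h𝔭c⟩ := Ideal.exists_minimalPrimes_comap_eq _ _ hmin
  set B' := {z ∈ B | ∀ f ∈ 𝔭, eval z f = 0} with hB'
  have hI : vanishingIdeal k B' = 𝔭 := exists_vanishingIdeal_eq_of_mem_minimalPrimes B 𝔭 h𝔭
  have hp : (vanishingIdeal k B').IsPrime := hI ▸ h𝔭.1.1
  obtain ⟨z, hz, -, H⟩ := exists_surjective_differential_relative B' hp p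
    (fun i : Empty => i.elim) (fun G hG z _ w => by
      have h0 : rename (Sum.elim id Empty.elim) G ∈
          𝔭.comap (aeval (R := k) p).toRingHom := by
        rw [← hI, Ideal.mem_comap, mem_vanishingIdeal_iff]
        intro z hz
        rw [← hG z hz]
        change aeval z (aeval p (rename (Sum.elim id Empty.elim) G)) = _
        rw [← coe_aeval_eq_eval] 
        simp only [aeval_rename]
        rw [← AlgHom.comp_apply, comp_aeval]
        change aeval _ G = aeval _ G
        congr 2
        ext i
        rcases i with i | i
        · rfl
        · exact i.elim
      rw [h𝔭c, Ideal.mem_bot] at h0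
      have h1 := congrArg (eval w) h0
      rw [eval_rename, map_zero] at h1
      rw [← h1]
      congr 2
      ext i
      rcases i with i | i
      · rfl
      · exact i.elim) 1 (by
      by_contra! hcon
      apply hp.ne_top
      rw [Ideal.eq_top_iff_one, mem_vanishingIdeal_iff]
      intro z hz
      simpa using hcon z hz)
  refine ⟨z, hz.1, fun w => ?_⟩
  obtain ⟨u, hu1, -, hu3⟩ := H w
  refine ⟨u, fun f hf => hu1 f ?_, hu3⟩
  rw [mem_vanishingIdeal_iff] at hf ⊢
  exact fun z hz => hf z hz.1

end EL

namespace EL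

section Polynomials

variable {k σ τ : Type} [Field k]

lemma IsHomogeneous.eval_smul {f : MvPolynomial σ k} {d : ℕ} (hf : f.IsHomogeneous d)
    (c : k) (v : σ → k) : eval (c • v) f = c ^ d * eval v f := by
  rw [eval_eq, eval_eq, Finset.mul_sum]
  refine Finset.sum_congr rfl fun m hm => ?_
  have hd := hf.degree_eq_sum_deg_support hm
  simp only [Pi.smul_apply, smul_eq_mul, mul_pow, Finset.prod_mul_distrib, Finset.prod_pow_eq_pow_sum]
  rw [hd]
  ring

/-- The restriction of `f` to the parametrized line `t ↦ v + t w`. -/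
def linePoly (f : MvPolynomial σ k) (v w : σ → k) : Polynomial k :=
  aeval (fun i => Polynomial.C (v i) + Polynomial.X * Polynomial.C (w i)) f

lemma eval_linePoly (f : MvPolynomial σ k) (v w : σ → k) (t : k) :
    (linePoly f v w).eval t = eval (v + t • w) f := by
  rw [linePoly]
  induction f using MvPolynomial.induction_on with
  | C a => simp
  | add p q hp hq => simp only [map_add, Polynomial.eval_add, hp, hq]
  | mul_X p i hp =>
    rw [map_mul, Polynomial.eval_mul, hp, map_mul]
    simp only [aeval_X, eval_X, Polynomial.eval_add, Polynomial.eval_mul, Polynomial.eval_C,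
      Polynomial.eval_X, Pi.add_apply, Pi.smul_apply, smul_eq_mul]

lemma eval_smul_eq_sum (f : MvPolynomial σ k) (c : k) (v : σ → k) :
    eval (c • v) f = ∑ i ∈ Finset.range (f.totalDegree + 1),
      eval v (homogeneousComponent i f) * c ^ i := by
  conv_lhs => rw [← sum_homogeneousComponent f]
  rw [map_sum]
  refine Finset.sum_congr rfl fun i _ => ?_
  rw [IsHomogeneous.eval_smul (homogeneousComponent_isHomogeneous i f), mul_comm]

/-- A set of vectors closed under scalar multiplication. -/
def IsConical (K : Set (σ → k)) : Prop := ∀ (c : k), ∀ v ∈ K, c • v ∈ K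

lemma linePoly_zero_coeff (f : MvPolynomial σ k) (v : σ → k) (i : ℕ) [Infinite k] :
    (linePoly f 0 v).coeff i = eval v (homogeneousComponent i f) := by
  have h : linePoly f 0 v = ∑ i ∈ Finset.range (f.totalDegree + 1),
      Polynomial.C (eval v (homogeneousComponent i f)) * Polynomial.X ^ i := by
    apply Polynomial.funext
    intro c
    rw [eval_linePoly, zero_add, eval_smul_eq_sum]
    simp [Polynomial.eval_finsetSum]
  rw [h]
  simp only [Polynomial.finsetSum_coeff, Polynomial.coeff_C_mul, Polynomial.coeff_X_pow, mul_ite,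
    mul_one, mul_zero, Finset.sum_ite_eq, Finset.mem_range]
  split_ifs with hi
  · rfl
  · rw [homogeneousComponent_eq_zero _ _ (by omega), map_zero]

lemma IsConical.homogeneousComponent_eq_zero [Infinite k] {K : Set (σ → k)} (hK : IsConical K)
    {f : MvPolynomial σ k} (hf : ∀ v ∈ K, eval v f = 0) (i : ℕ) :
    ∀ v ∈ K, eval v (homogeneousComponent i f) = 0 := by
  intro v hv
  rw [← linePoly_zero_coeff]
  have : linePoly f 0 v = 0 := Polynomial.funext fun c => by
    rw [eval_linePoly, zero_add, hf _ (hK c v hv), Polynomial.eval_zero]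
  rw [this, Polynomial.coeff_zero]

lemma exists_homogeneousComponent_eval_ne_zero {f : MvPolynomial σ k} {v : σ → k}
    (h : eval v f ≠ 0) : ∃ i, eval v (homogeneousComponent i f) ≠ 0 := by
  by_contra! hcon
  apply h
  rw [← sum_homogeneousComponent f, map_sum]
  exact Finset.sum_eq_zero fun i _ => hcon i

lemma exists_homogeneousComponent_ne_zero {f : MvPolynomial σ k}
    (h : f ≠ 0) : ∃ i, homogeneousComponent i f ≠ 0 := by
  by_contra! hcon
  apply h
  rw [← sum_homogeneousComponent f]
  exact Finset.sum_eq_zero fun i _ => hcon i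

lemma exists_smul_eval_ne_zero [Infinite k] {f g : MvPolynomial σ k} {v : σ → k} {i j : ℕ}
    (hf : eval v (homogeneousComponent i f) ≠ 0) (hg : eval v (homogeneousComponent j g) ≠ 0) :
    ∃ c : k, c ≠ 0 ∧ eval (c • v) f ≠ 0 ∧ eval (c • v) g ≠ 0 := by
  by_contra! hcon
  have h1 : Polynomial.X * (linePoly f 0 v * linePoly g 0 v) = 0 := Polynomial.funext fun c => by
    rw [Polynomial.eval_mul, Polynomial.eval_mul, eval_linePoly, eval_linePoly, zero_add,
      Polynomial.eval_zero, Polynomial.eval_X]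
    by_cases hc : c = 0
    · rw [hc, zero_mul]
    by_cases h : eval (c • v) f = 0
    · rw [h, zero_mul, mul_zero]
    · rw [hcon c hc h, mul_zero, mul_zero]
  rcases mul_eq_zero.1 ((mul_eq_zero.1 h1).resolve_left Polynomial.X_ne_zero) with h | h
  · rw [← linePoly_zero_coeff, h] at hf; simp at hf
  · rw [← linePoly_zero_coeff, h] at hg; simp at hg

lemma IsConical.vanishingIdeal_isPrime [Infinite k] {K : Set (σ → k)} (hK : IsConical K)
    (hne : K.Nonempty)
    (h : ∀ f g : MvPolynomial σ k, ∀ d e, f.IsHomogeneous d → g.IsHomogeneous e →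
      (∃ v ∈ K, eval v f ≠ 0) → (∃ v ∈ K, eval v g ≠ 0) →
      ∃ v ∈ K, eval v f ≠ 0 ∧ eval v g ≠ 0) : (vanishingIdeal k K).IsPrime := by
  have hmem : ∀ f, f ∉ vanishingIdeal k K ↔ ∃ v ∈ K, eval v f ≠ 0 := by
    intro f
    rw [mem_vanishingIdeal_iff]
    push Not
    simp
  refine ⟨fun htop => ?_, fun {f g} hfg => ?_⟩
  · obtain ⟨v, hv⟩ := hne
    have := (mem_vanishingIdeal_iff.1 ((Ideal.eq_top_iff_one _).1 htop)) v hv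
    simp at this
  · by_contra! hcon
    obtain ⟨⟨v, hv, hfv⟩, ⟨w, hw, hgw⟩⟩ := And.intro ((hmem f).1 hcon.1) ((hmem g).1 hcon.2)
    obtain ⟨i, hi⟩ := exists_homogeneousComponent_eval_ne_zero hfv
    obtain ⟨j, hj⟩ := exists_homogeneousComponent_eval_ne_zero hgw
    obtain ⟨z, hz, hz1, hz2⟩ := h _ _ i j (homogeneousComponent_isHomogeneous i f)
      (homogeneousComponent_isHomogeneous j g) ⟨v, hv, hi⟩ ⟨w, hw, hj⟩
    obtain ⟨c, -, hc1, hc2⟩ := exists_smul_eval_ne_zero hz1 hz2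
    have := (mem_vanishingIdeal_iff.1 hfg) _ (hK c z hz)
    rw [map_mul] at this
    exact mul_ne_zero hc1 hc2 (by simpa using this)

/-- Pullback of a polynomial along a linear map. -/
def pullback [Fintype σ] [DecidableEq σ] (e : (σ → k) →ₗ[k] (τ → k)) (f : MvPolynomial τ k) :
    MvPolynomial σ k :=
  aeval (fun i => ∑ j, C (e (Pi.single j 1) i) * X j) f

lemma eval_pullback [Fintype σ] [DecidableEq σ] (e : (σ → k) →ₗ[k] (τ → k))
    (f : MvPolynomial τ k) (v : σ → k) : eval v (pullback e f) = eval (e v) f := by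
  rw [pullback, eval_aeval]
  congr 2
  ext i
  conv_rhs => rw [pi_eq_sum_univ' v, map_sum]
  simp [mul_comm]

lemma pullback_isHomogeneous [Fintype σ] [DecidableEq σ] (e : (σ → k) →ₗ[k] (τ → k))
    {f : MvPolynomial τ k} {d : ℕ} (hf : f.IsHomogeneous d) : (pullback e f).IsHomogeneous d := by
  have := hf.aeval (fun i => ∑ j, C (e (Pi.single j 1) i) * X j) (n := 1) (fun i =>
    IsHomogeneous.sum _ _ _ fun j _ => isHomogeneous_C_mul_X _ _)
  rwa [one_mul] at this

end Polynomials

section Topology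

variable {k : Type} [Field k] {N : ℕ}

/-- The affine cone over a subset of projective space, including the origin. -/
def cone (S : Set (PS k N)) : Set (Fin N → k) :=
  {v | ∀ hv : v ≠ 0, Projectivization.mk k v hv ∈ S}

lemma mem_cone_iff {S : Set (PS k N)} {v : Fin N → k} (hv : v ≠ 0) :
    v ∈ cone S ↔ Projectivization.mk k v hv ∈ S := ⟨fun h => h hv, fun h _ => h⟩

lemma rep_mem_cone {S : Set (PS k N)} {p : PS k N} : p.rep ∈ cone S ↔ p ∈ S := by
  rw [mem_cone_iff p.rep_nonzero, Projectivization.mk_rep]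

lemma zero_mem_cone (S : Set (PS k N)) : (0 : Fin N → k) ∈ cone S := fun h => absurd rfl h

lemma isConical_cone (S : Set (PS k N)) : IsConical (cone S) := by
  intro c v hv h
  have hc : c ≠ 0 := fun h0 => h (by rw [h0, zero_smul])
  have hv0 : v ≠ 0 := fun h0 => h (by rw [h0, smul_zero])
  have : Projectivization.mk k (c • v) h = Projectivization.mk k v hv0 :=
    (Projectivization.mk_eq_mk_iff' k _ _ h hv0).2 ⟨c, rfl⟩
  rw [this]
  exact hv hv0

lemma mk_mem_V0 {f : MvPolynomial (Fin N) k} {d : ℕ} (hf : f.IsHomogeneous d) {v : Fin N → k}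
    (hv : v ≠ 0) : Projectivization.mk k v hv ∈ V0 f ↔ eval v f = 0 := by
  refine ⟨fun h => h v hv rfl, fun h w hw hwv => ?_⟩
  obtain ⟨c, rfl⟩ := (Projectivization.mk_eq_mk_iff' k _ _ hw hv).1 hwv
  rw [IsHomogeneous.eval_smul hf, h, mul_zero]

lemma mem_V0_iff_rep {f : MvPolynomial (Fin N) k} {d : ℕ} (hf : f.IsHomogeneous d) {p : PS k N} :
    p ∈ V0 f ↔ eval p.rep f = 0 := by
  conv_lhs => rw [← Projectivization.mk_rep p]
  exact mk_mem_V0 hf p.rep_nonzero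

lemma isOpen_compl_V0 {f : MvPolynomial (Fin N) k} {d : ℕ} (hf : f.IsHomogeneous d) :
    IsOpen (V0 f)ᶜ := TopologicalSpace.isOpen_generateFrom_of_mem ⟨d, f, hf, rfl⟩

lemma isClosed_V0 {f : MvPolynomial (Fin N) k} {d : ℕ} (hf : f.IsHomogeneous d) :
    IsClosed (V0 f) := ⟨isOpen_compl_V0 hf⟩

lemma exists_basic_of_mem_isOpen {U : Set (PS k N)} (hU : IsOpen U) {p : PS k N} (hp : p ∈ U) :
    ∃ (d : ℕ) (f : MvPolynomial (Fin N) k), f.IsHomogeneous d ∧ p ∉ V0 f ∧ (V0 f)ᶜ ⊆ U := by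
  induction hU with
  | basic s hs =>
    obtain ⟨d, f, hf, rfl⟩ := hs
    exact ⟨d, f, hf, hp, le_rfl⟩
  | univ =>
    refine ⟨0, 1, isHomogeneous_one _ _, ?_, Set.subset_univ _⟩
    rw [mem_V0_iff_rep (isHomogeneous_one _ _)]
    simp
  | inter s t _ _ hs ht =>
    obtain ⟨d, f, hf, hpf, hfs⟩ := hs hp.1
    obtain ⟨e, g, hg, hpg, hgs⟩ := ht hp.2
    refine ⟨d + e, f * g, hf.mul hg, ?_, ?_⟩
    · rw [mem_V0_iff_rep (hf.mul hg), map_mul]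
      rw [mem_V0_iff_rep hf] at hpf
      rw [mem_V0_iff_rep hg] at hpg
      exact mul_ne_zero hpf hpg
    · intro q hq
      rw [Set.mem_compl_iff, mem_V0_iff_rep (hf.mul hg), map_mul] at hq
      refine ⟨hfs fun h => hq ?_, hgs fun h => hq ?_⟩
      · rw [(mem_V0_iff_rep hf).1 h, zero_mul]
      · rw [(mem_V0_iff_rep hg).1 h, mul_zero]
  | sUnion S _ hS =>
    obtain ⟨s, hs, hps⟩ := hp
    obtain ⟨d, f, hf, h1, h2⟩ := hS s hs hps
    exact ⟨d, f, hf, h1, h2.trans (Set.subset_sUnion_of_mem hs)⟩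

lemma exists_homogCut_of_notMem {S : Set (PS k N)} (hS : IsClosed S) {p : PS k N} (hp : p ∉ S) :
    ∃ f ∈ homogCut S, p ∉ V0 f := by
  obtain ⟨d, f, hf, hpf, hfS⟩ := exists_basic_of_mem_isOpen hS.isOpen_compl hp
  refine ⟨f, ⟨⟨d, hf⟩, fun q hq => ?_⟩, hpf⟩
  by_contra h
  exact hfS h hq

lemma eval_eq_zero_of_mem_homogCut {S : Set (PS k N)} (hS : S.Nonempty)
    {f : MvPolynomial (Fin N) k} (hf : f ∈ homogCut S) : ∀ v ∈ cone S, eval v f = 0 := by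
  obtain ⟨⟨d, hd⟩, hf⟩ := hf
  intro v hv
  by_cases hv0 : v = 0
  · obtain ⟨p, hp⟩ := hS
    have h := (mem_V0_iff_rep hd).1 (hf hp)
    have h2 := IsHomogeneous.eval_smul hd 0 p.rep
    rw [h, mul_zero, zero_smul] at h2
    rw [hv0, h2]
  · exact (mk_mem_V0 hd hv0).1 (hf (hv hv0))

lemma mem_cone_of_homogCut {S : Set (PS k N)} (hS : IsClosed S) {v : Fin N → k}
    (h : ∀ f ∈ homogCut S, eval v f = 0) : v ∈ cone S := by
  intro hv
  by_contra hcon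
  obtain ⟨f, hf, hfv⟩ := exists_homogCut_of_notMem hS hcon
  obtain ⟨d, hd⟩ := hf.1
  exact hfv ((mk_mem_V0 hd hv).2 (h f hf))

lemma mk_mem_linSet {W : Submodule k (Fin N → k)} {v : Fin N → k} (hv : v ≠ 0) :
    Projectivization.mk k v hv ∈ linSet W ↔ v ∈ W := by
  rw [linSet, Set.mem_ofPred_eq, Projectivization.submodule_mk, Submodule.span_singleton_le_iff_mem]

lemma cone_linSet (W : Submodule k (Fin N → k)) : cone (linSet W) = W := by
  ext v
  by_cases hv : v = 0
  · subst hv; simp [zero_mem_cone]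
  · rw [mem_cone_iff hv, mk_mem_linSet hv]; rfl

lemma isIrreducible_of_cone {S : Set (PS k N)} (hne : S.Nonempty)
    (h : ∀ f g : MvPolynomial (Fin N) k, ∀ d e, f.IsHomogeneous d → g.IsHomogeneous e →
      (∃ p ∈ S, p ∉ V0 f) → (∃ p ∈ S, p ∉ V0 g) → ∃ p ∈ S, p ∉ V0 f ∧ p ∉ V0 g) :
    IsIrreducible S := by
  refine ⟨hne, ?_⟩
  rintro U V hU hV ⟨p, hpS, hpU⟩ ⟨q, hqS, hqV⟩
  obtain ⟨d, f, hf, hpf, hfU⟩ := exists_basic_of_mem_isOpen hU hpU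
  obtain ⟨e, g, hg, hqg, hgV⟩ := exists_basic_of_mem_isOpen hV hqV
  obtain ⟨r, hr, hrf, hrg⟩ := h f g d e hf hg ⟨p, hpS, hpf⟩ ⟨q, hqS, hqg⟩
  exact ⟨r, hr, hfU hrf, hgV hrg⟩

lemma exists_mem_eval_ne_zero [Infinite k] {σ : Type} (W : Submodule k (σ → k))
    {f g : MvPolynomial σ k} {v w : σ → k} (hv : v ∈ W) (hw : w ∈ W) (hf : eval v f ≠ 0)
    (hg : eval w g ≠ 0) : ∃ u ∈ W, eval u f ≠ 0 ∧ eval u g ≠ 0 := by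
  by_contra! hcon
  have h1 : linePoly f v (w - v) * linePoly g v (w - v) = 0 := Polynomial.funext fun c => by
    rw [Polynomial.eval_mul, eval_linePoly, eval_linePoly, Polynomial.eval_zero]
    by_cases h : eval (v + c • (w - v)) f = 0
    · rw [h, zero_mul]
    · rw [hcon _ (W.add_mem hv (W.smul_mem c (W.sub_mem hw hv))) h, mul_zero]
  rcases mul_eq_zero.1 h1 with h | h
  · apply hf
    have := eval_linePoly f v (w - v) 0
    rwa [h, Polynomial.eval_zero, zero_smul, add_zero, eq_comm] at this
  · apply hg
    have := eval_linePoly g v (w - v) 1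
    rwa [h, Polynomial.eval_zero, one_smul, add_sub_cancel, eq_comm] at this

lemma isIrreducible_linSet [Infinite k] {W : Submodule k (Fin N → k)} (hW : W ≠ ⊥) :
    IsIrreducible (linSet W) := by
  obtain ⟨w, hw, hw0⟩ := W.ne_bot_iff.1 hW
  refine isIrreducible_of_cone ⟨Projectivization.mk k w hw0, (mk_mem_linSet hw0).2 hw⟩ ?_
  rintro f g d e hf hg ⟨p, hp, hpf⟩ ⟨q, hq, hqg⟩
  rw [mem_V0_iff_rep hf] at hpf
  rw [mem_V0_iff_rep hg] at hqg
  have hp' : p.rep ∈ W := by rw [← rep_mem_cone, cone_linSet] at hp; exact hp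
  have hq' : q.rep ∈ W := by rw [← rep_mem_cone, cone_linSet] at hq; exact hq
  obtain ⟨u, hu, huf, hug⟩ := exists_mem_eval_ne_zero W hp' hq' hpf hqg
  by_cases hu0 : u = 0
  · subst hu0
    have h1 : ∀ {h : MvPolynomial (Fin N) k} {m : ℕ}, h.IsHomogeneous m → eval 0 h ≠ 0 → w ∈ W →
        eval w h ≠ 0 := by
      intro h m hm h0 _ hcon
      have := IsHomogeneous.eval_smul hm 0 w
      rw [zero_smul, hcon, mul_zero] at this
      exact h0 this
    refine ⟨Projectivization.mk k w hw0, (mk_mem_linSet hw0).2 hw, ?_, ?_⟩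
    · rw [mk_mem_V0 hf]; exact h1 hf huf hw
    · rw [mk_mem_V0 hg]; exact h1 hg hug hw
  · refine ⟨Projectivization.mk k u hu0, (mk_mem_linSet hu0).2 hu, ?_, ?_⟩
    · rwa [mk_mem_V0 hf]
    · rwa [mk_mem_V0 hg]

lemma linSet_top : linSet (⊤ : Submodule k (Fin N → k)) = Set.univ := by
  ext p; simp [linSet]

lemma dense_of_isOpen [Infinite k] {U : Set (PS k N)} (hU : IsOpen U) (hne : U.Nonempty) :
    Dense U := by
  obtain ⟨p, hp⟩ := hne
  have hT : (⊤ : Submodule k (Fin N → k)) ≠ ⊥ :=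
    (Submodule.ne_bot_iff _).2 ⟨p.rep, trivial, p.rep_nonzero⟩
  have h := (isIrreducible_linSet hT).isPreirreducible
  rw [linSet_top] at h
  intro q
  have := subset_closure_inter_of_isPreirreducible_of_isOpen h hU ⟨p, trivial, hp⟩
  rw [Set.univ_inter] at this
  exact this trivial

lemma nonempty_compl_V0 [Infinite k] (hN : 0 < N) {G : MvPolynomial (Fin N) k} {d : ℕ}
    (hd : G.IsHomogeneous d) (hG : G ≠ 0) : ((V0 G)ᶜ).Nonempty := by
  have h : G * X ⟨0, hN⟩ ≠ 0 := mul_ne_zero hG (X_ne_zero _)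
  obtain ⟨v, hv⟩ : ∃ v, eval v (G * X ⟨0, hN⟩) ≠ 0 := by
    by_contra! hcon
    exact h (MvPolynomial.funext fun v => by rw [hcon, map_zero])
  rw [map_mul, eval_X] at hv
  have hv0 : v ≠ 0 := fun h0 => right_ne_zero_of_mul hv (by rw [h0]; rfl)
  exact ⟨Projectivization.mk k v hv0, by
    rw [Set.mem_compl_iff, mk_mem_V0 hd]; exact left_ne_zero_of_mul hv⟩

/-- The vanishing ideal of the part of the cone over an irreducible set cut out by an injective
linear parametrization of a linear space containing the set. -/
lemma vanishingIdeal_comap_isPrime [Infinite k] {S : Set (PS k N)} (hS : IsIrreducible S) {σ : Type}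
    [Fintype σ] (e : (σ → k) →ₗ[k] (Fin N → k)) (he : Function.Injective e)
    (hSe : ∀ p ∈ S, p.submodule ≤ LinearMap.range e) (π : (Fin N → k) →ₗ[k] (σ → k))
    (hπ : ∀ v, π (e v) = v) :
    (vanishingIdeal k (e ⁻¹' cone S)).IsPrime := by
  classical
  have hcon : IsConical (e ⁻¹' cone S) := fun c v hv => by
    rw [Set.mem_preimage, map_smul]; exact isConical_cone S c _ hv
  obtain ⟨p₀, hp₀⟩ := hS.nonempty
  have hrep : ∀ p ∈ S, ∃ v, e v = p.rep := fun p hp => hSe p hp (by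
    rw [Projectivization.submodule_eq]; exact Submodule.mem_span_singleton_self _)
  have key : ∀ (f : MvPolynomial σ k) d, f.IsHomogeneous d →
      (∃ v ∈ e ⁻¹' cone S, eval v f ≠ 0) → ∃ p ∈ S, p ∉ V0 (pullback π f) := by
    rintro f d hf ⟨v, hv, hfv⟩
    by_cases hv0 : v = 0
    · obtain ⟨w, hw⟩ := hrep p₀ hp₀
      refine ⟨p₀, hp₀, ?_⟩
      rw [mem_V0_iff_rep (pullback_isHomogeneous _ hf), eval_pullback]
      intro hcon
      have := IsHomogeneous.eval_smul hf 0 (π p₀.rep)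
      rw [zero_smul, hcon, mul_zero, ← hv0] at this
      exact hfv this
    · have hev : e v ≠ 0 := fun h => hv0 (he (by rw [h, map_zero]))
      refine ⟨Projectivization.mk k (e v) hev, hv hev, ?_⟩
      rw [mk_mem_V0 (pullback_isHomogeneous _ hf), eval_pullback, hπ]
      exact hfv
  refine hcon.vanishingIdeal_isPrime ⟨0, by simp [zero_mem_cone]⟩ ?_
  intro f g d d' hf hg hfv hgv
  obtain ⟨p, hp, hpf⟩ := key f d hf hfv
  obtain ⟨q, hq, hqg⟩ := key g d' hg hgv
  obtain ⟨r, hr, hrf, hrg⟩ := hS.isPreirreducible _ _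
    (isOpen_compl_V0 (pullback_isHomogeneous π hf)) (isOpen_compl_V0 (pullback_isHomogeneous π hg))
    ⟨p, hp, hpf⟩ ⟨q, hq, hqg⟩
  obtain ⟨w, hw⟩ := hrep r hr
  rw [Set.mem_compl_iff, mem_V0_iff_rep (pullback_isHomogeneous _ hf), eval_pullback, ← hw, hπ] at hrf
  rw [Set.mem_compl_iff, mem_V0_iff_rep (pullback_isHomogeneous _ hg), eval_pullback, ← hw, hπ] at hrg
  exact ⟨w, by rw [Set.mem_preimage, hw, rep_mem_cone]; exact hr, hrf, hrg⟩

end Topology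

end EL

namespace EL

/-- The image of a dominant polynomial map from an affine algebraic set contains a nonempty
principal open set. -/
lemma exists_basicOpen_subset_image {k σ τ : Type} [Field k] [IsAlgClosed k] [Finite σ] [Finite τ]
    (I : Ideal (MvPolynomial σ k)) (p : τ → MvPolynomial σ k)
    (hinj : ∀ G : MvPolynomial τ k, aeval p G ∈ I → G = 0) :
    ∃ h : MvPolynomial τ k, h ≠ 0 ∧ ∀ v, eval v h ≠ 0 →
      ∃ z, (∀ f ∈ I, eval z f = 0) ∧ ∀ j, eval z (p j) = v j := by
  classical
  let φ : MvPolynomial τ k →ₐ[k] MvPolynomial σ k ⧸ I := (Ideal.Quotient.mkₐ k I).comp (aeval p)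
  have hφ : Function.Injective φ.toRingHom := by
    rw [injective_iff_map_eq_zero]
    exact fun G hG => hinj G (Ideal.Quotient.eq_zero_iff_mem.1 hG)
  have hfp : φ.toRingHom.FinitePresentation := by
    rw [← RingHom.FinitePresentation.of_finiteType]
    apply RingHom.FiniteType.of_comp_finiteType (f := algebraMap k (MvPolynomial τ k))
    have : φ.toRingHom.comp (algebraMap k (MvPolynomial τ k)) =
        algebraMap k (MvPolynomial σ k ⧸ I) := φ.comp_algebraMap
    rw [this, RingHom.finiteType_algebraMap]
    infer_instance
  obtain ⟨S, hS⟩ := PrimeSpectrum.exists_constructibleSetData_iff.2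
    (PrimeSpectrum.isConstructible_range_comap hfp)
  have hbot : (⟨⊥, Ideal.isPrime_bot⟩ : PrimeSpectrum (MvPolynomial τ k)) ∈
      Set.range (PrimeSpectrum.comap φ.toRingHom) := by
    have h0 : (⊥ : Ideal (MvPolynomial σ k ⧸ I)).comap φ.toRingHom = ⊥ := by
      rw [← RingHom.ker_eq_comap_bot]
      exact (RingHom.injective_iff_ker_eq_bot _).1 hφ
    have hmin : (⊥ : Ideal (MvPolynomial τ k)) ∈
        ((⊥ : Ideal (MvPolynomial σ k ⧸ I)).comap φ.toRingHom).minimalPrimes := by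
      rw [h0]
      exact ⟨⟨Ideal.isPrime_bot, le_rfl⟩, fun _ _ _ => bot_le⟩
    obtain ⟨𝔭, h𝔭, h𝔭c⟩ := Ideal.exists_minimalPrimes_comap_eq _ _ hmin
    exact ⟨⟨𝔭, h𝔭.1.1⟩, PrimeSpectrum.ext h𝔭c⟩
  rw [← hS] at hbot
  simp only [PrimeSpectrum.ConstructibleSetData.toSet, Set.mem_iUnion] at hbot
  obtain ⟨D, hD, hDbot⟩ := hbot
  obtain ⟨hg, hf⟩ := hDbot
  have hg0 : ∀ i, D.g i = 0 := fun i => by simpa using hg ⟨i, rfl⟩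
  have hf0 : D.f ≠ 0 := by
    intro h
    apply hf
    simp [h]
  refine ⟨D.f, hf0, fun v hv => ?_⟩
  have hmax : (vanishingIdeal k {v}).IsMaximal := isMaximal_iff_eq_vanishingIdeal_singleton.2 ⟨v, rfl⟩
  have hmemv : ∀ f, f ∈ vanishingIdeal k {v} ↔ eval v f = 0 := by
    intro f; rw [mem_vanishingIdeal_iff]; simp
  have hmem : (⟨vanishingIdeal k {v}, hmax.isPrime⟩ : PrimeSpectrum (MvPolynomial τ k)) ∈
      Set.range (PrimeSpectrum.comap φ.toRingHom) := by
    rw [← hS]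
    simp only [PrimeSpectrum.ConstructibleSetData.toSet, Set.mem_iUnion]
    refine ⟨D, hD, ?_, ?_⟩
    · rintro _ ⟨i, rfl⟩
      rw [hg0 i]
      exact Ideal.zero_mem _
    · intro h
      rw [PrimeSpectrum.mem_zeroLocus, Set.singleton_subset_iff] at h
      exact hv ((hmemv _).1 h)
  obtain ⟨𝔮, h𝔮⟩ := hmem
  obtain ⟨𝔫, h𝔫max, h𝔮𝔫⟩ := Ideal.exists_le_maximal 𝔮.asIdeal 𝔮.isPrime.ne_top
  have h𝔫 : 𝔫.comap φ.toRingHom = vanishingIdeal k {v} := by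
    refine (hmax.eq_of_le (Ideal.comap_ne_top _ h𝔫max.ne_top) ?_).symm
    have : vanishingIdeal k {v} = 𝔮.asIdeal.comap φ.toRingHom :=
      (congrArg PrimeSpectrum.asIdeal h𝔮).symm
    rw [this]
    exact Ideal.comap_mono h𝔮𝔫
  have h𝔫' : (𝔫.comap (Ideal.Quotient.mk I)).IsMaximal :=
    Ideal.comap_isMaximal_of_surjective _ Ideal.Quotient.mk_surjective
  obtain ⟨z, hz⟩ := isMaximal_iff_eq_vanishingIdeal_singleton.1 h𝔫'
  have hmemz : ∀ f, eval z f = 0 ↔ Ideal.Quotient.mk I f ∈ 𝔫 := by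
    intro f
    rw [← Ideal.mem_comap, hz, mem_vanishingIdeal_iff]
    simp
  refine ⟨z, fun f hf => ?_, fun j => ?_⟩
  · rw [hmemz, Ideal.Quotient.eq_zero_iff_mem.2 hf]
    exact 𝔫.zero_mem
  · have h1 : (X j - C (v j) : MvPolynomial τ k) ∈ 𝔫.comap φ.toRingHom := by
      rw [h𝔫, hmemv]; simp
    have h2 : Ideal.Quotient.mk I (aeval p (X j - C (v j))) ∈ 𝔫 := h1
    rw [← hmemz] at h2
    simpa [sub_eq_zero, ← algebraMap_eq] using h2

section Secant

variable {k : Type} [Field k] {N : ℕ}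

lemma pspan_pair {A : Set (PS k N)} {v : Fin N → k} :
    v ∈ pspan A → ∀ p q : PS k N, A ⊆ {p, q} → ∃ a b : k, v = a • p.rep + b • q.rep := by
  intro hv p q hA
  have hle : pspan A ≤ Submodule.span k {p.rep, q.rep} := by
    refine iSup₂_le fun r hr => ?_
    rw [Projectivization.submodule_eq, Submodule.span_singleton_le_iff_mem]
    rcases hA hr with rfl | h
    · exact Submodule.subset_span (by simp)
    · rw [Set.mem_singleton_iff.1 h]; exact Submodule.subset_span (by simp)
  obtain ⟨a, b, h⟩ := Submodule.mem_span_pair.1 (hle hv)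
  exact ⟨a, b, h.symm⟩

lemma eq_zero_of_vanish_on_sums [Infinite k] (hN : 0 < N) {S : Set (PS k N)}
    (hsec : secant S 2 = Set.univ) {f : MvPolynomial (Fin N) k}
    (hf : ∀ x ∈ cone S, ∀ y ∈ cone S, eval (x + y) f = 0) : f = 0 := by
  classical
  by_contra hne
  obtain ⟨i, hi⟩ := exists_homogeneousComponent_ne_zero hne
  have hom := homogeneousComponent_isHomogeneous i f
  have hcon : IsConical {v : Fin N → k | ∃ x ∈ cone S, ∃ y ∈ cone S, v = x + y} := by
    rintro c v ⟨x, hx, y, hy, rfl⟩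
    exact ⟨_, isConical_cone S c x hx, _, isConical_cone S c y hy, smul_add _ _ _⟩
  have hcomp := hcon.homogeneousComponent_eq_zero
    (f := f) (by rintro v ⟨x, hx, y, hy, rfl⟩; exact hf x hx y hy) i
  have hsub : secant S 2 ⊆ V0 (homogeneousComponent i f) := by
    refine closure_minimal ?_ (isClosed_V0 hom)
    rintro q ⟨A, hAS, hcard, hq⟩
    obtain ⟨p₁, p₂, -, rfl⟩ := Finset.card_eq_two.1 hcard
    rw [mem_V0_iff_rep hom]
    obtain ⟨a, b, hab⟩ := pspan_pair (hq (by
      rw [Projectivization.submodule_eq]; exact Submodule.mem_span_singleton_self _)) p₁ p₂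
      (by simp)
    rw [hab]
    exact hcomp _ ⟨_, isConical_cone S a _ (rep_mem_cone.2 (hAS (by simp))), _,
      isConical_cone S b _ (rep_mem_cone.2 (hAS (by simp))), rfl⟩
  rw [hsec] at hsub
  obtain ⟨p, hp⟩ := nonempty_compl_V0 hN hom hi
  exact hp (hsub trivial)

/-- A general vector is a sum of two vectors in the cone over `S`. -/
lemma exists_homogeneous_of_secant [IsAlgClosed k] (hN : 0 < N) {S : Set (PS k N)} (hS : IsClosed S)
    (hne : S.Nonempty) (hsec : secant S 2 = Set.univ) :
    ∃ (d : ℕ) (G : MvPolynomial (Fin N) k), G.IsHomogeneous d ∧ G ≠ 0 ∧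
      ∀ v, eval v G ≠ 0 → ∃ x ∈ cone S, ∃ y ∈ cone S, v = x + y := by
  classical
  have : Infinite k := IsAlgClosed.instInfinite
  let B : Set (Fin N ⊕ Fin N → k) := {z | z ∘ Sum.inl ∈ cone S ∧ z ∘ Sum.inr ∈ cone S}
  obtain ⟨h, hh, H⟩ := exists_basicOpen_subset_image (vanishingIdeal k B)
    (fun j : Fin N => (X (Sum.inl j) + X (Sum.inr j) : MvPolynomial (Fin N ⊕ Fin N) k)) (by
      intro G hG
      rw [mem_vanishingIdeal_iff] at hG
      refine eq_zero_of_vanish_on_sums hN hsec fun x hx y hy => ?_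
      have := hG (Sum.elim x y) ⟨hx, hy⟩
      change eval _ (aeval _ G) = 0 at this
      rw [eval_aeval] at this
      rw [← this]
      congr 2
      ext j
      simp)
  obtain ⟨i, hi⟩ := exists_homogeneousComponent_ne_zero hh
  refine ⟨i, _, homogeneousComponent_isHomogeneous i h, hi, fun v hv => ?_⟩
  obtain ⟨c, hc0, hc, -⟩ := exists_smul_eval_ne_zero hv hv
  obtain ⟨z, hz, hzv⟩ := H _ hc
  have hx : z ∘ Sum.inl ∈ cone S := mem_cone_of_homogCut hS fun f hf => by
    rw [← eval_rename]
    refine hz _ (mem_vanishingIdeal_iff.2 fun w hw => ?_)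
    change eval w _ = 0
    rw [eval_rename]
    exact eval_eq_zero_of_mem_homogCut hne hf _ hw.1
  have hy : z ∘ Sum.inr ∈ cone S := mem_cone_of_homogCut hS fun f hf => by
    rw [← eval_rename]
    refine hz _ (mem_vanishingIdeal_iff.2 fun w hw => ?_)
    change eval w _ = 0
    rw [eval_rename]
    exact eval_eq_zero_of_mem_homogCut hne hf _ hw.2
  refine ⟨_, isConical_cone S c⁻¹ _ hx, _, isConical_cone S c⁻¹ _ hy, ?_⟩
  have hsum : z ∘ Sum.inl + z ∘ Sum.inr = c • v := by
    ext j
    simpa using hzv j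
  rw [← smul_add, hsum, smul_smul, inv_mul_cancel₀ hc0, one_smul]

end Secant

end EL

namespace EL

section Entry

variable {k : Type} [Field k] {N : ℕ}

def entrySet (X : Set (PS k N)) (q : PS k N) : Set (PS k N) :=
  ⋃ A ∈ decomps X q, (↑A : Set (PS k N))

lemma submodule_le_iff_rep {p : PS k N} {W : Submodule k (Fin N → k)} :
    p.submodule ≤ W ↔ p.rep ∈ W := by
  rw [Projectivization.submodule_eq, Submodule.span_singleton_le_iff_mem]

lemma eq_of_submodule_le {p q : PS k N} (h : q.submodule ≤ p.submodule) : q = p := by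
  rw [submodule_le_iff_rep, Projectivization.submodule_eq, Submodule.mem_span_singleton] at h
  obtain ⟨a, ha⟩ := h
  rw [← Projectivization.mk_rep p, ← Projectivization.mk_rep q,
    Projectivization.mk_eq_mk_iff' k _ _ q.rep_nonzero p.rep_nonzero]
  exact ⟨a, ha⟩

lemma mem_pspan {S : Set (PS k N)} {p : PS k N} (hp : p ∈ S) : p.rep ∈ pspan S :=
  submodule_le_iff_rep.1 (le_iSup₂_of_le p hp le_rfl)

lemma pspan_mono {S T : Set (PS k N)} (h : S ⊆ T) : pspan S ≤ pspan T :=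
  iSup₂_le fun p hp => submodule_le_iff_rep.2 (mem_pspan (h hp))

lemma pspan_empty : pspan (∅ : Set (PS k N)) = ⊥ := by simp [pspan]

lemma mem_pspan_of_mem_cone {S : Set (PS k N)} {v : Fin N → k} (hv : v ∈ cone S) :
    v ∈ pspan S := by
  by_cases h0 : v = 0
  · rw [h0]; exact zero_mem _
  · have := submodule_le_iff_rep.2 (mem_pspan (hv h0))
    rwa [Projectivization.submodule_mk, Submodule.span_singleton_le_iff_mem] at this

lemma subset_linSet_pspan (S : Set (PS k N)) : S ⊆ linSet (pspan S) := fun _ hp =>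
  submodule_le_iff_rep.2 (mem_pspan hp)

lemma not_hasDecomp_zero {X : Set (PS k N)} {q : PS k N} : ¬ hasDecomp X q 0 := by
  rintro ⟨A, -, hA, hq⟩
  rw [Finset.card_eq_zero] at hA
  rw [memSpan, hA, Finset.coe_empty, pspan_empty, submodule_le_iff_rep] at hq
  exact q.rep_nonzero hq

lemma memSpan_singleton {p q : PS k N} (h : memSpan q {p}) : q = p := by
  apply eq_of_submodule_le
  simpa [memSpan, pspan] using h

lemma not_hasDecomp_one {X : Set (PS k N)} {q : PS k N} (hq : q ∉ X) : ¬ hasDecomp X q 1 := by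
  rintro ⟨A, hAX, hA, h⟩
  obtain ⟨p, rfl⟩ := Finset.card_eq_one.1 hA
  rw [Finset.coe_singleton] at h
  exact hq (memSpan_singleton h ▸ hAX (by simp))

lemma rk_eq_two {X : Set (PS k N)} {q : PS k N} (hq : q ∉ X) (h : hasDecomp X q 2) :
    rk X q = 2 := by
  have hmem : hasDecomp X q (rk X q) := Nat.sInf_mem (s := {s | hasDecomp X q s}) ⟨2, h⟩
  have hle : rk X q ≤ 2 := Nat.sInf_le h
  have h0 : rk X q ≠ 0 := fun h0 => not_hasDecomp_zero (h0 ▸ hmem)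
  have h1 : rk X q ≠ 1 := fun h1 => not_hasDecomp_one hq (h1 ▸ hmem)
  omega

lemma pair_mem_decomps {X : Set (PS k N)} {q : PS k N} (hq : q ∉ X) {p p' : PS k N}
    (hp : p ∈ X) (hp' : p' ∈ X) (h : memSpan q {p, p'}) :
    rk X q = 2 ∧ p ∈ entrySet X q := by
  classical
  have hne : p ≠ p' := by
    rintro rfl
    rw [Set.pair_eq_singleton] at h
    exact hq (memSpan_singleton h ▸ hp)
  have h2 : hasDecomp X q 2 := ⟨{p, p'}, by simp [Set.insert_subset_iff, hp, hp'],
    Finset.card_pair hne, by simpa using h⟩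
  refine ⟨rk_eq_two hq h2, ?_⟩
  refine Set.mem_biUnion (x := ({p, p'} : Finset (PS k N))) ⟨?_, ?_, ?_, ?_⟩ (by simp)
  · simp [Set.insert_subset_iff, hp, hp']
  · rw [rk_eq_two hq h2, Finset.card_pair hne]
  · simpa using h
  · intro B hB hqB
    have hlt := Finset.card_lt_card hB
    rw [Finset.card_pair hne] at hlt
    have hBX : (↑B : Set (PS k N)) ⊆ X := by
      intro z hz
      have := hB.1 hz
      simp only [Finset.mem_insert, Finset.mem_singleton] at this
      rcases this with rfl | rfl <;> assumption
    have hd : hasDecomp X q B.card := ⟨B, hBX, rfl, hqB⟩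
    interval_cases hc : B.card
    · exact not_hasDecomp_zero hd
    · exact not_hasDecomp_one hq hd

lemma mem_entrySet {X : Set (PS k N)} {v x : Fin N → k} (hv : v ∉ cone X) (hv0 : v ≠ 0)
    (hx : x ∈ cone X) (hx0 : x ≠ 0) {a : k} (hy : v - a • x ∈ cone X) :
    rk X (Projectivization.mk k v hv0) = 2 ∧
      Projectivization.mk k x hx0 ∈ entrySet X (Projectivization.mk k v hv0) := by
  have hy0 : v - a • x ≠ 0 := by
    intro h0
    apply hv
    rw [sub_eq_zero.1 h0]
    exact isConical_cone X _ _ hx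
  refine pair_mem_decomps (p' := Projectivization.mk k _ hy0) (fun h => hv fun _ => h)
    (hx hx0) (hy hy0) ?_
  rw [memSpan, Projectivization.submodule_mk, Submodule.span_singleton_le_iff_mem]
  have e : pspan {Projectivization.mk k x hx0, Projectivization.mk k _ hy0} =
      Submodule.span k {x} ⊔ Submodule.span k {v - a • x} := by
    rw [pspan, iSup_pair, Projectivization.submodule_mk, Projectivization.submodule_mk]
  rw [e]
  have : a • x + (v - a • x) ∈ Submodule.span k {x} ⊔ Submodule.span k {v - a • x} :=
    Submodule.add_mem_sup (Submodule.smul_mem _ _ (Submodule.mem_span_singleton_self _))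
      (Submodule.mem_span_singleton_self _)
  rwa [add_sub_cancel] at this

lemma entrySet_subset {X : Set (PS k N)} {q : PS k N} : entrySet X q ⊆ X := by
  intro p hp
  obtain ⟨A, hA, hpA⟩ := Set.mem_iUnion₂.1 hp
  exact hA.1 hpA

/-- Points of the entry set of a point of rank two come in pairs spanning that point. -/
lemma exists_of_mem_entrySet {X : Set (PS k N)} {v x : Fin N → k} (hv : v ∉ cone X) (hv0 : v ≠ 0)
    (hx0 : x ≠ 0) (hrk : rk X (Projectivization.mk k v hv0) = 2)
    (hx : Projectivization.mk k x hx0 ∈ entrySet X (Projectivization.mk k v hv0)) :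
    ∃ a : k, a ≠ 0 ∧ v - a • x ∈ cone X ∧ v - a • x ≠ 0 ∧
      ∀ h : v - a • x ≠ 0,
        Projectivization.mk k (v - a • x) h ∈ entrySet X (Projectivization.mk k v hv0) := by
  have hxX : x ∈ cone X := fun h => entrySet_subset hx
  have key : ∃ a : k, v - a • x ∈ cone X := by
    classical
    obtain ⟨A, hA, hpA⟩ := Set.mem_iUnion₂.1 hx
    obtain ⟨hAX, hcard, hirr, -⟩ := hA
    rw [hrk] at hcard
    obtain ⟨p, p', hne, hAe⟩ := Finset.card_eq_two.1 hcard
    subst hAe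
    have hvm : v ∈ pspan (↑({p, p'} : Finset (PS k N))) := by
      have := hirr
      rwa [memSpan, Projectivization.submodule_mk, Submodule.span_singleton_le_iff_mem] at this
    have main : ∀ r r' : PS k N, Projectivization.mk k x hx0 = r → r' ∈ X →
        v ∈ Submodule.span k {r.rep} ⊔ Submodule.span k {r'.rep} →
        ∃ a : k, v - a • x ∈ cone X := by
      intro r r' hr hr' hvr
      obtain ⟨y, hy, z, hz, rfl⟩ := Submodule.mem_sup.1 hvr
      rw [← Projectivization.submodule_eq, ← hr, Projectivization.submodule_mk] at hy
      obtain ⟨a, rfl⟩ := Submodule.mem_span_singleton.1 hy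
      obtain ⟨b, rfl⟩ := Submodule.mem_span_singleton.1 hz
      refine ⟨a, ?_⟩
      rw [add_sub_cancel_left]
      exact isConical_cone X _ _ (rep_mem_cone.2 hr')
    have e : pspan (↑({p, p'} : Finset (PS k N))) =
        Submodule.span k {p.rep} ⊔ Submodule.span k {p'.rep} := by
      rw [Finset.coe_pair, pspan, iSup_pair, Projectivization.submodule_eq,
        Projectivization.submodule_eq]
    rw [e] at hvm
    simp only [Finset.coe_pair, Set.mem_insert_iff, Set.mem_singleton_iff] at hpA
    rcases hpA with h | h
    · exact main p p' h (hAX (by simp)) hvm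
    · exact main p' p h (hAX (by simp)) (by rwa [sup_comm])
  obtain ⟨a, ha⟩ := key
  have hane : a ≠ 0 := by
    rintro rfl
    exact hv (by simpa using ha)
  have hne : v - a • x ≠ 0 := by
    intro h0
    exact hv (by rw [sub_eq_zero.1 h0]; exact isConical_cone X _ _ hxX)
  refine ⟨a, hane, ha, hne, fun h => (mem_entrySet hv hv0 ha h (a := 1) ?_).2⟩
  rw [one_smul, sub_sub_cancel]
  exact isConical_cone X _ _ hxX

lemma rk_eq_two_of_add {X : Set (PS k N)} {v x y : Fin N → k} (hv : v ∉ cone X) (hv0 : v ≠ 0)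
    (hx : x ∈ cone X) (hy : y ∈ cone X) (h : v = x + y) :
    rk X (Projectivization.mk k v hv0) = 2 := by
  have hx0 : x ≠ 0 := by
    rintro rfl
    exact hv (by rw [h, zero_add]; exact hy)
  refine (mem_entrySet (a := 1) hv hv0 hx hx0 ?_).1
  rw [h, one_smul, add_sub_cancel_left]
  exact hy

lemma mem_entrySet_of_add {X : Set (PS k N)} {v x y : Fin N → k} (hv : v ∉ cone X) (hv0 : v ≠ 0)
    (hx : x ∈ cone X) (hy : y ∈ cone X) (h : v = x + y) :
    x ∈ cone (entrySet X (Projectivization.mk k v hv0)) := by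
  intro hx0
  refine (mem_entrySet (a := 1) hv hv0 hx hx0 ?_).2
  rw [h, one_smul, add_sub_cancel_left]
  exact hy

lemma entrySet_subset_entryLocus {X : Set (PS k N)} {q : PS k N} :
    entrySet X q ⊆ entryLocus X q := subset_closure

lemma entryLocus_subset {X : Set (PS k N)} (hX : IsClosed X) {q : PS k N} :
    entryLocus X q ⊆ X := closure_minimal entrySet_subset hX

lemma cone_mono {S T : Set (PS k N)} (h : S ⊆ T) : cone S ⊆ cone T := fun _ hv h0 => h (hv h0)

def linForm (φ : (Fin N → k) →ₗ[k] k) : MvPolynomial (Fin N) k :=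
  ∑ j, C (φ (Pi.single j 1)) * X j

lemma eval_linForm (φ : (Fin N → k) →ₗ[k] k) (v : Fin N → k) : eval v (linForm φ) = φ v := by
  conv_rhs => rw [pi_eq_sum_univ' v]
  simp [linForm, mul_comm]

lemma isHomogeneous_linForm (φ : (Fin N → k) →ₗ[k] k) : (linForm φ).IsHomogeneous 1 :=
  IsHomogeneous.sum _ _ _ fun _ _ => isHomogeneous_C_mul_X _ _

lemma isClosed_linSet (W : Submodule k (Fin N → k)) : IsClosed (linSet W) := by
  have : linSet W = ⋂ φ ∈ {φ : (Fin N → k) →ₗ[k] k | W ≤ LinearMap.ker φ}, V0 (linForm φ) := by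
    ext p
    simp only [Set.mem_iInter, mem_V0_iff_rep (isHomogeneous_linForm _), eval_linForm]
    rw [linSet, Set.mem_ofPred_eq, submodule_le_iff_rep]
    refine ⟨fun h φ hφ => hφ h, fun h => ?_⟩
    by_contra hcon
    obtain ⟨φ, hφ, hle⟩ := Submodule.exists_le_ker_of_notMem hcon
    exact hφ (h φ hle)
  rw [this]
  exact isClosed_biInter fun φ _ => isClosed_V0 (isHomogeneous_linForm φ)

end Entry

section Tangent

variable {k : Type} [Field k] {σ τ : Type} [Fintype σ] [Fintype τ]

lemma dirDeriv_C (z u : σ → k) (a : k) : dirDeriv z u (C a) = 0 := by simp [dirDeriv]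

lemma dirDeriv_X (z u : σ → k) (i : σ) : dirDeriv z u (X i) = u i := by
  classical
  simp [dirDeriv, pderiv_X, Pi.single_apply, apply_ite (eval z), ite_mul]

lemma dirDeriv_add (z u : σ → k) (f g : MvPolynomial σ k) :
    dirDeriv z u (f + g) = dirDeriv z u f + dirDeriv z u g := by
  simp [dirDeriv, add_mul, Finset.sum_add_distrib]

lemma dirDeriv_mul (z u : σ → k) (f g : MvPolynomial σ k) :
    dirDeriv z u (f * g) = dirDeriv z u f * eval z g + eval z f * dirDeriv z u g := by
  simp only [dirDeriv, Derivation.leibniz, smul_eq_mul, map_add, map_mul, Finset.sum_mul,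
    Finset.mul_sum, ← Finset.sum_add_distrib]
  refine Finset.sum_congr rfl fun i _ => by ring

lemma dirDeriv_aeval (z u : σ → k) (q : τ → MvPolynomial σ k) (f : MvPolynomial τ k) :
    dirDeriv z u (aeval q f) =
      dirDeriv (fun i => eval z (q i)) (fun i => dirDeriv z u (q i)) f := by
  induction f using MvPolynomial.induction_on with
  | C a => rw [aeval_C, algebraMap_eq, dirDeriv_C, dirDeriv_C]
  | add f g hf hg => rw [map_add, dirDeriv_add, dirDeriv_add, hf, hg]
  | mul_X f i hf =>
    rw [map_mul, dirDeriv_mul, dirDeriv_mul, hf, aeval_X, dirDeriv_X, eval_aeval, eval_X]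

lemma dirDeriv_add_right (z u w : σ → k) (f : MvPolynomial σ k) :
    dirDeriv z (u + w) f = dirDeriv z u f + dirDeriv z w f := by
  simp [dirDeriv, mul_add, Finset.sum_add_distrib]

lemma dirDeriv_smul_right (z u : σ → k) (c : k) (f : MvPolynomial σ k) :
    dirDeriv z (c • u) f = c * dirDeriv z u f := by
  simp only [dirDeriv, Finset.mul_sum, Pi.smul_apply, smul_eq_mul]
  refine Finset.sum_congr rfl fun i _ => by ring

def dirDerivHom (z : σ → k) (f : MvPolynomial σ k) : (σ → k) →ₗ[k] k where
  toFun u := dirDeriv z u f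
  map_add' u w := dirDeriv_add_right z u w f
  map_smul' c u := dirDeriv_smul_right z u c f

/-- The Zariski tangent space at `z` to the zero set of `I`. -/
def tanSpace (I : Set (MvPolynomial σ k)) (z : σ → k) : Submodule k (σ → k) :=
  ⨅ f ∈ I, LinearMap.ker (dirDerivHom z f)

lemma mem_tanSpace {I : Set (MvPolynomial σ k)} {z u : σ → k} :
    u ∈ tanSpace I z ↔ ∀ f ∈ I, dirDeriv z u f = 0 := by
  simp [tanSpace, dirDerivHom]

lemma dirDeriv_smul_left {f : MvPolynomial σ k} {d : ℕ} (hf : f.IsHomogeneous d) (c : k)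
    (z u : σ → k) : dirDeriv (c • z) u f = c ^ (d - 1) * dirDeriv z u f := by
  simp only [dirDeriv, Finset.mul_sum]
  refine Finset.sum_congr rfl fun i _ => ?_
  rw [IsHomogeneous.eval_smul hf.pderiv, mul_assoc]

lemma dirDeriv_self {f : MvPolynomial σ k} {d : ℕ} (hf : f.IsHomogeneous d) (z : σ → k) :
    dirDeriv z z f = d * eval z f := by
  have := congrArg (eval z) hf.sum_X_mul_pderiv
  simpa [dirDeriv, mul_comm, nsmul_eq_mul] using this

lemma finrank_tanSpace_le {N m : ℕ} {X : Set (PS k N)} (hX : IsSmoothVar X m) (hm : m + 1 ≤ N)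
    {z : Fin N → k} (hz : z ∈ cone X) (hz0 : z ≠ 0) :
    Module.finrank k (tanSpace (homogCut X) z) ≤ m + 1 := by
  set p := Projectivization.mk k z hz0 with hp
  have h1 : Module.finrank k (gradSpan X p) = N - (m + 1) := hX p (hz hz0)
  obtain ⟨c, hc⟩ := Projectivization.exists_smul_eq_mk_rep k z hz0
  set B : LinearMap.BilinForm k (Fin N → k) := dotProductBilin k k with hB
  have hBn : B.Nondegenerate := ⟨fun v h => dotProduct_eq_zero v h, fun v h =>
    dotProduct_eq_zero v fun w => by rw [dotProduct_comm]; exact h w⟩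
  have hle : tanSpace (homogCut X) z ≤ B.orthogonal (gradSpan X p) := by
    intro u hu
    rw [mem_tanSpace] at hu
    rw [LinearMap.BilinForm.mem_orthogonal_iff]
    intro g hg
    change B g u = 0
    induction hg using Submodule.span_induction with
    | mem g hg =>
      obtain ⟨f, hf, rfl⟩ := hg
      obtain ⟨⟨d, hd⟩, -⟩ := id hf
      change dirDeriv p.rep u f = 0
      rw [hp, ← hc]
      have := dirDeriv_smul_left hd (c : k) z u
      rw [hu f hf, mul_zero] at this
      exact this
    | zero => simp
    | add a b _ _ ha hb => simp [ha, hb]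
    | smul a b _ hb => simp [hb]
  have h2 := Submodule.finrank_mono hle
  rw [LinearMap.BilinForm.finrank_orthogonal hBn, h1, Module.finrank_fin_fun] at h2
  omega

end Tangent

end EL

namespace EL

section LinePoly

variable {k : Type} [Field k] {σ : Type}

lemma linePoly_coeff_zero (f : MvPolynomial σ k) (v w : σ → k) :
    (linePoly f v w).coeff 0 = eval v f := by
  rw [Polynomial.coeff_zero_eq_eval_zero, eval_linePoly, zero_smul, add_zero]

lemma natDegree_linePoly_le {f : MvPolynomial σ k} {d : ℕ} (hf : f.IsHomogeneous d)
    (v w : σ → k) : (linePoly f v w).natDegree ≤ d := by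
  rw [← mul_one d, linePoly]
  refine aeval_natDegree_le f hf.totalDegree_le _ fun i => ?_
  refine (Polynomial.natDegree_add_le _ _).trans (max_le (by simp) ?_)
  exact (Polynomial.natDegree_mul_le).trans (by simp)

lemma linePoly_reflect [Infinite k] {f : MvPolynomial σ k} {d : ℕ} (hf : f.IsHomogeneous d)
    (v w : σ → k) : (linePoly f v w).reflect d = linePoly f w v := by
  refine mul_left_cancel₀ (Polynomial.X_ne_zero (R := k)) (Polynomial.funext fun s => ?_)
  by_cases hs : s = 0
  · simp [hs]
  · let := invertibleOfNonzero (inv_ne_zero hs)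
    have h := Polynomial.eval₂_reflect_mul_pow (RingHom.id k) s⁻¹ d (linePoly f v w)
      (natDegree_linePoly_le hf v w)
    rw [invOf_eq_inv, inv_inv, Polynomial.eval₂_id, Polynomial.eval₂_id, eval_linePoly] at h
    rw [Polynomial.eval_mul, Polynomial.eval_mul]
    congr 1
    rw [eval_linePoly]
    have h2 : w + s • v = s • (v + s⁻¹ • w) := by
      rw [smul_add, smul_smul, mul_inv_cancel₀ hs, one_smul, add_comm]
    rw [h2, IsHomogeneous.eval_smul hf, ← h, inv_pow, mul_comm, mul_assoc,
      inv_mul_cancel₀ (pow_ne_zero _ hs), mul_one]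

lemma linePoly_coeff_sub [Infinite k] {f : MvPolynomial σ k} {d i : ℕ} (hf : f.IsHomogeneous d)
    (hi : i ≤ d) (v w : σ → k) : (linePoly f v w).coeff (d - i) = (linePoly f w v).coeff i := by
  rw [← linePoly_reflect hf v w, Polynomial.coeff_reflect, Polynomial.revAt_le hi]

lemma linePoly_coeff_top [Infinite k] {f : MvPolynomial σ k} {d : ℕ} (hf : f.IsHomogeneous d)
    (v w : σ → k) : (linePoly f v w).coeff d = eval w f := by
  have := linePoly_coeff_sub hf (Nat.zero_le d) v w
  rwa [Nat.sub_zero, linePoly_coeff_zero] at this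

lemma natDegree_linePoly [Infinite k] {f : MvPolynomial σ k} {d : ℕ} (hf : f.IsHomogeneous d)
    (v : σ → k) {w : σ → k} (hw : eval w f ≠ 0) : (linePoly f v w).natDegree = d := by
  refine le_antisymm (natDegree_linePoly_le hf v w) (Polynomial.le_natDegree_of_ne_zero ?_)
  rwa [linePoly_coeff_top hf]

lemma IsHomogeneous.eq_zero_of_dvd {F G : MvPolynomial σ k} {d e : ℕ} (hF : F.IsHomogeneous d)
    (hG : G.IsHomogeneous e) (h : e < d) (hdvd : F ∣ G) : G = 0 := by
  by_contra h0
  have hF0 : F ≠ 0 := fun h => h0 (by rw [h, zero_dvd_iff] at hdvd; exact hdvd)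
  have := totalDegree_le_of_dvd_of_isDomain hdvd h0
  rw [hF.totalDegree hF0, hG.totalDegree h0] at this
  omega

variable [Fintype σ]

lemma eval_derivative_linePoly (f : MvPolynomial σ k) (v w : σ → k) (t : k) :
    (linePoly f v w).derivative.eval t = dirDeriv (v + t • w) w f := by
  induction f using MvPolynomial.induction_on with
  | C a => simp [linePoly, dirDeriv_C]
  | add f g hf hg => rw [dirDeriv_add, ← hf, ← hg]; simp [linePoly]
  | mul_X f i hf =>
    have h : linePoly (f * X i) v w =
        linePoly f v w * (Polynomial.C (v i) + Polynomial.X * Polynomial.C (w i)) := by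
      simp [linePoly]
    rw [dirDeriv_mul, ← hf, h, dirDeriv_X, ← eval_linePoly f, eval_X]
    simp only [Polynomial.derivative_mul, Polynomial.derivative_add, Polynomial.derivative_C, Polynomial.derivative_X, Polynomial.eval_add, Polynomial.eval_mul, Polynomial.eval_C, Polynomial.eval_X,
      Polynomial.eval_zero, Polynomial.eval_one, Pi.add_apply, Pi.smul_apply, smul_eq_mul]
    ring

lemma linePoly_coeff_one (f : MvPolynomial σ k) (v w : σ → k) :
    (linePoly f v w).coeff 1 = dirDeriv v w f := by
  have := eval_derivative_linePoly f v w 0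
  rw [zero_smul, add_zero, ← Polynomial.coeff_zero_eq_eval_zero, Polynomial.coeff_derivative] at this
  simpa using this

/-- The derivative of `f` in the direction `u`, as a polynomial. -/
def dirPoly (u : σ → k) (f : MvPolynomial σ k) : MvPolynomial σ k := ∑ i, C (u i) * pderiv i f

lemma eval_dirPoly (z u : σ → k) (f : MvPolynomial σ k) :
    eval z (dirPoly u f) = dirDeriv z u f := by
  simp [dirPoly, dirDeriv, mul_comm]

lemma isHomogeneous_dirPoly (u : σ → k) {f : MvPolynomial σ k} {d : ℕ} (hf : f.IsHomogeneous d) :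
    (dirPoly u f).IsHomogeneous (d - 1) :=
  IsHomogeneous.sum _ _ _ fun i _ => by
    simpa using (isHomogeneous_C σ (u i)).mul (hf.pderiv (i := i))

end LinePoly

section Plane

variable {k : Type} [Field k]

lemma krull_bound {p0 p1 p2 p3 p4 : Ideal (MvPolynomial (Fin 3) k)} (h0 : p0.IsPrime)
    (h1 : p1.IsPrime) (h2 : p2.IsPrime) (h3 : p3.IsPrime) (h4 : p4.IsPrime)
    (h01 : p0 < p1) (h12 : p1 < p2) (h23 : p2 < p3) (h34 : p3 < p4) : False := by
  have e1 : (⟨p0, h0⟩ : PrimeSpectrum (MvPolynomial (Fin 3) k)) < ⟨p1, h1⟩ := h01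
  have e2 : (⟨p1, h1⟩ : PrimeSpectrum (MvPolynomial (Fin 3) k)) < ⟨p2, h2⟩ := h12
  have e3 : (⟨p2, h2⟩ : PrimeSpectrum (MvPolynomial (Fin 3) k)) < ⟨p3, h3⟩ := h23
  have e4 : (⟨p3, h3⟩ : PrimeSpectrum (MvPolynomial (Fin 3) k)) < ⟨p4, h4⟩ := h34
  let s0 : LTSeries (PrimeSpectrum (MvPolynomial (Fin 3) k)) := RelSeries.singleton _ ⟨p0, h0⟩
  let s1 : LTSeries _ := s0.snoc ⟨p1, h1⟩ (by simpa [s0] using e1)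
  let s2 : LTSeries _ := s1.snoc ⟨p2, h2⟩ (by simpa [s1] using e2)
  let s3 : LTSeries _ := s2.snoc ⟨p3, h3⟩ (by simpa [s2] using e3)
  let s4 : LTSeries _ := s3.snoc ⟨p4, h4⟩ (by simpa [s3] using e4)
  have h := Order.LTSeries.length_le_krullDim s4
  have hd : Order.krullDim (PrimeSpectrum (MvPolynomial (Fin 3) k)) = 3 := by
    have := MvPolynomial.ringKrullDim_of_isNoetherianRing (R := k) (ι := Fin 3)
    rw [ringKrullDim_eq_zero_of_field, ringKrullDim, Nat.card_eq_fintype_card, Fintype.card_fin,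
      zero_add] at this
    exact this
  rw [hd] at h
  have hl : s4.length = 4 := rfl
  rw [hl] at h
  exact absurd h (by decide)

lemma exists_plane_equation [Infinite k] {K : Set (Fin 3 → k)} (hK : IsConical K)
    (hP : (vanishingIdeal k K).IsPrime)
    (hne : ∃ f : MvPolynomial (Fin 3) k, f ≠ 0 ∧ ∀ v ∈ K, eval v f = 0)
    {x y : Fin 3 → k} (hx : x ∈ K) (hy : y ∈ K) (hx0 : x ≠ 0)
    (hxy : y ∉ Submodule.span k {x}) :
    ∃ d, ∃ F : MvPolynomial (Fin 3) k, F.IsHomogeneous d ∧ Prime F ∧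
      ∀ g : MvPolynomial (Fin 3) k, (∀ v ∈ K, eval v g = 0) ↔ F ∣ g := by
  classical
  have hmem : ∀ g, g ∈ vanishingIdeal k K ↔ ∀ v ∈ K, eval v g = 0 := fun g => by
    simp [mem_vanishingIdeal_iff]
  have hex : ∃ d, ∃ F : MvPolynomial (Fin 3) k, F.IsHomogeneous d ∧ F ≠ 0 ∧
      ∀ v ∈ K, eval v F = 0 := by
    obtain ⟨f, hf0, hf⟩ := hne
    obtain ⟨i, hi⟩ := exists_homogeneousComponent_ne_zero hf0
    exact ⟨i, _, homogeneousComponent_isHomogeneous i f, hi,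
      hK.homogeneousComponent_eq_zero hf i⟩
  obtain ⟨F, hFh, hF0, hFK⟩ := Nat.find_spec hex
  set d := Nat.find hex with hd
  have key : ∀ a b : MvPolynomial (Fin 3) k, F = a * b → (∀ v ∈ K, eval v a = 0) → IsUnit b := by
    intro a b hab ha
    have ha0 : a ≠ 0 := by rintro rfl; exact hF0 (by rw [hab, zero_mul])
    have hb0 : b ≠ 0 := by rintro rfl; exact hF0 (by rw [hab, mul_zero])
    obtain ⟨i, hi⟩ := exists_homogeneousComponent_ne_zero ha0
    have hdi : d ≤ i := Nat.find_min' hex ⟨_, homogeneousComponent_isHomogeneous i a, hi,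
      hK.homogeneousComponent_eq_zero ha i⟩
    have hia : i ≤ a.totalDegree := by
      by_contra hlt
      exact hi (homogeneousComponent_eq_zero i a (by omega))
    have ht := totalDegree_mul_of_isDomain ha0 hb0
    rw [← hab, hFh.totalDegree hF0] at ht
    have hb : b.totalDegree = 0 := by omega
    rw [totalDegree_eq_zero_iff_eq_C] at hb
    rw [hb]
    refine IsUnit.map C (isUnit_iff_ne_zero.2 fun h => hb0 ?_)
    rw [hb, h, C_0]
  have hirr : Irreducible F := by
    refine ⟨fun hu => hP.ne_top (Ideal.eq_top_of_isUnit_mem _ ((hmem F).2 hFK) hu), ?_⟩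
    intro a b hab
    have : a * b ∈ vanishingIdeal k K := hab ▸ (hmem F).2 hFK
    rcases hP.mem_or_mem this with h | h
    · exact Or.inr (key a b hab ((hmem a).1 h))
    · exact Or.inl (key b a (by rw [hab, mul_comm]) ((hmem b).1 h))
  have hprime : Prime F := hirr.prime
  refine ⟨d, F, hFh, hprime, ?_⟩
  have hspan : (Ideal.span {F}).IsPrime := (Ideal.span_singleton_prime hF0).2 hprime
  have hle : Ideal.span {F} ≤ vanishingIdeal k K :=
    (Ideal.span_singleton_le_iff_mem _).2 ((hmem F).2 hFK)
  have heq : Ideal.span {F} = vanishingIdeal k K := by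
    by_contra hne
    set L : Submodule k (Fin 3 → k) := Submodule.span k {x} with hL
    have hmemL : ∀ W : Submodule k (Fin 3 → k), ∀ g, g ∈ vanishingIdeal k (W : Set (Fin 3 → k)) ↔
        ∀ v ∈ W, eval v g = 0 := fun W g => by
      simp [mem_vanishingIdeal_iff]
    have hpr : ∀ W : Submodule k (Fin 3 → k), (vanishingIdeal k (W : Set (Fin 3 → k))).IsPrime := by
      intro W
      refine IsConical.vanishingIdeal_isPrime (fun c v hv => W.smul_mem c hv) ⟨0, W.zero_mem⟩ ?_
      rintro f g - - - - ⟨v, hv, hfv⟩ ⟨w, hw, hgw⟩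
      exact exists_mem_eval_ne_zero W hv hw hfv hgw
    have hstrict : ∀ {I J : Ideal (MvPolynomial (Fin 3) k)}, I ≤ J → ∀ g ∈ J, g ∉ I → I < J :=
      fun hIJ g hg hg' => lt_of_le_of_ne hIJ fun h => hg' (h ▸ hg)
    obtain ⟨φ, hφy, hφx⟩ := Submodule.exists_le_ker_of_notMem hxy
    obtain ⟨ψ, hψx, -⟩ := Submodule.exists_le_ker_of_notMem
      (p := (⊥ : Submodule k (Fin 3 → k))) (v := x) (by simpa using hx0)
    refine krull_bound (Ideal.isPrime_bot) hspan hP (hpr L) (hpr ⊥) ?_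
      (lt_of_le_of_ne hle hne) ?_ ?_
    · exact bot_lt_iff_ne_bot.2 (by simpa using hF0)
    · refine hstrict (fun g hg => (hmemL L g).2 fun v hv => ?_) (linForm φ)
        ((hmemL L _).2 fun v hv => ?_) fun h => ?_
      · obtain ⟨c, rfl⟩ := Submodule.mem_span_singleton.1 hv
        exact (hmem g).1 hg _ (hK c x hx)
      · rw [eval_linForm]; exact hφx hv
      · have := (hmem _).1 h y hy
        rw [eval_linForm] at this
        exact hφy this
    · refine hstrict (fun g hg => (hmemL ⊥ g).2 fun v hv => ?_) (linForm ψ)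
        ((hmemL ⊥ _).2 fun v hv => ?_) fun h => ?_
      · exact (hmemL L g).1 hg v (bot_le (a := L) hv)
      · rw [eval_linForm, (Submodule.mem_bot k).1 hv, map_zero]
      · have := (hmemL L _).1 h x (Submodule.mem_span_singleton_self x)
        rw [eval_linForm] at this
        exact hψx this
  intro g
  rw [← hmem, ← heq, Ideal.mem_span_singleton]

/-- A conical set in three-space, given by a prime form which generates its ideal. -/
structure IsPlaneCurve (K : Set (Fin 3 → k)) (d : ℕ) (F : MvPolynomial (Fin 3) k) : Prop where
  homogeneous : F.IsHomogeneous d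
  prime : Prime F
  mem_iff : ∀ v, v ∈ K ↔ eval v F = 0
  vanish_iff : ∀ g : MvPolynomial (Fin 3) k, (∀ v ∈ K, eval v g = 0) ↔ F ∣ g
  nonlinear : 2 ≤ d

end Plane

end EL

namespace EL

section PlaneCurve

variable {k : Type} [Field k]

lemma IsHomogeneous.exists_linear {σ : Type} [Fintype σ] {F : MvPolynomial σ k}
    (hF : F.IsHomogeneous 1) : ∃ φ : (σ → k) →ₗ[k] k, ∀ v, eval v F = φ v := by
  refine ⟨dirDerivHom 0 F, fun v => ?_⟩
  have h1 := dirDeriv_self hF v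
  rw [Nat.cast_one, one_mul] at h1
  rw [← h1]
  change _ = dirDeriv 0 v F
  have h2 := dirDeriv_smul_left hF 0 v v
  rw [zero_smul, Nat.sub_self, pow_zero, one_mul] at h2
  exact h2.symm

lemma two_le_of_span [Infinite k] {K : Set (Fin 3 → k)} {d : ℕ} {F : MvPolynomial (Fin 3) k}
    (hF : F.IsHomogeneous d) (hp : Prime F) (hK : ∀ v ∈ K, eval v F = 0)
    (hspan : Submodule.span k K = ⊤) : 2 ≤ d := by
  by_contra hlt
  have h01 : d = 0 ∨ d = 1 := by omega
  rcases h01 with rfl | rfl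
  · rw [← totalDegree_zero_iff_isHomogeneous, totalDegree_eq_zero_iff_eq_C] at hF
    apply hp.not_isUnit
    rw [hF]
    refine IsUnit.map C (isUnit_iff_ne_zero.2 fun h => hp.ne_zero ?_)
    rw [hF, h, C_0]
  · obtain ⟨φ, hφ⟩ := IsHomogeneous.exists_linear hF
    have hle : Submodule.span k K ≤ LinearMap.ker φ := Submodule.span_le.2 fun v hv => by
      rw [SetLike.mem_coe, LinearMap.mem_ker, ← hφ, hK v hv]
    rw [hspan] at hle
    refine hp.ne_zero (MvPolynomial.funext fun v => ?_)
    rw [hφ, map_zero]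
    exact hle trivial

lemma IsPlaneCurve.not_dvd_dirPoly [CharZero k] {K : Set (Fin 3 → k)} {d : ℕ}
    {F : MvPolynomial (Fin 3) k} (hC : IsPlaneCurve K d F) {o : Fin 3 → k} (ho : eval o F ≠ 0) :
    ¬ F ∣ dirPoly o F := by
  intro hdvd
  have hd := hC.nonlinear
  have h0 := IsHomogeneous.eq_zero_of_dvd hC.homogeneous (isHomogeneous_dirPoly o hC.homogeneous)
    (by omega) hdvd
  have h1 := dirDeriv_self hC.homogeneous o
  rw [← eval_dirPoly, h0, map_zero] at h1
  exact mul_ne_zero (Nat.cast_ne_zero.2 (by omega)) ho h1.symm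

/-- The multiset of parameters of the points in which a line meets a plane curve. -/
lemma card_roots_linePoly [IsAlgClosed k] {F : MvPolynomial (Fin 3) k} {d : ℕ}
    (hF : F.IsHomogeneous d) (x : Fin 3 → k) {o : Fin 3 → k} (ho : eval o F ≠ 0) :
    (linePoly F x o).roots.card = d := by
  rw [← natDegree_linePoly hF x ho]
  exact Polynomial.splits_iff_card_roots.1 (IsAlgClosed.splits _)

lemma linePoly_ne_zero [Infinite k] {F : MvPolynomial (Fin 3) k} {d : ℕ}
    (hF : F.IsHomogeneous d) (x : Fin 3 → k) {o : Fin 3 → k} (ho : eval o F ≠ 0) :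
    linePoly F x o ≠ 0 := fun h => ho (by rw [← linePoly_coeff_top hF x o, h, Polynomial.coeff_zero])

lemma one_lt_rootMultiplicity_linePoly [Infinite k] [DecidableEq k] {F : MvPolynomial (Fin 3) k} {d : ℕ}
    (hF : F.IsHomogeneous d) (x : Fin 3 → k) {o : Fin 3 → k} (ho : eval o F ≠ 0) {t : k}
    (h : 1 < (linePoly F x o).roots.count t) : eval (x + t • o) (dirPoly o F) = 0 := by
  rw [Polynomial.count_roots,
    Polynomial.one_lt_rootMultiplicity_iff_isRoot (linePoly_ne_zero hF x ho)] at h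
  rw [eval_dirPoly, ← eval_derivative_linePoly]
  exact h.2

lemma IsPlaneCurve.exists_chord [IsAlgClosed k] {K : Set (Fin 3 → k)} {d : ℕ}
    {F : MvPolynomial (Fin 3) k} (hC : IsPlaneCurve K d F) {o x : Fin 3 → k} (ho : eval o F ≠ 0)
    (hx : eval x (dirPoly o F) ≠ 0) : ∃ t : k, t ≠ 0 ∧ x + t • o ∈ K := by
  classical
  by_contra! hcon
  have hall : ∀ t ∈ (linePoly F x o).roots, t = 0 := by
    intro t ht
    by_contra ht0
    apply hcon t ht0
    rw [hC.mem_iff, ← eval_linePoly]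
    exact (Polynomial.mem_roots'.1 ht).2
  have hrep := Multiset.eq_replicate_card.2 hall
  have hd := hC.nonlinear
  refine hx ?_
  have := one_lt_rootMultiplicity_linePoly hC.homogeneous x ho (t := 0) (by
    rw [hrep, Multiset.count_replicate_self, card_roots_linePoly hC.homogeneous x ho]; omega)
  simpa using this

/-- A plane curve all of whose chords through a point meet it only twice is a conic. -/
lemma IsPlaneCurve.eq_two [IsAlgClosed k] [CharZero k] {K : Set (Fin 3 → k)} {d : ℕ}
    {F : MvPolynomial (Fin 3) k} (hC : IsPlaneCurve K d F) {q : Fin 3 → k} (hq : eval q F ≠ 0)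
    (htri : ∀ x ∈ K, x ≠ 0 → ∀ t₁ t₂ : k, t₁ ≠ 0 → t₂ ≠ 0 → x + t₁ • q ∈ K → x + t₂ • q ∈ K →
      t₁ = t₂) : d = 2 := by
  classical
  by_contra hd2
  have hd := hC.nonlinear
  have hF := hC.homogeneous
  set g := dirPoly q F with hg
  have hgh : g.IsHomogeneous (d - 1) := isHomogeneous_dirPoly q hF
  have hd1 : ((d - 1 : ℕ) : k) ≠ 0 := Nat.cast_ne_zero.2 (by omega)
  set b : k := (((d - 1 : ℕ) : k) * eval q F)⁻¹ with hb
  let Λ : (Fin 3 → k) →ₗ[k] (Fin 3 → k) :=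
    LinearMap.id - b • (dirDerivHom q F).smulRight q
  have hΛ : ∀ x, Λ x = x + (- (b * dirDeriv q x F)) • q := fun x => by
    simp only [Λ, LinearMap.sub_apply, LinearMap.id_apply, LinearMap.smul_apply,
      LinearMap.smulRight_apply, neg_smul, mul_smul, ← sub_eq_add_neg]
    rfl
  have hvan : ∀ x ∈ K, eval x g ≠ 0 → eval (Λ x) g = 0 := by
    intro x hx hgx
    have hx0 : x ≠ 0 := by
      rintro rfl
      apply hgx
      have := IsHomogeneous.eval_smul hgh 0 0
      rwa [zero_smul, zero_pow (by omega), zero_mul] at this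
    set R := (linePoly F x q).roots with hR
    have hcard : R.card = d := card_roots_linePoly hF x hq
    have hmemR : ∀ t, t ∈ R ↔ x + t • q ∈ K := fun t => by
      rw [hC.mem_iff, ← eval_linePoly, hR, Polynomial.mem_roots (linePoly_ne_zero hF x hq)]
      rfl
    have h0R : (0 : k) ∈ R := by rw [hmemR]; simpa using hx
    have hc0 : R.count 0 = 1 := by
      refine le_antisymm ?_ (Multiset.one_le_count_iff_mem.2 h0R)
      by_contra hlt
      have := one_lt_rootMultiplicity_linePoly hF x hq (not_le.1 hlt)
      rw [zero_smul, add_zero] at this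
      exact hgx this
    obtain ⟨t, ht0, ht⟩ := hC.exists_chord hq hgx
    have hall : ∀ s ∈ R.erase 0, s = t := by
      intro s hs
      have hs0 : s ≠ 0 := by
        rintro rfl
        have := Multiset.one_le_count_iff_mem.2 hs
        rw [Multiset.count_erase_self, hc0] at this
        omega
      exact htri x hx hx0 s t hs0 ht0 ((hmemR s).1 (Multiset.mem_of_mem_erase hs)) ht
    have hrep := Multiset.eq_replicate_card.2 hall
    have hcard' : (R.erase 0).card = d - 1 := by rw [Multiset.card_erase_of_mem h0R, hcard]; rfl
    rw [hcard'] at hrep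
    have hsum : R.sum = (d - 1 : ℕ) * t := by
      rw [← Multiset.cons_erase h0R, hrep]
      simp
    have hnext : dirDeriv q x F = - eval q F * R.sum := by
      have h1 := Polynomial.Splits.nextCoeff_eq_neg_sum_roots_mul_leadingCoeff
        (IsAlgClosed.splits (linePoly F x q))
      rw [Polynomial.nextCoeff_of_natDegree_pos (by rw [natDegree_linePoly hF x hq]; omega),
        Polynomial.leadingCoeff, natDegree_linePoly hF x hq, linePoly_coeff_top hF,
        linePoly_coeff_sub hF (by omega), linePoly_coeff_one] at h1
      exact h1
    have htt : - (b * dirDeriv q x F) = t := by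
      rw [hnext, hsum, hb]
      field_simp
    rw [hΛ, htt]
    refine one_lt_rootMultiplicity_linePoly hF x hq ?_
    have : 1 < (R.erase 0).count t := by rw [hrep, Multiset.count_replicate_self]; omega
    exact lt_of_lt_of_le this (Multiset.count_le_of_le _ (Multiset.erase_le _ _))
  have hdvd : F ∣ g * pullback Λ g := by
    refine (hC.vanish_iff _).1 fun x hx => ?_
    rw [map_mul, eval_pullback]
    by_cases h : eval x g = 0
    · rw [h, zero_mul]
    · rw [hvan x hx h, mul_zero]
  rcases hC.prime.dvd_or_dvd hdvd with h | h
  · exact hC.not_dvd_dirPoly hq h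
  · have h0 := IsHomogeneous.eq_zero_of_dvd hF (pullback_isHomogeneous Λ hgh) (by omega) h
    have h1 := eval_pullback Λ g q
    have hqq := dirDeriv_self hF q
    have hΛq : Λ q = (1 - b * (d * eval q F)) • q := by
      rw [hΛ, hqq, sub_smul, one_smul, neg_smul, ← sub_eq_add_neg]
    rw [h0, map_zero, hΛq, IsHomogeneous.eval_smul hgh, eval_dirPoly, hqq] at h1
    refine mul_ne_zero (pow_ne_zero _ ?_) (mul_ne_zero (Nat.cast_ne_zero.2 (by omega)) hq) h1.symm
    rw [hb]
    have hcast : ((d : ℕ) : k) = ((d - 1 : ℕ) : k) + 1 := by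
      rw [← Nat.cast_succ, Nat.succ_eq_add_one, Nat.sub_add_cancel (by omega)]
    rw [hcast]
    intro hz
    field_simp at hz
    simp at hz

lemma plane_eq_of_subset {K K' : Set (Fin 3 → k)} {F F' : MvPolynomial (Fin 3) k}
    (hF : ∀ v, v ∈ K ↔ eval v F = 0) (hF' : ∀ v, v ∈ K' ↔ eval v F' = 0)
    (hp : Prime F) (hp' : Prime F') (h : ∀ g : MvPolynomial (Fin 3) k, (∀ v ∈ K, eval v g = 0) ↔ F ∣ g)
    (hKK : K ⊆ K') : K = K' := by
  have hd : F ∣ F' := (h F').1 fun v hv => (hF' v).1 (hKK hv)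
  have ha : F' ∣ F := (hp.irreducible.associated_of_dvd hp'.irreducible hd).dvd'
  refine hKK.antisymm fun v hv => (hF v).2 ?_
  obtain ⟨c, rfl⟩ := ha
  rw [map_mul, (hF' v).1 hv, zero_mul]

end PlaneCurve

end EL

namespace EL

section Param

variable {k : Type} [Field k] {N : ℕ}

lemma exists_param {r : ℕ} (W : Submodule k (Fin N → k)) (hW : Module.finrank k W = r) :
    ∃ (e : (Fin r → k) →ₗ[k] (Fin N → k)) (π : (Fin N → k) →ₗ[k] (Fin r → k)),
      LinearMap.range e = W ∧ ∀ v, π (e v) = v := by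
  have b : (Fin r → k) ≃ₗ[k] W := LinearEquiv.ofFinrankEq _ _ (by rw [hW, Module.finrank_fin_fun])
  obtain ⟨π, hπ⟩ := LinearMap.exists_leftInverse_of_injective (W.subtype ∘ₗ b.toLinearMap)
    (LinearMap.ker_eq_bot.2 (W.injective_subtype.comp b.injective))
  refine ⟨W.subtype ∘ₗ b.toLinearMap, π, ?_, fun v => LinearMap.congr_fun hπ v⟩
  rw [LinearMap.range_comp, LinearEquiv.range, Submodule.map_top, Submodule.range_subtype]

lemma span_cone (S : Set (PS k N)) : Submodule.span k (cone S) = pspan S := by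
  refine le_antisymm (Submodule.span_le.2 fun v hv => mem_pspan_of_mem_cone hv) ?_
  exact iSup₂_le fun p hp => submodule_le_iff_rep.2 (Submodule.subset_span (rep_mem_cone.2 hp))

section Comap

variable {r : ℕ} {S : Set (PS k N)} {e : (Fin r → k) →ₗ[k] (Fin N → k)}
  {π : (Fin N → k) →ₗ[k] (Fin r → k)}

lemma isConical_comap : IsConical (e ⁻¹' cone S) := fun c v hv => by
  rw [Set.mem_preimage, map_smul]
  exact isConical_cone S c _ hv

lemma span_comap (he : LinearMap.range e = pspan S) (hπ : ∀ v, π (e v) = v) :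
    Submodule.span k (e ⁻¹' cone S) = ⊤ := by
  have hi : Function.Injective e := Function.LeftInverse.injective hπ
  apply Submodule.map_injective_of_injective hi
  rw [Submodule.map_span, Set.image_preimage_eq_of_subset, span_cone, Submodule.map_top, he]
  intro v hv
  have := mem_pspan_of_mem_cone hv
  rwa [← he] at this

lemma exists_param_eq (he : LinearMap.range e = pspan S) (hπ : ∀ v, π (e v) = v)
    {v : Fin N → k} (hv : v ∈ pspan S) : e (π v) = v := by
  rw [← he] at hv
  obtain ⟨w, rfl⟩ := hv
  rw [hπ]

lemma comap_isPrime [Infinite k] (hS : IsIrreducible S) (he : LinearMap.range e = pspan S)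
    (hπ : ∀ v, π (e v) = v) : (vanishingIdeal k (e ⁻¹' cone S)).IsPrime :=
  vanishingIdeal_comap_isPrime hS e (Function.LeftInverse.injective hπ)
    (fun _ hp => he ▸ submodule_le_iff_rep.2 (mem_pspan hp)) π hπ

lemma mem_comap_of_eval (hS : IsClosed S) (hne : S.Nonempty) {v : Fin r → k}
    (h : ∀ g : MvPolynomial (Fin r) k, (∀ w ∈ e ⁻¹' cone S, eval w g = 0) → eval v g = 0) :
    v ∈ e ⁻¹' cone S := by
  refine mem_cone_of_homogCut hS fun f hf => ?_
  rw [← eval_pullback]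
  refine h _ fun w hw => ?_
  rw [eval_pullback]
  exact eval_eq_zero_of_mem_homogCut hne hf _ hw

end Comap

variable {S : Set (PS k N)} {e : (Fin 3 → k) →ₗ[k] (Fin N → k)}
  {π : (Fin N → k) →ₗ[k] (Fin 3 → k)}

lemma exists_isPlaneCurve [Infinite k] (hS : IsClosed S) (hirr : IsIrreducible S)
    (he : LinearMap.range e = pspan S) (hπ : ∀ v, π (e v) = v) {o : Fin N → k}
    (ho : o ∈ pspan S) (hoS : o ∉ cone S) :
    ∃ d F, IsPlaneCurve (e ⁻¹' cone S) d F := by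
  set K := e ⁻¹' cone S with hK
  have hsp : Submodule.span k K = ⊤ := span_comap he hπ
  have hnot : ∀ x : Fin 3 → k, ∃ y ∈ K, y ∉ Submodule.span k {x} := by
    intro x
    by_contra! hcon
    have hle : Submodule.span k K ≤ Submodule.span k {x} := Submodule.span_le.2 hcon
    rw [hsp] at hle
    have h1 := Submodule.finrank_mono hle
    rw [finrank_top, Module.finrank_fin_fun] at h1
    have h2 := finrank_span_le_card (R := k) ({x} : Set (Fin 3 → k))
    simp at h2
    omega
  obtain ⟨x, hx, hx0⟩ := hnot 0
  obtain ⟨y, hy, hxy⟩ := hnot x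
  have hex : ∃ f : MvPolynomial (Fin 3) k, f ≠ 0 ∧ ∀ v ∈ K, eval v f = 0 := by
    by_contra! hcon
    apply hoS
    have : π o ∈ K := mem_comap_of_eval hS hirr.nonempty fun g hg => by
      by_contra hgo
      obtain ⟨v, hv, hgv⟩ := hcon g (by rintro rfl; simp at hgo)
      exact hgv (hg v hv)
    rwa [hK, Set.mem_preimage, exists_param_eq he hπ ho] at this
  obtain ⟨d, F, hF, hp, hd⟩ := exists_plane_equation isConical_comap (comap_isPrime hirr he hπ) hex
    hx hy (by rintro rfl; simp at hx0) hxy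
  have hvan : ∀ v ∈ K, eval v F = 0 := (hd F).2 dvd_rfl
  refine ⟨d, F, hF, hp, fun v => ⟨fun hv => hvan v hv, fun hv => ?_⟩, hd,
    two_le_of_span hF hp hvan hsp⟩
  refine mem_comap_of_eval hS hirr.nonempty fun g hg => ?_
  obtain ⟨c, rfl⟩ := (hd g).1 hg
  rw [map_mul, hv, zero_mul]

end Param

section EntryPlane

variable {k : Type} [Field k] {N : ℕ} {X : Set (PS k N)}

lemma isClosed_entryLocus (q : PS k N) : IsClosed (entryLocus X q) := isClosed_closure

lemma mem_pspan_entryLocus {q : PS k N} (h : (entryLocus X q).Nonempty) :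
    q.rep ∈ pspan (entryLocus X q) := by
  obtain ⟨p, hp⟩ := closure_nonempty_iff.1 h
  obtain ⟨A, hA, -⟩ := Set.mem_iUnion₂.1 hp
  have h1 := hA.2.2.1
  rw [memSpan, submodule_le_iff_rep] at h1
  refine pspan_mono ?_ h1
  exact (Set.subset_biUnion_of_mem (u := fun A : Finset (PS k N) => (↑A : Set (PS k N))) hA).trans
    subset_closure

/-- A plane entry locus is contained in the entry locus of any point of its plane. -/
lemma entryLocus_subset_of_plane [IsAlgClosed k] [CharZero k] {C : Set (PS k N)}
    (hCX : C ⊆ X)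
    {e : (Fin 3 → k) →ₗ[k] (Fin N → k)} {π : (Fin N → k) →ₗ[k] (Fin 3 → k)}
    (he : LinearMap.range e = pspan C) (hπ : ∀ v, π (e v) = v) {d : ℕ}
    {F : MvPolynomial (Fin 3) k} (hF : IsPlaneCurve (e ⁻¹' cone C) d F) {o : PS k N}
    (ho : o.rep ∈ pspan C) (hoX : o ∉ X) : C ⊆ entryLocus X o := by
  have hoX' : o.rep ∉ cone X := fun h => hoX (rep_mem_cone.1 h)
  have hoe := exists_param_eq he hπ ho
  have hFo : eval (π o.rep) F ≠ 0 := fun h => hoX' (cone_mono hCX (by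
    have := (hF.mem_iff _).2 h
    rwa [Set.mem_preimage, hoe] at this))
  have key : ∀ f ∈ homogCut (entryLocus X o), ∀ v ∈ e ⁻¹' cone C, eval v (pullback e f) = 0 := by
    intro f hf
    obtain ⟨⟨m, hm⟩, -⟩ := id hf
    have hdvd : F ∣ dirPoly (π o.rep) F * pullback e f := by
      refine (hF.vanish_iff _).1 fun x hx => ?_
      rw [map_mul, eval_pullback]
      by_cases hgx : eval x (dirPoly (π o.rep) F) = 0
      · rw [hgx, zero_mul]
      obtain ⟨t, ht0, ht⟩ := hF.exists_chord hFo hgx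
      rw [Set.mem_preimage, map_add, map_smul, hoe] at ht
      have hmem : e x ∈ cone (entryLocus X o) := by
        intro hx0
        have h1 := mem_entrySet (a := -t⁻¹) hoX' o.rep_nonzero (cone_mono hCX hx) hx0 (by
          have : o.rep - (-t⁻¹) • e x = t⁻¹ • (e x + t • o.rep) := by
            rw [smul_add, smul_smul, inv_mul_cancel₀ ht0]; module
          rw [this]
          exact isConical_cone X _ _ (cone_mono hCX ht))
        have h2 := h1.2
        rw [Projectivization.mk_rep] at h2
        exact subset_closure h2
      have hx0 : e x ≠ 0 := fun h0 => hgx (by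
        have hx' : x = (0 : k) • x := by rw [zero_smul, ← hπ x, h0, map_zero]
        have hd := hF.nonlinear
        rw [hx', IsHomogeneous.eval_smul (isHomogeneous_dirPoly (π o.rep) hF.homogeneous),
          zero_pow (by omega), zero_mul])
      rw [eval_eq_zero_of_mem_homogCut ⟨_, hmem hx0⟩ hf _ hmem, mul_zero]
    rcases hF.prime.dvd_or_dvd hdvd with h | h
    · exact absurd h (hF.not_dvd_dirPoly hFo)
    · exact (hF.vanish_iff _).2 h
  intro p hp
  rw [← rep_mem_cone]
  refine mem_cone_of_homogCut isClosed_closure fun f hf => ?_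
  have := key f hf (π p.rep)
  rw [eval_pullback, Set.mem_preimage, exists_param_eq he hπ (mem_pspan hp)] at this
  exact this (rep_mem_cone.2 hp)

lemma exists_notMem_of_smooth [Infinite k] {m : ℕ} (hN : m + 1 < N) (hsm : IsSmoothVar X m) :
    Xᶜ.Nonempty := by
  by_contra hcon
  rw [Set.not_nonempty_iff_eq_empty, Set.compl_empty_iff] at hcon
  subst hcon
  have h : ∀ f ∈ homogCut (Set.univ : Set (PS k N)), f = 0 := by
    rintro f ⟨⟨d, hd⟩, hf⟩
    by_contra hf0
    obtain ⟨p, hp⟩ := nonempty_compl_V0 (by omega) hd hf0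
    exact hp (hf trivial)
  have h1 : Nonempty (PS k N) := by
    have : Nontrivial (Fin N → k) := by
      have : Nonempty (Fin N) := ⟨⟨0, by omega⟩⟩
      infer_instance
    infer_instance
  obtain ⟨p⟩ := h1
  have h2 : Module.finrank k (gradSpan Set.univ p) = N - (m + 1) := hsm p trivial
  have h3 : gradSpan Set.univ p = ⊥ := by
    rw [gradSpan, Submodule.span_eq_bot]
    rintro _ ⟨f, hf, rfl⟩
    rw [h f hf]
    ext i
    simp
  rw [h3, finrank_bot] at h2
  omega

theorem typeI_typeA_of_conic [IsAlgClosed k] [CharZero k] (hX : IsClosed X) (hne : Xᶜ.Nonempty)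
    (h : Generic fun q : PS k N => IsIrreducible (entryLocus X q) ∧
      spanDim (entryLocus X q) = 2) : TypeI X ∧ TypeA X := by
  obtain ⟨U, hU, hUd, hq⟩ := h
  refine ⟨⟨U, hU, hUd, fun q hqU => (hq q hqU).1⟩, U ∩ Xᶜ, hU.inter hX.isOpen_compl,
    hUd.inter_of_isOpen_right (dense_of_isOpen hX.isOpen_compl hne) hX.isOpen_compl, ?_⟩
  rintro q ⟨hqU, hqX⟩
  obtain ⟨hirr, hdim⟩ := hq q hqU
  have hfin : ∀ q ∈ U, Module.finrank k (pspan (entryLocus X q)) = 3 := fun q hqU => by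
    have := (hq q hqU).2
    rw [spanDim] at this
    omega
  have hqW := mem_pspan_entryLocus hirr.nonempty
  obtain ⟨e, π, he, hπ⟩ := exists_param _ (hfin q hqU)
  have hCX := entryLocus_subset hX (q := q)
  have hqC : q.rep ∉ cone (entryLocus X q) := fun h => hqX (hCX (rep_mem_cone.1 h))
  obtain ⟨d, F, hF⟩ := exists_isPlaneCurve (isClosed_entryLocus q) hirr he hπ hqW hqC
  refine ⟨U ∩ Xᶜ, hU.inter hX.isOpen_compl, ?_, ?_⟩
  · refine subset_closure_inter_of_isPreirreducible_of_isOpen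
      (isIrreducible_linSet fun h0 => ?_).isPreirreducible (hU.inter hX.isOpen_compl)
      ⟨q, submodule_le_iff_rep.2 hqW, hqU, hqX⟩
    rw [h0, Submodule.mem_bot] at hqW
    exact q.rep_nonzero hqW
  · rintro o ⟨hoW, hoU, hoX⟩
    have hoW' : o.rep ∈ pspan (entryLocus X q) := submodule_le_iff_rep.1 hoW
    have hsub := entryLocus_subset_of_plane hCX he hπ hF hoW' hoX
    have hW : pspan (entryLocus X q) = pspan (entryLocus X o) :=
      Submodule.eq_of_le_of_finrank_eq (pspan_mono hsub) (by rw [hfin q hqU, hfin o hoU])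
    have he' := he.trans hW
    obtain ⟨d', F', hF'⟩ := exists_isPlaneCurve (isClosed_entryLocus o) (hq o hoU).1 he' hπ
      (mem_pspan_entryLocus (hq o hoU).1.nonempty)
      (fun h => hoX (entryLocus_subset hX (rep_mem_cone.1 h)))
    have hKK := plane_eq_of_subset hF.mem_iff hF'.mem_iff hF.prime hF'.prime hF.vanish_iff
      (Set.preimage_mono (cone_mono hsub))
    refine Set.Subset.antisymm (fun p hp => ?_) hsub
    have hp' : π p.rep ∈ e ⁻¹' cone (entryLocus X q) := by
      rw [hKK, Set.mem_preimage, exists_param_eq he' hπ (mem_pspan hp)]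
      exact rep_mem_cone.2 hp
    rw [Set.mem_preimage, exists_param_eq he' hπ (mem_pspan hp)] at hp'
    exact rep_mem_cone.1 hp'

end EntryPlane

end EL

namespace EL

section LinearAlgebra

variable {k V E : Type} [Field k] [AddCommGroup V] [Module k V] [FiniteDimensional k V]
  [AddCommGroup E] [Module k E] [FiniteDimensional k E]

lemma finrank_map_add_finrank_inf_ker (P : Submodule k V) (f : V →ₗ[k] E) :
    Module.finrank k (P.map f) + Module.finrank k (P ⊓ LinearMap.ker f : Submodule k V) =
      Module.finrank k P := by
  rw [← LinearMap.finrank_range_add_finrank_ker (f.domRestrict P), LinearMap.range_domRestrict,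
    LinearMap.ker_domRestrict, ← Submodule.finrank_map_subtype_eq, Submodule.map_comap_subtype]

lemma finrank_add_finrank_le_of_map_le {P : Submodule k V} (f : V →ₗ[k] E) {L W : Submodule k E}
    (hP : P.map f ≤ W) (hL : L ≤ W) :
    Module.finrank k P + Module.finrank k L ≤
      Module.finrank k (P ⊓ L.comap f : Submodule k V) + Module.finrank k W := by
  have h1 := finrank_map_add_finrank_inf_ker P f
  have h2 := finrank_map_add_finrank_inf_ker (P ⊓ L.comap f) f
  have h3 := Submodule.finrank_sup_add_finrank_inf_eq (P.map f) L
  have h4 := Submodule.finrank_mono (sup_le hP hL)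
  rw [Submodule.map_inf_eq_map_inf_comap] at h3
  have h5 : P ⊓ L.comap f ⊓ LinearMap.ker f = P ⊓ LinearMap.ker f := by
    have h6 : LinearMap.ker f ≤ L.comap f := fun v hv => by
      rw [Submodule.mem_comap, LinearMap.mem_ker.1 hv]
      exact zero_mem _
    rw [inf_assoc, inf_eq_right.2 h6]
  rw [h5] at h2
  omega

lemma finrank_prod_submodule (P : Submodule k V) (Q : Submodule k E) :
    Module.finrank k (P.prod Q) = Module.finrank k P + Module.finrank k Q := by
  rw [← Module.finrank_prod, ← LinearMap.finrank_range_of_inj (f := P.subtype.prodMap Q.subtype)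
    (P.injective_subtype.prodMap Q.injective_subtype), LinearMap.range_prodMap,
    Submodule.range_subtype, Submodule.range_subtype]

/-- The rank estimate behind the trisecant lemma. -/
lemma map_ne_top_of_trisecant {m : ℕ} {T₁ T₂ T₃ W : Submodule k E} (hm : 2 ≤ m)
    (hE : Module.finrank k E = 2 * m + 1) (h₁ : Module.finrank k T₁ ≤ m + 1)
    (h₂ : Module.finrank k T₂ ≤ m + 1) (h₃ : Module.finrank k T₃ ≤ m + 1) (hT : T₁ ⊔ T₂ = ⊤)
    (hW : Module.finrank k W ≤ 3) (hW₁ : 2 ≤ Module.finrank k (W ⊓ T₁ : Submodule k E))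
    (hW₂ : 2 ≤ Module.finrank k (W ⊓ T₂ : Submodule k E))
    (hW₃ : 2 ≤ Module.finrank k (W ⊓ T₃ : Submodule k E)) (b : k) {y : E} (hy : y ∈ W) :
    ∃ w : E, ∀ u ∈ T₁, ∀ v ∈ T₂, u + v ∈ T₃ → ∀ c : k, w ≠ u + b • v + c • y := by
  let σ : E × E →ₗ[k] E := LinearMap.fst k E E + LinearMap.snd k E E
  let D : (E × E) × k →ₗ[k] E :=
    (LinearMap.fst k E E + b • LinearMap.snd k E E) ∘ₗ LinearMap.fst k (E × E) k +
      (LinearMap.toSpanSingleton k E y) ∘ₗ LinearMap.snd k (E × E) k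
  let S : Submodule k (E × E) := (T₁.prod T₂) ⊓ T₃.comap σ
  let P : Submodule k (E × E) := (W ⊓ T₁).prod (W ⊓ T₂)
  let Q : Submodule k (E × E) := P ⊓ (W ⊓ T₃).comap σ
  have hS : Module.finrank k S ≤ m + 2 := by
    have e1 := finrank_map_add_finrank_inf_ker S σ
    have e2 : Module.finrank k (S.map σ) ≤ m + 1 :=
      (Submodule.finrank_mono (by rintro _ ⟨z, hz, rfl⟩; exact hz.2)).trans h₃
    have e3 := Submodule.finrank_sup_add_finrank_inf_eq T₁ T₂
    rw [hT, finrank_top] at e3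
    have e4 : S ⊓ LinearMap.ker σ ≤
        (T₁ ⊓ T₂).map (LinearMap.prod LinearMap.id (-LinearMap.id)) := by
      rintro ⟨u, v⟩ ⟨⟨⟨hu, hv⟩, -⟩, hk⟩
      have hk' : u + v = 0 := hk
      have hvu : v = -u := (neg_eq_of_add_eq_zero_right hk').symm
      subst hvu
      exact ⟨u, ⟨hu, by simpa using hv⟩, rfl⟩
    have e5 := (Submodule.finrank_mono e4).trans (Submodule.finrank_map_le _ _)
    omega
  have hQ : 3 ≤ Module.finrank k Q := by
    have e1 := finrank_add_finrank_le_of_map_le (P := P) σ (L := W ⊓ T₃) (W := W) (by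
      rintro _ ⟨z, hz, rfl⟩; exact add_mem hz.1.1 hz.2.1) inf_le_left
    have e2 : Module.finrank k P = _ := finrank_prod_submodule _ _
    change 3 ≤ Module.finrank k (P ⊓ (W ⊓ T₃).comap σ : Submodule k (E × E))
    omega
  have hQS : Q ≤ S := by
    rintro z ⟨⟨h1, h2⟩, h3⟩
    exact ⟨⟨h1.2, h2.2⟩, h3.2⟩
  have e1 := finrank_map_add_finrank_inf_ker (Q.prod (⊤ : Submodule k k)) D
  have e2 := finrank_map_add_finrank_inf_ker (S.prod (⊤ : Submodule k k)) D
  have e3 : Module.finrank k ((Q.prod (⊤ : Submodule k k)).map D) ≤ 3 := by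
    refine (Submodule.finrank_mono ?_).trans hW
    rintro _ ⟨⟨⟨u, v⟩, c⟩, ⟨⟨⟨h1, h2⟩, -⟩, -⟩, rfl⟩
    exact add_mem (add_mem h1.1 (W.smul_mem _ h2.1)) (W.smul_mem _ hy)
  have e4 := Submodule.finrank_mono (inf_le_inf_right (LinearMap.ker D)
    (Submodule.prod_mono hQS (le_refl (⊤ : Submodule k k))))
  rw [finrank_prod_submodule, finrank_top, Module.finrank_self] at e1 e2
  have e5 : (S.prod (⊤ : Submodule k k)).map D ≠ ⊤ := by
    intro h
    rw [h, finrank_top] at e2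
    omega
  by_contra! hcon
  apply e5
  rw [eq_top_iff]
  rintro w -
  obtain ⟨u, hu, v, hv, huv, c, rfl⟩ := hcon w
  exact ⟨((u, v), c), ⟨⟨⟨hu, hv⟩, huv⟩, trivial⟩, rfl⟩

end LinearAlgebra

section Sard

variable {k : Type} [Field k] [CharZero k] {N : ℕ}

lemma eval_homogeneousComponent_eq_zero {σ : Type} {f : MvPolynomial σ k} {v : σ → k}
    (h : ∀ c : k, c ≠ 0 → eval (c • v) f = 0) (i : ℕ) :
    eval v (homogeneousComponent i f) = 0 := by
  rw [← linePoly_zero_coeff]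
  have : linePoly f 0 v * Polynomial.X = 0 := Polynomial.funext fun c => by
    rw [Polynomial.eval_mul, eval_linePoly, zero_add, Polynomial.eval_X, Polynomial.eval_zero]
    rcases eq_or_ne c 0 with rfl | hc
    · rw [mul_zero]
    · rw [h c hc, zero_mul]
  rw [(mul_eq_zero.1 this).resolve_right Polynomial.X_ne_zero, Polynomial.coeff_zero]

lemma exists_homogeneous_of_not_surjective {σ : Type} [Fintype σ] (B : Set (σ → k))
    (p : Fin N → MvPolynomial σ k)
    (hB : ∀ c : k, c ≠ 0 → ∀ z ∈ B, ∃ z' ∈ B, ∀ j, eval z' (p j) = c * eval z (p j))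
    (hno : ∀ z ∈ B, ∃ w : Fin N → k, ∀ u : σ → k,
      (∀ f ∈ vanishingIdeal k B, dirDeriv z u f = 0) → ∃ j, dirDeriv z u (p j) ≠ w j) :
    ∃ d G, IsHomogeneous G d ∧ G ≠ 0 ∧ ∀ z ∈ B, eval (fun j => eval z (p j)) G = 0 := by
  have h : ¬ ∀ G : MvPolynomial (Fin N) k,
      (∀ z ∈ B, eval (fun j => eval z (p j)) G = 0) → G = 0 := by
    intro hdom
    obtain ⟨z, hz, hw⟩ := exists_surjective_differential B p hdom
    obtain ⟨w, h⟩ := hno z hz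
    obtain ⟨u, hu, huw⟩ := hw w
    obtain ⟨j, hj⟩ := h u hu
    exact hj (huw j)
  push Not at h
  obtain ⟨G, hG, hG0⟩ := h
  obtain ⟨i, hi⟩ := exists_homogeneousComponent_ne_zero hG0
  refine ⟨i, _, homogeneousComponent_isHomogeneous i G, hi, fun z hz => ?_⟩
  refine eval_homogeneousComponent_eq_zero (fun c hc => ?_) i
  obtain ⟨z', hz', he⟩ := hB c hc z hz
  rw [← hG z' hz']
  congr 2
  exact (funext he).symm

variable {X : Set (PS k N)}

lemma tanSpace_smul {c : k} (hc : c ≠ 0) (x : Fin N → k) :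
    tanSpace (homogCut X) (c • x) = tanSpace (homogCut X) x := by
  ext u
  rw [mem_tanSpace, mem_tanSpace]
  refine forall₂_congr fun f hf => ?_
  obtain ⟨⟨d, hd⟩, -⟩ := hf
  rw [dirDeriv_smul_left hd, mul_eq_zero, or_iff_right (pow_ne_zero _ hc)]

lemma mem_tanSpace_of_vanishingIdeal {σ : Type} [Fintype σ] {B : Set (σ → k)} (hne : X.Nonempty)
    (q : Fin N → MvPolynomial σ k) (hq : ∀ z ∈ B, (fun j => eval z (q j)) ∈ cone X)
    {z u : σ → k} (hu : ∀ f ∈ vanishingIdeal k B, dirDeriv z u f = 0) :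
    (fun j => dirDeriv z u (q j)) ∈ tanSpace (homogCut X) (fun j => eval z (q j)) := by
  rw [mem_tanSpace]
  intro f hf
  rw [← dirDeriv_aeval]
  refine hu _ ?_
  rw [mem_vanishingIdeal_iff]
  intro z' hz'
  have := eval_eq_zero_of_mem_homogCut hne hf _ (hq z' hz')
  rw [← eval_aeval] at this
  simpa using this

/-- Terracini: the tangent spaces at two points spanning a general point span everything. -/
lemma exists_homogeneous_tanSpace_sup (hne : X.Nonempty) :
    ∃ d G, IsHomogeneous G d ∧ G ≠ 0 ∧ ∀ x ∈ cone X, ∀ y ∈ cone X, eval (x + y) G ≠ 0 →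
      tanSpace (homogCut X) x ⊔ tanSpace (homogCut X) y = ⊤ := by
  obtain ⟨d, G, hG, hG0, h⟩ := exists_homogeneous_of_not_surjective
    (B := {z : Fin N ⊕ Fin N → k | z ∘ Sum.inl ∈ cone X ∧ z ∘ Sum.inr ∈ cone X ∧
      tanSpace (homogCut X) (z ∘ Sum.inl) ⊔ tanSpace (homogCut X) (z ∘ Sum.inr) ≠ ⊤})
    (p := fun j => MvPolynomial.X (Sum.inl j) + MvPolynomial.X (Sum.inr j))
    (fun c hc z hz => ⟨c • z, ⟨isConical_cone X c _ hz.1, isConical_cone X c _ hz.2.1, by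
      have := hz.2.2
      rwa [← tanSpace_smul hc (z ∘ Sum.inl), ← tanSpace_smul hc (z ∘ Sum.inr)] at this⟩,
      fun j => by simp [mul_add]⟩)
    (fun z hz => by
      by_contra! hcon
      refine hz.2.2 (eq_top_iff.2 fun w _ => ?_)
      obtain ⟨u, hu, huw⟩ := hcon w
      have h1 := mem_tanSpace_of_vanishingIdeal hne (fun j => MvPolynomial.X (Sum.inl j))
        (fun z hz => by simp only [eval_X]; exact hz.1) hu
      have h2 := mem_tanSpace_of_vanishingIdeal hne (fun j => MvPolynomial.X (Sum.inr j))
        (fun z hz => by simp only [eval_X]; exact hz.2.1) hu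
      simp only [eval_X, dirDeriv_X] at h1 h2
      have hw : w = (fun j => u (Sum.inl j)) + fun j => u (Sum.inr j) := by
        ext j
        rw [← huw j, dirDeriv_add, dirDeriv_X, dirDeriv_X]
        rfl
      rw [hw]
      exact Submodule.add_mem_sup h1 h2)
  refine ⟨d, G, hG, hG0, fun x hx y hy hxy => ?_⟩
  by_contra hcon
  refine hxy ?_
  have := h (Sum.elim x y) ⟨hx, hy, hcon⟩
  simpa [Pi.add_def] using this

/-- Two points `x`, `y` of the cone over `X` on a trisecant line of a plane `W` that meets
the tangent spaces of `X` at the three points in lines. -/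
structure TrisecantConfig (X : Set (PS k N)) (x y : Fin N → k) (W : Submodule k (Fin N → k)) :
    Prop where
  mem_left : x ∈ cone X
  mem_right : y ∈ cone X
  mem_add : x + y ∈ cone X
  left_ne : x ≠ 0
  right_ne : y ≠ 0
  add_ne : x + y ≠ 0
  sup_eq : tanSpace (homogCut X) x ⊔ tanSpace (homogCut X) y = ⊤
  finrank_le : Module.finrank k W ≤ 3
  right_mem : y ∈ W
  left_tan : 2 ≤ Module.finrank k (W ⊓ tanSpace (homogCut X) x : Submodule k (Fin N → k))
  right_tan : 2 ≤ Module.finrank k (W ⊓ tanSpace (homogCut X) y : Submodule k (Fin N → k))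
  add_tan : 2 ≤ Module.finrank k (W ⊓ tanSpace (homogCut X) (x + y) : Submodule k (Fin N → k))

lemma TrisecantConfig.smul {x y : Fin N → k} {W : Submodule k (Fin N → k)}
    (h : TrisecantConfig X x y W) {c : k} (hc : c ≠ 0) : TrisecantConfig X (c • x) (c • y) W where
  mem_left := isConical_cone X c _ h.mem_left
  mem_right := isConical_cone X c _ h.mem_right
  mem_add := by rw [← smul_add]; exact isConical_cone X c _ h.mem_add
  left_ne := smul_ne_zero hc h.left_ne
  right_ne := smul_ne_zero hc h.right_ne
  add_ne := by rw [← smul_add]; exact smul_ne_zero hc h.add_ne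
  sup_eq := by rw [tanSpace_smul hc, tanSpace_smul hc]; exact h.sup_eq
  finrank_le := h.finrank_le
  right_mem := W.smul_mem c h.right_mem
  left_tan := by rw [tanSpace_smul hc]; exact h.left_tan
  right_tan := by rw [tanSpace_smul hc]; exact h.right_tan
  add_tan := by rw [← smul_add, tanSpace_smul hc]; exact h.add_tan

/-- The trisecant lines of `X` lying suitably in a plane do not fill the ambient space. -/
lemma exists_homogeneous_trisecant {m : ℕ} {X : Set (PS k (2 * m + 1))} (hm : 2 ≤ m)
    (hne : X.Nonempty) (hsm : IsSmoothVar X m) :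
    ∃ d G, IsHomogeneous G d ∧ G ≠ 0 ∧ ∀ x y W, TrisecantConfig X x y W →
      ∀ b : k, eval (x + b • y) G = 0 := by
  let B : Set ((Fin (2 * m + 1) ⊕ Fin (2 * m + 1)) ⊕ Unit → k) :=
    {z | ∃ W, TrisecantConfig X (fun j => z (Sum.inl (Sum.inl j)))
      (fun j => z (Sum.inl (Sum.inr j))) W}
  let p : Fin (2 * m + 1) → MvPolynomial ((Fin (2 * m + 1) ⊕ Fin (2 * m + 1)) ⊕ Unit) k := fun j =>
    MvPolynomial.X (Sum.inl (Sum.inl j)) +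
      MvPolynomial.X (Sum.inr ()) * MvPolynomial.X (Sum.inl (Sum.inr j))
  have hp : ∀ z, (fun j => eval z (p j)) = (fun j => z (Sum.inl (Sum.inl j))) +
      z (Sum.inr ()) • fun j => z (Sum.inl (Sum.inr j)) := fun z => by
    ext j
    simp [p]
  have hdp : ∀ z u, (fun j => dirDeriv z u (p j)) = (fun j => u (Sum.inl (Sum.inl j))) +
      z (Sum.inr ()) • (fun j => u (Sum.inl (Sum.inr j))) +
      u (Sum.inr ()) • fun j => z (Sum.inl (Sum.inr j)) := fun z u => by
    ext j
    simp only [p, dirDeriv_add, dirDeriv_mul, dirDeriv_X, eval_X, Pi.add_apply, Pi.smul_apply,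
      smul_eq_mul]
    ring
  have hBs : ∀ c : k, c ≠ 0 → ∀ z ∈ B, ∃ z' ∈ B, ∀ j, eval z' (p j) = c * eval z (p j) := by
    rintro c hc z ⟨W, hW⟩
    refine ⟨Sum.elim (fun i => c * z (Sum.inl i)) (fun i => z (Sum.inr i)), ⟨W, hW.smul hc⟩,
      fun j => ?_⟩
    simp only [p, map_add, map_mul, eval_X, Sum.elim_inl, Sum.elim_inr]
    ring
  have hno : ∀ z ∈ B, ∃ w : Fin (2 * m + 1) → k, ∀ u,
      (∀ f ∈ vanishingIdeal k B, dirDeriv z u f = 0) → ∃ j, dirDeriv z u (p j) ≠ w j := by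
    rintro z ⟨W, h⟩
    obtain ⟨w, hw⟩ := map_ne_top_of_trisecant hm (Module.finrank_fin_fun k)
      (finrank_tanSpace_le hsm (by omega) h.mem_left h.left_ne)
      (finrank_tanSpace_le hsm (by omega) h.mem_right h.right_ne)
      (finrank_tanSpace_le hsm (by omega) h.mem_add h.add_ne) h.sup_eq h.finrank_le h.left_tan
      h.right_tan h.add_tan (z (Sum.inr ())) h.right_mem
    refine ⟨w, fun u hu => ?_⟩
    have t1 := mem_tanSpace_of_vanishingIdeal hne (fun j => MvPolynomial.X (Sum.inl (Sum.inl j)))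
      (fun z hz => by simp only [eval_X]; obtain ⟨W, hz⟩ := hz; exact hz.mem_left) hu
    have t2 := mem_tanSpace_of_vanishingIdeal hne (fun j => MvPolynomial.X (Sum.inl (Sum.inr j)))
      (fun z hz => by simp only [eval_X]; obtain ⟨W, hz⟩ := hz; exact hz.mem_right) hu
    have t3 := mem_tanSpace_of_vanishingIdeal hne
      (fun j => MvPolynomial.X (Sum.inl (Sum.inl j)) + MvPolynomial.X (Sum.inl (Sum.inr j)))
      (fun z hz => by simp only [eval_X, map_add]; obtain ⟨W, hz⟩ := hz; exact hz.mem_add) hu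
    simp only [eval_X, dirDeriv_X, map_add, dirDeriv_add] at t1 t2 t3
    by_contra! hcon
    refine hw _ t1 _ t2 t3 (u (Sum.inr ())) ?_
    rw [← hdp]
    exact (funext hcon).symm
  obtain ⟨d, G, hG, hG0, h⟩ := exists_homogeneous_of_not_surjective B p hBs hno
  refine ⟨d, G, hG, hG0, fun x y W hW b => ?_⟩
  have := h (Sum.elim (Sum.elim x y) fun _ => b) ⟨W, hW⟩
  rwa [hp] at this

end Sard

end EL

namespace EL

section Product

variable {k σ τ : Type} [Field k]

lemma vanishingIdeal_univ_isPrime [Infinite k] :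
    (vanishingIdeal k (Set.univ : Set (σ → k))).IsPrime := by
  have : vanishingIdeal k (Set.univ : Set (σ → k)) = ⊥ := by
    rw [eq_bot_iff]
    intro f hf
    rw [mem_vanishingIdeal_iff] at hf
    exact MvPolynomial.funext fun v => by simpa using hf v trivial
  rw [this]
  exact Ideal.isPrime_bot

lemma vanishingIdeal_prod_isPrime {A : Set (σ → k)} {B : Set (τ → k)}
    (hA : (vanishingIdeal k A).IsPrime) (hB : (vanishingIdeal k B).IsPrime) :
    (vanishingIdeal k {z : σ ⊕ τ → k | z ∘ Sum.inl ∈ A ∧ z ∘ Sum.inr ∈ B}).IsPrime := by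
  have hneA : A.Nonempty := by
    by_contra h
    rw [Set.not_nonempty_iff_eq_empty] at h
    exact hA.ne_top (by rw [h, vanishingIdeal_empty])
  have hneB : B.Nonempty := by
    by_contra h
    rw [Set.not_nonempty_iff_eq_empty] at h
    exact hB.ne_top (by rw [h, vanishingIdeal_empty])
  let fixL (a : σ → k) (f : MvPolynomial (σ ⊕ τ) k) : MvPolynomial τ k :=
    aeval (Sum.elim (fun i => C (a i)) X) f
  let fixR (b : τ → k) (f : MvPolynomial (σ ⊕ τ) k) : MvPolynomial σ k :=
    aeval (Sum.elim X (fun i => C (b i))) f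
  have hL : ∀ a b f, eval b (fixL a f) = eval (Sum.elim a b) f := fun a b f => by
    rw [eval_aeval]
    congr 2
    ext (i | i) <;> simp
  have hR : ∀ a b f, eval a (fixR b f) = eval (Sum.elim a b) f := fun a b f => by
    rw [eval_aeval]
    congr 2
    ext (i | i) <;> simp
  have hmem : ∀ f : MvPolynomial (σ ⊕ τ) k,
      f ∈ vanishingIdeal k {z : σ ⊕ τ → k | z ∘ Sum.inl ∈ A ∧ z ∘ Sum.inr ∈ B} ↔
        ∀ a ∈ A, ∀ b ∈ B, eval (Sum.elim a b) f = 0 := by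
    intro f
    simp only [mem_vanishingIdeal_iff, coe_aeval_eq_eval]
    refine ⟨fun h a ha b hb => h _ ⟨ha, hb⟩, fun h z hz => ?_⟩
    have := h _ hz.1 _ hz.2
    rwa [Sum.elim_comp_inl_inr] at this
  refine ⟨?_, fun {f g} hfg => ?_⟩
  · rw [Ne, Ideal.eq_top_iff_one, hmem]
    obtain ⟨a, ha⟩ := hneA
    obtain ⟨b, hb⟩ := hneB
    intro h
    simpa using h a ha b hb
  · by_contra! hcon
    rw [hmem, hmem] at hcon
    rw [hmem] at hfg
    obtain ⟨h1, h2⟩ := hcon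
    push Not at h1 h2
    obtain ⟨a, ha, b, hb, hf⟩ := h1
    obtain ⟨a', ha', b', hb', hg⟩ := h2
    have h3 : fixR b f * fixR b' g ∉ vanishingIdeal k A := by
      intro h
      rcases hA.mem_or_mem h with h | h
      · rw [mem_vanishingIdeal_iff] at h
        exact hf (by rw [← hR]; simpa using h a ha)
      · rw [mem_vanishingIdeal_iff] at h
        exact hg (by rw [← hR]; simpa using h a' ha')
    rw [mem_vanishingIdeal_iff] at h3
    push Not at h3
    obtain ⟨c, hc, h3⟩ := h3
    change eval c _ ≠ 0 at h3
    rw [map_mul, hR, hR] at h3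
    have h4 : fixL c f * fixL c g ∈ vanishingIdeal k B := by
      rw [mem_vanishingIdeal_iff]
      intro y hy
      change eval y _ = 0
      rw [map_mul, hL, hL, ← map_mul]
      exact hfg c hc y hy
    rcases hB.mem_or_mem h4 with h | h
    · rw [mem_vanishingIdeal_iff] at h
      exact left_ne_zero_of_mul h3 (by rw [← hL]; simpa using h b hb)
    · rw [mem_vanishingIdeal_iff] at h
      exact right_ne_zero_of_mul h3 (by rw [← hL]; simpa using h b' hb')

end Product

section Tangent

variable {k : Type} [Field k] [CharZero k] {N : ℕ}

lemma eval_eq_zero_of_mem_cone_closure {S : Set (PS k N)} (hne : S.Nonempty)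
    {g : MvPolynomial (Fin N) k} (h : ∀ v ∈ cone S, v ≠ 0 → eval v g = 0) :
    ∀ v ∈ cone (closure S), eval v g = 0 := by
  intro v hv
  rw [← sum_homogeneousComponent g, map_sum]
  refine Finset.sum_eq_zero fun i _ => eval_eq_zero_of_mem_homogCut hne.closure
    (f := homogeneousComponent i g) ⟨⟨i, homogeneousComponent_isHomogeneous i g⟩, ?_⟩ v hv
  refine closure_minimal (fun p hp => ?_) (isClosed_V0 (homogeneousComponent_isHomogeneous i g))
  rw [mem_V0_iff_rep (homogeneousComponent_isHomogeneous i g)]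
  exact eval_homogeneousComponent_eq_zero (fun c hc => h _
    (isConical_cone S c _ (rep_mem_cone.2 hp)) (smul_ne_zero hc p.rep_nonzero)) i

lemma dirDeriv_pullback {r : ℕ} (e : (Fin r → k) →ₗ[k] (Fin N → k)) (f : MvPolynomial (Fin N) k)
    (y u : Fin r → k) : dirDeriv y u (pullback e f) = dirDeriv (e y) (e u) f := by
  rw [← linePoly_coeff_one, ← linePoly_coeff_one]
  congr 1
  refine Polynomial.funext fun t => ?_
  rw [eval_linePoly, eval_linePoly, eval_pullback, map_add, map_smul]

variable {r : ℕ} {Γ : Set (PS k N)} {e : (Fin r → k) →ₗ[k] (Fin N → k)}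
  {π : (Fin N → k) →ₗ[k] (Fin r → k)}

/-- If a general vector of the span of `Γ` is a sum of two vectors of the cone over `Γ`, the first
of which may be chosen generally, then a general point of `Γ` and the tangent space at another
general point span everything. -/
lemma exists_tanSpace_span (hirr : IsIrreducible Γ) (he : LinearMap.range e = pspan Γ)
    (hπ : ∀ v, π (e v) = v) {h : MvPolynomial (Fin r) k} (hh : h ≠ 0)
    (hdec : ∀ w, eval w h ≠ 0 → ∃ S, S.Nonempty ∧ closure S = Γ ∧
      ∀ x ∈ cone S, x ≠ 0 → ∃ a : k, ∃ y ∈ cone Γ, e w = a • x + y)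
    {g : MvPolynomial (Fin r) k} (hg : ∃ y ∈ e ⁻¹' cone Γ, eval y g ≠ 0) :
    ∃ x, ∃ y ∈ e ⁻¹' cone Γ, eval y g ≠ 0 ∧ ∀ w, ∃ c : k,
      ∃ u ∈ tanSpace (vanishingIdeal k (e ⁻¹' cone Γ)) y, w = c • x + u := by
  set K := e ⁻¹' cone Γ with hK
  have hKp : (vanishingIdeal k K).IsPrime := comap_isPrime hirr he hπ
  set B : Set ((Fin r ⊕ Fin r) ⊕ Unit → k) := {z | z ∘ Sum.inl ∈
    {z' : Fin r ⊕ Fin r → k | z' ∘ Sum.inl ∈ K ∧ z' ∘ Sum.inr ∈ K} ∧ z ∘ Sum.inr ∈ Set.univ} with hB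
  have hBp : (vanishingIdeal k B).IsPrime :=
    vanishingIdeal_prod_isPrime (vanishingIdeal_prod_isPrime hKp hKp) vanishingIdeal_univ_isPrime
  let p : Fin r → MvPolynomial ((Fin r ⊕ Fin r) ⊕ Unit) k := fun j =>
    X (Sum.inr ()) * X (Sum.inl (Sum.inl j)) + X (Sum.inl (Sum.inr j))
  let s : Fin r → MvPolynomial ((Fin r ⊕ Fin r) ⊕ Unit) k := fun j => X (Sum.inl (Sum.inl j))
  have hdom : ∀ G : MvPolynomial (Fin r ⊕ Fin r) k,
      (∀ z ∈ B, eval (Sum.elim (fun j => eval z (p j)) (fun i => eval z (s i))) G = 0) →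
      ∀ z ∈ B, ∀ w : Fin r → k, eval (Sum.elim w (fun i => eval z (s i))) G = 0 := by
    intro G hG z hz w
    have hx : (fun i => eval z (s i)) ∈ K := by
      simp only [s, eval_X]
      exact hz.1.1
    set x : Fin r → k := fun i => eval z (s i) with hxdef
    have hG' : ∀ x ∈ K, ∀ y ∈ K, ∀ a : k, eval (Sum.elim (a • x + y) x) G = 0 := by
      intro x hx y hy a
      rw [← hG (Sum.elim (Sum.elim x y) fun _ => a) ⟨⟨hx, hy⟩, trivial⟩]
      congr 2
      ext (i | i) <;> simp [p, s]
    have hev : ∀ w, eval w (aeval (Sum.elim X fun i => C (x i)) G : MvPolynomial (Fin r) k) =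
        eval (Sum.elim w x) G := fun w => by
      rw [eval_aeval]
      congr 2
      ext (i | i) <;> simp
    have hzero : (aeval (Sum.elim X fun i => C (x i)) G : MvPolynomial (Fin r) k) * h = 0 := by
      refine MvPolynomial.funext fun w => ?_
      rw [map_mul, map_zero, hev]
      by_cases hw : eval w h = 0
      · rw [hw, mul_zero]
      obtain ⟨S, hSne, hSΓ, hS⟩ := hdec w hw
      have hev' : ∀ x, eval x (aeval (Sum.elim (fun i => C (w i)) X) G : MvPolynomial (Fin r) k) =
          eval (Sum.elim w x) G := fun x => by
        rw [eval_aeval]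
        congr 2
        ext (i | i) <;> simp
      have := eval_eq_zero_of_mem_cone_closure hSne
        (g := pullback π (aeval (Sum.elim (fun i => C (w i)) X) G)) (fun v hv hv0 => by
          rw [eval_pullback, hev']
          obtain ⟨a, y, hy, hwy⟩ := hS v hv hv0
          have hvΓ : v ∈ cone Γ := cone_mono (hSΓ ▸ subset_closure) hv
          have hev := exists_param_eq he hπ (mem_pspan_of_mem_cone hvΓ)
          have hey := exists_param_eq he hπ (mem_pspan_of_mem_cone hy)
          have hw' : w = a • π v + π y := by
            rw [← hπ w, hwy, map_add, map_smul]
          have := hG' (π v) (by rwa [hK, Set.mem_preimage, hev]) (π y)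
            (by rwa [hK, Set.mem_preimage, hey]) a
          rwa [← hw'] at this) (e x) (by rw [hSΓ]; exact hx)
      rw [eval_pullback, hev', hπ] at this
      rw [this, zero_mul]
    have := (mul_eq_zero.1 hzero).resolve_right hh
    rw [← hev, this, map_zero]
  obtain ⟨z, hz, hgz, hsurj⟩ := exists_surjective_differential_relative B hBp p s hdom
    (aeval (fun j => X (Sum.inl (Sum.inr j))) g) (by
      obtain ⟨y, hy, hgy⟩ := hg
      refine ⟨Sum.elim (Sum.elim y y) fun _ => 0, ⟨⟨hy, hy⟩, trivial⟩, ?_⟩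
      rw [eval_aeval]
      simpa using hgy)
  refine ⟨fun j => z (Sum.inl (Sum.inl j)), fun j => z (Sum.inl (Sum.inr j)), hz.1.2, ?_,
    fun w => ?_⟩
  · rw [eval_aeval] at hgz
    simpa using hgz
  · obtain ⟨u, hu, hus, huw⟩ := hsurj w
    refine ⟨u (Sum.inr ()), fun j => u (Sum.inl (Sum.inr j)), ?_, ?_⟩
    · rw [mem_tanSpace]
      intro f hf
      have := hu (aeval (fun j => X (Sum.inl (Sum.inr j))) f) (by
        rw [mem_vanishingIdeal_iff]
        rw [SetLike.mem_coe, mem_vanishingIdeal_iff] at hf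
        intro z' hz'
        have := hf _ hz'.1.2
        change eval _ f = 0 at this
        change eval z' _ = 0
        rw [eval_aeval]
        simp only [eval_X]
        exact this)
      rw [dirDeriv_aeval] at this
      simpa only [eval_X, dirDeriv_X] using this
    · ext j
      have h1 := hus j
      simp only [s, dirDeriv_X] at h1
      rw [← huw j]
      simp only [p, dirDeriv_add, dirDeriv_mul, dirDeriv_X, eval_X, Pi.add_apply, Pi.smul_apply,
        smul_eq_mul, h1]
      ring

/-- Under the hypotheses of `exists_tanSpace_span`, every tangent space of the cone over `Γ` has
codimension at most one in the span of `Γ`. -/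
lemma le_finrank_tanSpace (hirr : IsIrreducible Γ) (he : LinearMap.range e = pspan Γ)
    (hπ : ∀ v, π (e v) = v) {h : MvPolynomial (Fin r) k} (hh : h ≠ 0)
    (hdec : ∀ w, eval w h ≠ 0 → ∃ S, S.Nonempty ∧ closure S = Γ ∧
      ∀ x ∈ cone S, x ≠ 0 → ∃ a : k, ∃ y ∈ cone Γ, e w = a • x + y)
    {y : Fin r → k} (hy : y ∈ e ⁻¹' cone Γ) :
    r ≤ Module.finrank k (tanSpace (vanishingIdeal k (e ⁻¹' cone Γ)) y) + 1 := by
  set K := e ⁻¹' cone Γ with hK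
  have minor : ∀ f ∈ vanishingIdeal k K, ∀ g ∈ vanishingIdeal k K, ∀ w w' : Fin r → k,
      dirDeriv y w f * dirDeriv y w' g = dirDeriv y w' f * dirDeriv y w g := by
    intro f hf g hg w w'
    by_contra hcon
    obtain ⟨x, z, -, hM, hw⟩ := exists_tanSpace_span hirr he hπ hh hdec
      (g := dirPoly w f * dirPoly w' g - dirPoly w' f * dirPoly w g) ⟨y, hy, by
        simp only [map_sub, map_mul, eval_dirPoly]
        exact sub_ne_zero.2 hcon⟩
    apply hM
    obtain ⟨c, u, hu, rfl⟩ := hw w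
    obtain ⟨c', u', hu', rfl⟩ := hw w'
    rw [mem_tanSpace] at hu hu'
    simp only [map_sub, map_mul, eval_dirPoly, dirDeriv_add_right, dirDeriv_smul_right, hu f hf,
      hu g hg, hu' f hf, hu' g hg]
    ring
  obtain ⟨φ, hφ⟩ : ∃ φ : (Fin r → k) →ₗ[k] k,
      LinearMap.ker φ ≤ tanSpace (vanishingIdeal k K) y := by
    by_cases hall : ∀ f ∈ vanishingIdeal k K, ∀ w, dirDeriv y w f = 0
    · exact ⟨0, fun w _ => mem_tanSpace.2 fun f hf => hall f hf w⟩
    push Not at hall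
    obtain ⟨f, hf, w', hw'⟩ := hall
    refine ⟨dirDerivHom y f, fun w hw => mem_tanSpace.2 fun g hg => ?_⟩
    have h0 : dirDeriv y w f = 0 := hw
    have := minor f hf g hg w w'
    rw [h0, zero_mul] at this
    exact (mul_eq_zero.1 this.symm).resolve_left hw'
  have h1 := LinearMap.finrank_range_add_finrank_ker φ
  have h2 := Submodule.finrank_le (LinearMap.range φ)
  have h3 := Submodule.finrank_mono hφ
  rw [Module.finrank_fin_fun] at h1
  rw [Module.finrank_self] at h2
  omega

lemma le_finrank_pspan_inf_tanSpace {X : Set (PS k N)} (hX : X.Nonempty) (hΓX : Γ ⊆ X)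
    (hirr : IsIrreducible Γ)
    (he : LinearMap.range e = pspan Γ) (hπ : ∀ v, π (e v) = v) {h : MvPolynomial (Fin r) k}
    (hh : h ≠ 0)
    (hdec : ∀ w, eval w h ≠ 0 → ∃ S, S.Nonempty ∧ closure S = Γ ∧
      ∀ x ∈ cone S, x ≠ 0 → ∃ a : k, ∃ y ∈ cone Γ, e w = a • x + y)
    {x : Fin N → k} (hx : x ∈ cone Γ) :
    r ≤ Module.finrank k (pspan Γ ⊓ tanSpace (homogCut X) x : Submodule k (Fin N → k)) + 1 := by
  have hex := exists_param_eq he hπ (mem_pspan_of_mem_cone hx)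
  have hy : π x ∈ e ⁻¹' cone Γ := by rwa [Set.mem_preimage, hex]
  refine (le_finrank_tanSpace hirr he hπ hh hdec hy).trans ?_
  have hle : (tanSpace (vanishingIdeal k (e ⁻¹' cone Γ)) (π x)).map e ≤
      pspan Γ ⊓ tanSpace (homogCut X) x := by
    rintro _ ⟨u, hu, rfl⟩
    refine ⟨he ▸ ⟨u, rfl⟩, mem_tanSpace.2 fun f hf => ?_⟩
    rw [SetLike.mem_coe, mem_tanSpace] at hu
    rw [← hex, ← dirDeriv_pullback]
    refine hu _ ?_
    rw [SetLike.mem_coe, mem_vanishingIdeal_iff]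
    intro v hv
    change eval v _ = 0
    rw [eval_pullback]
    exact eval_eq_zero_of_mem_homogCut hX hf _ (cone_mono hΓX hv)
  have := Submodule.finrank_mono hle
  rw [← (Submodule.equivMapOfInjective e (Function.LeftInverse.injective hπ) _).finrank_eq] at this
  omega

end Tangent

end EL

namespace EL

section General

variable {k : Type} [Field k] {N : ℕ}

lemma isClosed_singleton (p : PS k N) : IsClosed ({p} : Set (PS k N)) := by
  have : ({p} : Set (PS k N)) = linSet p.submodule := by
    ext x
    rw [Set.mem_singleton_iff, linSet, Set.mem_ofPred_eq]
    exact ⟨fun h => h ▸ le_rfl, eq_of_submodule_le⟩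
  rw [this]
  exact isClosed_linSet _

lemma subsingleton_of_isIrreducible_of_finite {S : Set (PS k N)} (hS : IsIrreducible S)
    (hfin : S.Finite) : S.Subsingleton := by
  obtain ⟨Z, hZ, hSZ⟩ := isIrreducible_iff_sUnion_isClosed.1 hS
    (hfin.toFinset.image fun p => ({p} : Set (PS k N))) (fun Z hZ => by
      obtain ⟨p, -, rfl⟩ := Finset.mem_image.1 hZ
      exact isClosed_singleton p) (fun p hp => by
      simpa using hp)
  obtain ⟨p, -, rfl⟩ := Finset.mem_image.1 hZ
  exact Set.subsingleton_singleton.anti hSZ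

lemma three_le_finrank_pspan [CharZero k] {S : Set (PS k N)} (hS : IsClosed S)
    (hirr : IsIrreducible S) {q x y : Fin N → k} (hq : q ∉ cone S) (hx : x ∈ cone S)
    (hy : y ∈ cone S) (hxy : q = x + y) : 3 ≤ Module.finrank k (pspan S) := by
  classical
  by_contra! hlt
  have hx0 : x ≠ 0 := by
    rintro rfl
    exact hq (by rwa [hxy, zero_add])
  have hy0 : y ≠ 0 := by
    rintro rfl
    exact hq (by rwa [hxy, add_zero])
  have hqx : ∀ c : k, c • x ≠ q := fun c h => hq (h ▸ isConical_cone S c x hx)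
  have hli : LinearIndependent k ![x, q] := by
    rw [LinearIndependent.pair_iff' hx0]
    exact hqx
  have hle : Submodule.span k {x, q} ≤ pspan S := by
    rw [Submodule.span_le, Set.pair_subset_iff]
    refine ⟨mem_pspan_of_mem_cone hx, ?_⟩
    rw [hxy]
    exact add_mem (mem_pspan_of_mem_cone hx) (mem_pspan_of_mem_cone hy)
  have hfr : Module.finrank k (Submodule.span k {x, q}) = 2 := by
    have := finrank_span_eq_card hli
    rwa [Matrix.range_cons_cons_empty, Fintype.card_fin] at this
  have heq : Submodule.span k {x, q} = pspan S :=
    Submodule.eq_of_le_of_finrank_le hle (by omega)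
  obtain ⟨F, hF, hFq⟩ : ∃ F ∈ homogCut S, eval q F ≠ 0 := by
    by_contra! h
    exact hq (mem_cone_of_homogCut hS h)
  obtain ⟨d, hd⟩ := hF.1
  have hFS := eval_eq_zero_of_mem_homogCut hirr.nonempty hF
  have hL0 : linePoly F x q ≠ 0 := fun h0 => by
    have := linePoly_coeff_top hd x q
    rw [h0, Polynomial.coeff_zero] at this
    exact hFq this.symm
  have hne : ∀ t : k, x + t • q ≠ 0 := fun t h => by
    have := LinearIndependent.pair_iff.1 hli 1 t (by rwa [one_smul])
    exact one_ne_zero this.1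
  have hfin : S.Finite := by
    refine ((linePoly F x q).roots.toFinset.finite_toSet.image
      fun t => Projectivization.mk k _ (hne t)).subset fun p hp => ?_
    have hpW := mem_pspan hp
    rw [← heq, Submodule.mem_span_pair] at hpW
    obtain ⟨a, b, hab⟩ := hpW
    have hpS := rep_mem_cone.2 hp
    have ha : a ≠ 0 := by
      rintro rfl
      rw [zero_smul, zero_add] at hab
      have hb : b ≠ 0 := by
        rintro rfl
        exact p.rep_nonzero (by rw [← hab, zero_smul])
      apply hq
      have := isConical_cone S b⁻¹ _ hpS
      rwa [← hab, smul_smul, inv_mul_cancel₀ hb, one_smul] at this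
    have hsm : a⁻¹ • p.rep = x + (a⁻¹ * b) • q := by
      rw [← hab, smul_add, smul_smul, smul_smul, inv_mul_cancel₀ ha, one_smul]
    refine ⟨a⁻¹ * b, ?_, ?_⟩
    · rw [Finset.mem_coe, Multiset.mem_toFinset, Polynomial.mem_roots hL0, Polynomial.IsRoot,
        eval_linePoly, ← hsm]
      exact hFS _ (isConical_cone S _ _ hpS)
    · conv_rhs => rw [← p.mk_rep]
      rw [Projectivization.mk_eq_mk_iff']
      exact ⟨a⁻¹, hsm⟩
  have := subsingleton_of_isIrreducible_of_finite hirr hfin (hx hx0) (hy hy0)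
  rw [Projectivization.mk_eq_mk_iff'] at this
  obtain ⟨c, hc⟩ := this
  refine hqx (c⁻¹ + 1) ?_
  have hc0 : c ≠ 0 := by
    rintro rfl
    exact hx0 (by rw [← hc, zero_smul])
  rw [hxy, add_smul, one_smul, ← hc, smul_smul, inv_mul_cancel₀ hc0, one_smul, add_comm]

end General

section TypeA

variable {k : Type} [Field k] [IsAlgClosed k] [CharZero k] {N : ℕ} {X : Set (PS k N)}

lemma exists_polynomial_of_genericIn (hX : IsClosed X) {d : ℕ} {G : MvPolynomial (Fin N) k}
    (hGh : G.IsHomogeneous d)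
    (hG : ∀ v, eval v G ≠ 0 → ∃ x ∈ cone X, ∃ y ∈ cone X, v = x + y) {q : PS k N}
    (hqG : q ∉ V0 G) (hqX : q ∉ X) (hqW : q.rep ∈ pspan (entryLocus X q))
    (hA : GenericIn (linSet (pspan (entryLocus X q))) fun o => entryLocus X o = entryLocus X q)
    {r : ℕ} {e : (Fin r → k) →ₗ[k] (Fin N → k)} {π : (Fin N → k) →ₗ[k] (Fin r → k)}
    (he : LinearMap.range e = pspan (entryLocus X q)) (hπ : ∀ v, π (e v) = v) :
    ∃ h : MvPolynomial (Fin r) k, h ≠ 0 ∧ ∀ w, eval w h ≠ 0 → ∃ S, S.Nonempty ∧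
      closure S = entryLocus X q ∧ ∀ x ∈ cone S, x ≠ 0 →
        ∃ a : k, ∃ y ∈ cone (entryLocus X q), e w = a • x + y := by
  obtain ⟨U, hU, hcl, hUA⟩ := hA
  have hO : IsOpen ((V0 G)ᶜ ∩ Xᶜ) := (isOpen_compl_V0 hGh).inter hX.isOpen_compl
  obtain ⟨o, hoO, hoW, hoU⟩ := mem_closure_iff.1 (hcl (submodule_le_iff_rep.2 hqW)) _ hO ⟨hqG, hqX⟩
  obtain ⟨d', f, hf, hof, hfU⟩ := exists_basic_of_mem_isOpen (hU.inter hO) ⟨hoU, hoO⟩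
  have hoW' : o.rep ∈ pspan (entryLocus X q) := submodule_le_iff_rep.1 hoW
  have heo := exists_param_eq he hπ hoW'
  obtain ⟨i, hi⟩ : ∃ i, π o.rep i ≠ 0 := by
    by_contra! h
    apply o.rep_nonzero
    rw [← heo, show π o.rep = 0 from funext h, map_zero]
  refine ⟨pullback e f * MvPolynomial.X i, fun h0 => ?_, fun w hw => ?_⟩
  · have : eval (π o.rep) (pullback e f * MvPolynomial.X i) ≠ 0 := by
      rw [map_mul, eval_pullback, heo, eval_X]
      exact mul_ne_zero (fun h => hof ((mem_V0_iff_rep hf).2 h)) hi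
    rw [h0, map_zero] at this
    exact this rfl
  · rw [map_mul, eval_pullback, eval_X] at hw
    have hv0 : e w ≠ 0 := fun h => by
      have : w = 0 := by rw [← hπ w, h, map_zero]
      rw [this] at hw
      exact right_ne_zero_of_mul hw rfl
    obtain ⟨hoU', hoG', hoX'⟩ := @hfU (Projectivization.mk k (e w) hv0)
      (fun h => left_ne_zero_of_mul hw ((mk_mem_V0 hf hv0).1 h))
    have hvX : e w ∉ cone X := fun h => hoX' (h hv0)
    have hΓ := hUA _ ⟨(mk_mem_linSet hv0).2 (he ▸ ⟨w, rfl⟩), hoU'⟩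
    obtain ⟨x, hx, y, hy, hxy⟩ := hG (e w) fun h => hoG' ((mk_mem_V0 hGh hv0).2 h)
    have hrk := rk_eq_two_of_add hvX hv0 hx hy hxy
    have hx0 : x ≠ 0 := by
      rintro rfl
      exact hvX (by rwa [hxy, zero_add])
    refine ⟨entrySet X (Projectivization.mk k (e w) hv0),
      ⟨_, mem_entrySet_of_add hvX hv0 hx hy hxy hx0⟩, hΓ, fun z hz hz0 => ?_⟩
    obtain ⟨a, -, -, -, ha⟩ := exists_of_mem_entrySet hvX hv0 hz0 hrk (hz hz0)
    refine ⟨a, e w - a • z, fun h => ?_, by abel⟩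
    rw [← hΓ]
    exact entrySet_subset_entryLocus (ha h)

end TypeA

section Conic

variable {k : Type} [Field k] [IsAlgClosed k] [CharZero k] {n : ℕ} {X Γ : Set (PS k (2 * n + 1))}

lemma finrank_pspan_le_three (hsm : IsSmoothVar X n) (hn : n + 1 ≤ 2 * n + 1)
    (hΓX : Γ ⊆ X) (hT : ∀ x ∈ cone Γ, Module.finrank k (pspan Γ) ≤
      Module.finrank k (pspan Γ ⊓ tanSpace (homogCut X) x : Submodule k _) + 1)
    {x y : Fin (2 * n + 1) → k} (hx : x ∈ cone Γ) (hy : y ∈ cone Γ) (hx0 : x ≠ 0) (hy0 : y ≠ 0)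
    (hsup : tanSpace (homogCut X) x ⊔ tanSpace (homogCut X) y = ⊤) :
    Module.finrank k (pspan Γ) ≤ 3 := by
  have h2 := finrank_tanSpace_le hsm hn (cone_mono hΓX hx) hx0
  have h3 := finrank_tanSpace_le hsm hn (cone_mono hΓX hy) hy0
  have h7 := hT x hx
  have h8 := hT y hy
  set W := pspan Γ
  set A := tanSpace (homogCut X) x
  set B := tanSpace (homogCut X) y
  have h1 := Submodule.finrank_sup_add_finrank_inf_eq A B
  rw [hsup, finrank_top, Module.finrank_fin_fun] at h1
  have h4 := Submodule.finrank_sup_add_finrank_inf_eq (W ⊓ A) (W ⊓ B)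
  have h5 : Module.finrank k ((W ⊓ A) ⊔ (W ⊓ B) : Submodule k _) ≤ Module.finrank k W :=
    Submodule.finrank_mono (sup_le inf_le_left inf_le_left)
  have h6 : Module.finrank k ((W ⊓ A) ⊓ (W ⊓ B) : Submodule k _) ≤
      Module.finrank k (A ⊓ B : Submodule k _) :=
    Submodule.finrank_mono (inf_le_inf inf_le_right inf_le_right)
  omega

lemma eq_of_trisecant (hΓX : Γ ⊆ X) (hW : Module.finrank k (pspan Γ) = 3)
    (hT : ∀ x ∈ cone Γ, 3 ≤
      Module.finrank k (pspan Γ ⊓ tanSpace (homogCut X) x : Submodule k _) + 1)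
    {q : Fin (2 * n + 1) → k} (hq : q ∉ cone X)
    (hsup : ∀ x ∈ cone X, ∀ y ∈ cone X, x + y = q →
      tanSpace (homogCut X) x ⊔ tanSpace (homogCut X) y = ⊤)
    (htri : ∀ x y W, TrisecantConfig X x y W → ∀ b c : k, c ≠ 0 → x + b • y ≠ c • q)
    {x : Fin (2 * n + 1) → k} (hx : x ∈ cone Γ) (hx0 : x ≠ 0) {t₁ t₂ : k} (ht₁ : t₁ ≠ 0)
    (ht₂ : t₂ ≠ 0) (h₁ : x + t₁ • q ∈ cone Γ) (h₂ : x + t₂ • q ∈ cone Γ) : t₁ = t₂ := by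
  by_contra hne
  have hxX := cone_mono hΓX hx
  have hne0 : ∀ t : k, t ≠ 0 → x + t • q ≠ 0 := fun t ht h => by
    apply hq
    have := isConical_cone X (-t⁻¹) x hxX
    rwa [eq_neg_of_add_eq_zero_left h, neg_smul_neg, smul_smul, inv_mul_cancel₀ ht, one_smul]
      at this
  set s := t₂ / t₁ with hs
  have hs0 : s ≠ 0 := div_ne_zero ht₂ ht₁
  have hs1 : 1 - s ≠ 0 := fun h => hne (by
    rw [sub_eq_zero, hs, eq_div_iff ht₁, one_mul] at h
    exact h)
  have hst : s * t₁ = t₂ := div_mul_cancel₀ _ ht₁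
  have hsum : (1 - s) • x + s • (x + t₁ • q) = x + t₂ • q := by
    rw [smul_add, smul_smul, hst]
    module
  have hcl : (1 - s) • x ∈ cone Γ := isConical_cone Γ _ _ hx
  have hcr : s • (x + t₁ • q) ∈ cone Γ := isConical_cone Γ _ _ h₁
  have htan : ∀ y ∈ cone Γ,
      2 ≤ Module.finrank k (pspan Γ ⊓ tanSpace (homogCut X) y : Submodule k _) := fun y hy => by
    have := hT y hy
    omega
  refine htri ((1 - s) • x) (s • (x + t₁ • q)) (pspan Γ) ?_ (-((1 - s) / s)) (-((1 - s) * t₁))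
    (neg_ne_zero.2 (mul_ne_zero hs1 ht₁)) ?_
  · refine
      { mem_left := cone_mono hΓX hcl
        mem_right := cone_mono hΓX hcr
        mem_add := by rw [hsum]; exact cone_mono hΓX h₂
        left_ne := smul_ne_zero hs1 hx0
        right_ne := smul_ne_zero hs0 (hne0 _ ht₁)
        add_ne := by rw [hsum]; exact hne0 _ ht₂
        sup_eq := ?_
        finrank_le := hW.le
        right_mem := mem_pspan_of_mem_cone hcr
        left_tan := htan _ hcl
        right_tan := htan _ hcr
        add_tan := by rw [hsum]; exact htan _ h₂ }
    rw [tanSpace_smul hs1, tanSpace_smul hs0,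
      ← tanSpace_smul (neg_ne_zero.2 (inv_ne_zero ht₁)) x,
      ← tanSpace_smul (inv_ne_zero ht₁) (x + t₁ • q)]
    refine hsup _ (isConical_cone X _ _ hxX) _ (isConical_cone X _ _ (cone_mono hΓX h₁)) ?_
    rw [smul_add, smul_smul, inv_mul_cancel₀ ht₁]
    module
  · rw [smul_smul, neg_mul, div_mul_cancel₀ _ hs0]
    module

end Conic

end EL

namespace EL

section Degree

variable {k : Type} [Field k]

lemma eval_add_eq_zero_of_quadric [Infinite k] {m : ℕ} {F : MvPolynomial (Fin m) k}
    (hF : F.IsHomogeneous 2) {a b : Fin m → k} (ha : eval a F = 0) (hb : eval b F = 0) {s t : k}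
    (hs : s ≠ 0) (ht : t ≠ 0) (hab : eval (s • a + t • b) F = 0) (u v : k) :
    eval (u • a + v • b) F = 0 := by
  have hev : ∀ τ : k, eval (a + τ • b) F = (linePoly F a b).coeff 1 * τ := by
    intro τ
    rw [← eval_linePoly, Polynomial.eval_eq_sum_range' (n := 3)
      (Nat.lt_succ_of_le (natDegree_linePoly_le hF a b))]
    simp [Finset.sum_range_succ, linePoly_coeff_zero, linePoly_coeff_top hF, ha, hb]
  have hsm : ∀ u v : k, u ≠ 0 →
      eval (u • a + v • b) F = u ^ 2 * ((linePoly F a b).coeff 1 * (u⁻¹ * v)) := by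
    intro u v hu
    rw [← hev, ← IsHomogeneous.eval_smul hF, smul_add, smul_smul, mul_inv_cancel_left₀ hu]
  have hc : (linePoly F a b).coeff 1 = 0 := by
    rw [hsm s t hs] at hab
    simpa [hs, ht] using hab
  by_cases hu : u = 0
  · rw [hu, zero_smul, zero_add, IsHomogeneous.eval_smul hF, hb, mul_zero]
  · rw [hsm u v hu, hc, zero_mul, mul_zero]

variable {N : ℕ}

lemma linearIndependent_rep {p q : PS k N} (h : p ≠ q) : LinearIndependent k ![p.rep, q.rep] := by
  rw [LinearIndependent.pair_iff' p.rep_nonzero]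
  intro c hc
  apply h
  rw [← p.mk_rep, ← q.mk_rep, eq_comm, Projectivization.mk_eq_mk_iff']
  exact ⟨c, hc⟩

lemma finrank_span_pair {x y : Fin N → k} (h : LinearIndependent k ![x, y]) :
    Module.finrank k (Submodule.span k {x, y}) = 2 := by
  classical
  have := finrank_span_eq_card h
  rwa [Matrix.range_cons_cons_empty, Fintype.card_fin] at this

lemma exists_inf_eq {P W : Submodule k (Fin N → k)} (hPW : P ≤ W) :
    ∃ H : Submodule k (Fin N → k), H ⊓ W = P ∧
      Module.finrank k H + Module.finrank k W = N + Module.finrank k P := by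
  obtain ⟨C, hC⟩ := exists_isCompl W
  refine ⟨P ⊔ C, ?_, ?_⟩
  · rw [sup_inf_assoc_of_le C hPW, inf_comm, hC.inf_eq_bot, sup_bot_eq]
  · have h1 := Submodule.finrank_sup_add_finrank_inf_eq P C
    have h2 := Submodule.finrank_add_eq_of_isCompl hC
    have h3 : P ⊓ C = ⊥ := eq_bot_iff.2 ((inf_le_inf_right C hPW).trans hC.inf_eq_bot.le)
    rw [h3, finrank_bot] at h1
    rw [Module.finrank_fin_fun] at h2
    omega

variable [IsAlgClosed k] [CharZero k] {Γ : Set (PS k N)} {e : (Fin 3 → k) →ₗ[k] (Fin N → k)}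
  {π : (Fin N → k) →ₗ[k] (Fin 3 → k)} {F : MvPolynomial (Fin 3) k}

/-- A plane conic containing three collinear points contains their line. -/
lemma mem_cone_of_collinear (hF : IsPlaneCurve (e ⁻¹' cone Γ) 2 F)
    (he : LinearMap.range e = pspan Γ) (hπ : ∀ v, π (e v) = v) {x y : Fin N → k}
    (hx : x ∈ cone Γ) (hy : y ∈ cone Γ) {s t : k} (hs : s ≠ 0) (ht : t ≠ 0)
    (hst : s • x + t • y ∈ cone Γ) (u v : k) : u • x + v • y ∈ cone Γ := by
  have hK : ∀ z ∈ pspan Γ, z ∈ cone Γ ↔ eval (π z) F = 0 := fun z hz => by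
    rw [← hF.mem_iff, Set.mem_preimage, exists_param_eq he hπ hz]
  have hxW := mem_pspan_of_mem_cone hx
  have hyW := mem_pspan_of_mem_cone hy
  rw [hK _ (mem_pspan_of_mem_cone hst), map_add, map_smul, map_smul] at hst
  rw [hK _ (add_mem (Submodule.smul_mem _ _ hxW) (Submodule.smul_mem _ _ hyW)), map_add, map_smul,
    map_smul]
  exact eval_add_eq_zero_of_quadric hF.homogeneous ((hK _ hxW).1 hx) ((hK _ hyW).1 hy) hs ht hst u v

lemma ncard_le_two (hirr : IsIrreducible Γ) (hF : IsPlaneCurve (e ⁻¹' cone Γ) 2 F)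
    (he : LinearMap.range e = pspan Γ) (hπ : ∀ v, π (e v) = v)
    (hW : Module.finrank k (pspan Γ) = 3) {H : Submodule k (Fin N → k)}
    (hH : N ≤ Module.finrank k H + 1) (hfin : (Γ ∩ linSet H).Finite) :
    (Γ ∩ linSet H).ncard ≤ 2 := by
  by_contra! hlt
  obtain ⟨a, b, c, ha, hb, hc, hab, hac, hbc⟩ := (Set.two_lt_ncard_iff hfin).1 hlt
  have h1 := Submodule.finrank_sup_add_finrank_inf_eq H (pspan Γ)
  have h2 := Submodule.finrank_le (H ⊔ pspan Γ)
  rw [Module.finrank_fin_fun] at h2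
  by_cases h3 : pspan Γ ≤ H
  · have : Γ ∩ linSet H = Γ := Set.inter_eq_left.2 fun p hp => (subset_linSet_pspan Γ hp).trans h3
    rw [this] at ha hb hfin
    exact hab (subsingleton_of_isIrreducible_of_finite hirr hfin ha hb)
  have h4 : Module.finrank k (H ⊓ pspan Γ : Submodule k (Fin N → k)) < 3 := by
    rw [← hW]
    exact Submodule.finrank_lt_finrank_of_lt (inf_lt_right.2 h3)
  have hmem : ∀ p ∈ Γ ∩ linSet H, p.rep ∈ H ⊓ pspan Γ := fun p hp =>
    ⟨submodule_le_iff_rep.1 hp.2, mem_pspan hp.1⟩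
  have hspan : Submodule.span k {a.rep, b.rep} = H ⊓ pspan Γ := by
    refine Submodule.eq_of_le_of_finrank_le ?_ ?_
    · rw [Submodule.span_le, Set.pair_subset_iff]
      exact ⟨hmem a ha, hmem b hb⟩
    · rw [finrank_span_pair (linearIndependent_rep hab)]
      omega
  have hcs := hmem c hc
  rw [← hspan, Submodule.mem_span_pair] at hcs
  obtain ⟨s, t, hst⟩ := hcs
  have ht : t ≠ 0 := by
    rintro rfl
    rw [zero_smul, add_zero] at hst
    exact LinearIndependent.pair_iff' a.rep_nonzero |>.1 (linearIndependent_rep hac) s hst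
  have hs : s ≠ 0 := by
    rintro rfl
    rw [zero_smul, zero_add] at hst
    exact LinearIndependent.pair_iff' b.rep_nonzero |>.1 (linearIndependent_rep hbc) t hst
  have hsub : linSet (H ⊓ pspan Γ) ⊆ Γ ∩ linSet H := fun p hp => by
    refine ⟨?_, le_trans (b := H ⊓ pspan Γ) hp inf_le_left⟩
    have := submodule_le_iff_rep.1 hp
    rw [← hspan, Submodule.mem_span_pair] at this
    obtain ⟨u, v, huv⟩ := this
    rw [← rep_mem_cone, ← huv]
    exact mem_cone_of_collinear hF he hπ (rep_mem_cone.2 ha.1) (rep_mem_cone.2 hb.1) hs ht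
      (hst ▸ rep_mem_cone.2 hc.1) u v
  have hne : H ⊓ pspan Γ ≠ ⊥ := (Submodule.ne_bot_iff _).2 ⟨a.rep, hmem a ha, a.rep_nonzero⟩
  exact hab (subsingleton_of_isIrreducible_of_finite (isIrreducible_linSet hne) (hfin.subset hsub)
    (submodule_le_iff_rep.2 (hmem a ha)) (submodule_le_iff_rep.2 (hmem b hb)))

lemma exists_ncard_eq_two (hF : IsPlaneCurve (e ⁻¹' cone Γ) 2 F)
    (he : LinearMap.range e = pspan Γ) (hπ : ∀ v, π (e v) = v)
    (hW : Module.finrank k (pspan Γ) = 3) {q : Fin N → k} (hqW : q ∈ pspan Γ)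
    (hqΓ : q ∉ cone Γ) : ∃ H : Submodule k (Fin N → k), Module.finrank k H + 1 = N ∧
      (Γ ∩ linSet H).Finite ∧ (Γ ∩ linSet H).ncard = 2 := by
  have heq := exists_param_eq he hπ hqW
  have hFq : eval (π q) F ≠ 0 := fun h => hqΓ (by
    rwa [← hF.mem_iff, Set.mem_preimage, heq] at h)
  obtain ⟨x, hx, hxq⟩ : ∃ x ∈ e ⁻¹' cone Γ, eval x (dirPoly (π q) F) ≠ 0 := by
    by_contra! h
    exact hF.not_dvd_dirPoly hFq ((hF.vanish_iff _).1 h)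
  obtain ⟨t, ht, hy⟩ := hF.exists_chord hFq hxq
  rw [Set.mem_preimage, map_add, map_smul, heq] at hy
  rw [Set.mem_preimage] at hx
  set x₀ := e x
  set y₀ := x₀ + t • q with hy₀
  have hqxy : q = (-t⁻¹) • x₀ + t⁻¹ • y₀ := by
    rw [hy₀, smul_add, smul_smul, inv_mul_cancel₀ ht]
    module
  have hx0 : x₀ ≠ 0 := fun h => hqΓ (by
    rw [hqxy, h, smul_zero, zero_add]
    exact isConical_cone Γ _ _ hy)
  have hli : LinearIndependent k ![x₀, y₀] := by
    rw [LinearIndependent.pair_iff' hx0]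
    intro c hc
    apply hqΓ
    rw [hqxy, ← hc, smul_smul, ← add_smul]
    exact isConical_cone Γ _ _ hx
  have hy0 : y₀ ≠ 0 := hli.ne_zero 1
  obtain ⟨H, hHW, hH⟩ := exists_inf_eq (P := Submodule.span k {x₀, y₀}) (W := pspan Γ) (by
    rw [Submodule.span_le, Set.pair_subset_iff]
    exact ⟨mem_pspan_of_mem_cone hx, mem_pspan_of_mem_cone hy⟩)
  rw [finrank_span_pair hli, hW] at hH
  have hset : Γ ∩ linSet H = {Projectivization.mk k x₀ hx0, Projectivization.mk k y₀ hy0} := by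
    ext p
    simp only [Set.mem_inter_iff, Set.mem_insert_iff, Set.mem_singleton_iff]
    constructor
    · rintro ⟨hp, hpH⟩
      have : p.rep ∈ H ⊓ pspan Γ := ⟨submodule_le_iff_rep.1 hpH, mem_pspan hp⟩
      rw [hHW, Submodule.mem_span_pair] at this
      obtain ⟨a, b, hab⟩ := this
      rw [← p.mk_rep, Projectivization.mk_eq_mk_iff', Projectivization.mk_eq_mk_iff']
      by_cases hb : b = 0
      · left
        exact ⟨a, by rw [← hab, hb, zero_smul, add_zero]⟩
      by_cases ha : a = 0
      · right
        exact ⟨b, by rw [← hab, ha, zero_smul, zero_add]⟩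
      refine absurd ?_ hqΓ
      rw [hqxy]
      exact mem_cone_of_collinear hF he hπ hx hy ha hb (hab ▸ rep_mem_cone.2 hp) _ _
    · have hsub : ∀ z ∈ Submodule.span k {x₀, y₀}, z ∈ H := fun z hz => by
        rw [← hHW] at hz
        exact hz.1
      rintro (rfl | rfl)
      · exact ⟨hx hx0, (mk_mem_linSet hx0).2 (hsub _ (Submodule.subset_span (by simp)))⟩
      · exact ⟨hy hy0, (mk_mem_linSet hy0).2 (hsub _ (Submodule.subset_span (by simp)))⟩
  refine ⟨H, by omega, ?_, ?_⟩
  · rw [hset]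
    exact Set.toFinite _
  · rw [hset]
    refine Set.ncard_pair fun h => ?_
    rw [eq_comm, Projectivization.mk_eq_mk_iff'] at h
    obtain ⟨c, hc⟩ := h
    exact (LinearIndependent.pair_iff' hx0).1 hli c hc

lemma hasDegree_two (hN : 2 ≤ N) (hirr : IsIrreducible Γ) (hF : IsPlaneCurve (e ⁻¹' cone Γ) 2 F)
    (he : LinearMap.range e = pspan Γ) (hπ : ∀ v, π (e v) = v)
    (hW : Module.finrank k (pspan Γ) = 3) {q : Fin N → k} (hqW : q ∈ pspan Γ)
    (hqΓ : q ∉ cone Γ) : HasDegree Γ 1 2 := by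
  constructor
  · obtain ⟨H, hH, hfin, hcard⟩ := exists_ncard_eq_two hF he hπ hW hqW hqΓ
    exact ⟨linSet H, ⟨H, by omega, rfl⟩, hfin, hcard⟩
  · rintro t ⟨_, ⟨H, hH, rfl⟩, hfin, rfl⟩
    exact ncard_le_two hirr hF he hπ hW (by omega) hfin

end Degree

section TypeIA

variable {k : Type} [Field k] [IsAlgClosed k] [CharZero k] {n : ℕ} {X : Set (PS k (2 * n + 1))}

theorem conic_of_typeI_typeA (hn : 2 ≤ n) (hX : IsClosed X) (hne : X.Nonempty)
    (hsm : IsSmoothVar X n) (hsec : secant X 2 = Set.univ) (hI : TypeI X) (hA : TypeA X) :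
    Generic fun q : PS k (2 * n + 1) => IsIrreducible (entryLocus X q) ∧
      spanDim (entryLocus X q) = 2 ∧ HasDegree (entryLocus X q) 1 2 := by
  obtain ⟨U₁, hU₁, hd₁, h₁⟩ := hI
  obtain ⟨U₂, hU₂, hd₂, h₂⟩ := hA
  obtain ⟨d, G, hGh, hG0, hG⟩ := exists_homogeneous_of_secant (by omega) hX hne hsec
  obtain ⟨d', G', hGh', hG0', hG'⟩ := exists_homogeneous_tanSpace_sup hne
  obtain ⟨d'', G'', hGh'', hG0'', hG''⟩ := exists_homogeneous_trisecant hn hne hsm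
  have hXo := hX.isOpen_compl
  have hV := isOpen_compl_V0 hGh
  have hV' := isOpen_compl_V0 hGh'
  have hV'' := isOpen_compl_V0 hGh''
  have hXd := dense_of_isOpen hXo (exists_notMem_of_smooth (by omega) hsm)
  have hVd := dense_of_isOpen hV (nonempty_compl_V0 (by omega) hGh hG0)
  have hVd' := dense_of_isOpen hV' (nonempty_compl_V0 (by omega) hGh' hG0')
  have hVd'' := dense_of_isOpen hV'' (nonempty_compl_V0 (by omega) hGh'' hG0'')
  refine ⟨((((U₁ ∩ U₂) ∩ Xᶜ) ∩ (V0 G)ᶜ) ∩ (V0 G')ᶜ) ∩ (V0 G'')ᶜ,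
    ((((hU₁.inter hU₂).inter hXo).inter hV).inter hV').inter hV'',
    ((((hd₁.inter_of_isOpen_right hd₂ hU₂).inter_of_isOpen_right hXd hXo).inter_of_isOpen_right
      hVd hV).inter_of_isOpen_right hVd' hV').inter_of_isOpen_right hVd'' hV'', ?_⟩
  rintro q ⟨⟨⟨⟨⟨hq₁, hq₂⟩, hqX⟩, hqG⟩, hqG'⟩, hqG''⟩
  have hirr := h₁ q hq₁
  have hclosed := isClosed_entryLocus (X := X) q
  have hΓX := entryLocus_subset hX (q := q)
  have hqW := mem_pspan_entryLocus hirr.nonempty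
  have hqX' : q.rep ∉ cone X := fun h => hqX (rep_mem_cone.1 h)
  have hqΓ : q.rep ∉ cone (entryLocus X q) := fun h => hqX' (cone_mono hΓX h)
  have hqG₀ : eval q.rep G ≠ 0 := fun h => hqG ((mem_V0_iff_rep hGh).2 h)
  have hqG₀' : eval q.rep G' ≠ 0 := fun h => hqG' ((mem_V0_iff_rep hGh').2 h)
  have hqG₀'' : eval q.rep G'' ≠ 0 := fun h => hqG'' ((mem_V0_iff_rep hGh'').2 h)
  obtain ⟨x, hx, y, hy, hxy⟩ := hG _ hqG₀
  have hx0 : x ≠ 0 := by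
    rintro rfl
    exact hqX' (by rwa [hxy, zero_add])
  have hy0 : y ≠ 0 := by
    rintro rfl
    exact hqX' (by rwa [hxy, add_zero])
  have hΓ : ∀ x ∈ cone X, ∀ y ∈ cone X, q.rep = x + y → x ∈ cone (entryLocus X q) := by
    intro x hx y hy hxy
    have := mem_entrySet_of_add hqX' q.rep_nonzero hx hy hxy
    rw [Projectivization.mk_rep] at this
    exact cone_mono entrySet_subset_entryLocus this
  have hxΓ := hΓ x hx y hy hxy
  have hyΓ := hΓ y hy x hx (hxy.trans (add_comm x y))
  have hsup : ∀ x ∈ cone X, ∀ y ∈ cone X, x + y = q.rep →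
      tanSpace (homogCut X) x ⊔ tanSpace (homogCut X) y = ⊤ := fun x hx y hy h =>
    hG' x hx y hy (by rwa [h])
  obtain ⟨e, π, he, hπ⟩ := exists_param (pspan (entryLocus X q)) rfl
  obtain ⟨h, hh, hdec⟩ := exists_polynomial_of_genericIn hX hGh hG hqG hqX hqW (h₂ q hq₂) he hπ
  have hT : ∀ x ∈ cone (entryLocus X q), Module.finrank k (pspan (entryLocus X q)) ≤
      Module.finrank k (pspan (entryLocus X q) ⊓ tanSpace (homogCut X) x : Submodule k _) + 1 :=
    fun x hx => le_finrank_pspan_inf_tanSpace hne hΓX hirr he hπ hh hdec hx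
  have hW : Module.finrank k (pspan (entryLocus X q)) = 3 :=
    le_antisymm (finrank_pspan_le_three hsm (by omega) hΓX hT hxΓ hyΓ hx0 hy0
      (hsup x hx y hy hxy.symm)) (three_le_finrank_pspan hclosed hirr hqΓ hxΓ hyΓ hxy)
  clear hdec hh h hπ he π e
  obtain ⟨e, π, he, hπ⟩ := exists_param (pspan (entryLocus X q)) hW
  obtain ⟨D, F, hF⟩ := exists_isPlaneCurve hclosed hirr he hπ hqW hqΓ
  have heq := exists_param_eq he hπ hqW
  rw [hW] at hT
  have hD : D = 2 := hF.eq_two (q := π q.rep)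
    (fun h => hqΓ (by rwa [← hF.mem_iff, Set.mem_preimage, heq] at h))
    fun x hx hx0 t₁ t₂ ht₁ ht₂ h₁ h₂ => by
      rw [Set.mem_preimage] at hx
      rw [Set.mem_preimage, map_add, map_smul, heq] at h₁ h₂
      refine eq_of_trisecant hΓX hW hT hqX' hsup (fun x y W hW b c hc h => ?_) hx
        (fun h => hx0 (by rw [← hπ x, h, map_zero])) ht₁ ht₂ h₁ h₂
      have := hG'' x y W hW b
      rw [h, IsHomogeneous.eval_smul hGh''] at this
      exact mul_ne_zero (pow_ne_zero _ hc) hqG₀'' this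
  subst hD
  refine ⟨hirr, by rw [spanDim, hW], hasDegree_two (by omega) hirr hF he hπ hW hqW hqΓ⟩

end TypeIA

end EL

open EL in
/-- A smooth integral nondegenerate `n`-fold `X ⊂ ℙ^{2n}` (`n ≥ 2`) with
`σ₂(X) = ℙ^{2n}` is of type IA iff it is a QEL-manifold, i.e. its general entry locus is
an irreducible conic (an irreducible degree-2 curve spanning a plane). -/
theorem statement9 {k : Type} [Field k] [IsAlgClosed k] [CharZero k]
    (n : ℕ) (hn : 2 ≤ n) (X : Set (PS k (2*n+1)))
    (hX : IsVariety X) (hnd : Nondeg X) (hdim : pdim X = (n : WithBot ℕ∞))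
    (hsm : IsSmoothVar X n) (hsec : secant X 2 = Set.univ) :
    ((TypeI X ∧ TypeA X) ↔
      Generic (fun q : PS k (2*n+1) =>
        IsIrreducible (entryLocus X q) ∧ spanDim (entryLocus X q) = 2 ∧
        HasDegree (entryLocus X q) 1 2)) := by
  refine ⟨fun h => conic_of_typeI_typeA hn hX.1 hX.2.nonempty hsm hsec h.1 h.2, fun h => ?_⟩
  obtain ⟨U, hU, hUd, hq⟩ := h
  exact typeI_typeA_of_conic hX.1 (exists_notMem_of_smooth (by omega) hsm)
    ⟨U, hU, hUd, fun q hqU => ⟨(hq q hqU).1, (hq q hqU).2.1⟩⟩
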